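/- Define the alternating sum of prime divisors function A*(n) = ∑_{j=1}^{Ω(n)} (−1)^{j−1} P_j(n), where P_j(n) is the j-th largest prime factor of n counted with multiplicity and Ω(n) is the number of prime factors of n with multiplicity (so A*(1) = 0). Fix K ≥ 1. Then for every ε > 0 there exists x₀ such that for all x ≥ x₀, all positive integers q ≤ (log x)^K, and all integers a, one has |#{n ≤ x : A*(n) ≡ a (mod q)} − x/q| ≤ ε·x/q. That is, A*(n) is asymptotically uniformly distributed modulo q, uniformly for q ≤ (log x)^K. -/

import Mathlib

/-- The number of positive integers `n ≤ x` satisfying the predicate `P`. -/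
noncomputable def cnt (x : ℝ) (P : ℕ → Prop) : ℕ :=
  Set.ncard {n : ℕ | 0 < n ∧ (n : ℝ) ≤ x ∧ P n}

/-- The alternating sum of prime divisors function
`A*(n) = ∑_{j=1}^{Ω(n)} (−1)^{j−1} P_j(n)`, where `P_j(n)` is the `j`-th largest prime
factor of `n` counted with multiplicity (so `A*(1) = 0`). Here
`(n.primeFactorsList).reverse` lists the prime factors of `n` with multiplicity in
decreasing order, its `(j-1)`-th entry being `P_j(n)`. -/
def Astar (n : ℕ) : ℤ :=
  ∑ j ∈ Finset.range (n.primeFactorsList).length,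
    (-1 : ℤ) ^ j * ((n.primeFactorsList).reverse.getD j 0 : ℤ)


section A1
open MeasureTheory Filter Topology Set intervalIntegral

/-- Fejer type kernel. -/
noncomputable def fejK (w : ℝ) : ℝ := ∫ s in (0:ℝ)..1, 2 * (1 - s) * Real.cos (s * w)

lemma fejK_eq {w : ℝ} (hw : w ≠ 0) : fejK w = 2 * (1 - Real.cos w) / w ^ 2 := by
  unfold fejK
  have h : ∀ s ∈ uIcc (0:ℝ) 1, HasDerivAt
      (fun s => 2 * ((1 - s) * Real.sin (s * w) / w - Real.cos (s * w) / w ^ 2))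
      (2 * (1 - s) * Real.cos (s * w)) s := by
    intro s _
    have h1 : HasDerivAt (fun s : ℝ => s * w) w s := by
      simpa using (hasDerivAt_id s).mul_const w
    have h2 := h1.sin
    have h3 := h1.cos
    have h4 : HasDerivAt (fun s : ℝ => 1 - s) (-1) s := by
      simpa using (hasDerivAt_id s).const_sub 1
    have h5 := (((h4.mul h2).div_const w).sub (h3.div_const (w^2))).const_mul 2
    refine h5.congr_deriv ?_
    field_simp
    ring
  rw [integral_eq_sub_of_hasDerivAt h]
  · simp
    field_simp
    ring
  · apply Continuous.intervalIntegrable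
    fun_prop

lemma fejK_zero : fejK 0 = 1 := by
  unfold fejK
  simp only [mul_zero, Real.cos_zero, mul_one]
  rw [intervalIntegral.integral_const_mul, intervalIntegral.integral_sub (by simp) (by simp)]
  simp
  norm_num

lemma fejK_nonneg (w : ℝ) : 0 ≤ fejK w := by
  by_cases hw : w = 0
  · rw [hw, fejK_zero]; norm_num
  · rw [fejK_eq hw]
    have := Real.cos_le_one w
    apply div_nonneg _ (sq_nonneg w)
    linarith

lemma fejK_le (w : ℝ) : fejK w ≤ 5 * (1 + w ^ 2)⁻¹ := by
  by_cases hw : w = 0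
  · rw [hw, fejK_zero]; norm_num
  · rw [fejK_eq hw]
    have h1 := Real.one_sub_sq_div_two_le_cos (x := w)
    have h2 := Real.neg_one_le_cos w
    have hw2 : 0 < w ^ 2 := by positivity
    rw [← div_eq_mul_inv, div_le_div_iff₀ hw2 (by positivity)]
    nlinarith

lemma fejK_cont : Continuous fejK := by
  unfold fejK
  apply continuous_parametric_intervalIntegral_of_continuous'
  fun_prop

lemma fejK_integrable : Integrable fejK := by
  refine (integrable_inv_one_add_sq.const_mul 5).mono' fejK_cont.aestronglyMeasurable ?_
  filter_upwards with w
  rw [Real.norm_of_nonneg (fejK_nonneg w)]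
  exact fejK_le w

lemma fejK_integral_pos : 0 < ∫ w, fejK w := by
  rw [integral_pos_iff_support_of_nonneg fejK_nonneg fejK_integrable]
  exact (fejK_cont.isOpen_support).measure_pos volume ⟨0, by simp [fejK_zero]⟩

lemma fejK_tendsto (c : ℝ) (hc : 0 < c) :
    Tendsto (fun l : ℝ => ∫ w in (-(l * c))..(l * c), fejK w) atTop (𝓝 (∫ w, fejK w)) := by
  apply intervalIntegral_tendsto_integral fejK_integrable
  · exact tendsto_neg_atTop_atBot.comp (tendsto_id.atTop_mul_const hc)
  · exact tendsto_id.atTop_mul_const hc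

/-- the scaled kernel -/
noncomputable def fejS (l w : ℝ) : ℝ := l * fejK (l * w)

lemma fejS_nonneg {l : ℝ} (hl : 0 < l) (w : ℝ) : 0 ≤ fejS l w :=
  mul_nonneg hl.le (fejK_nonneg _)

lemma fejS_cont (l : ℝ) : Continuous (fejS l) := by
  unfold fejS
  have := fejK_cont
  fun_prop

lemma fejS_integrable {l : ℝ} (hl : 0 < l) : Integrable (fejS l) :=
  (fejK_integrable.comp_mul_left' hl.ne').const_mul l

lemma fejS_integral {l : ℝ} (hl : 0 < l) : ∫ w, fejS l w = ∫ w, fejK w := by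
  unfold fejS
  rw [MeasureTheory.integral_const_mul, Measure.integral_comp_mul_left]
  rw [abs_of_pos (inv_pos.2 hl), smul_eq_mul, ← mul_assoc, mul_inv_cancel₀ hl.ne', one_mul]

lemma fejS_interval {l : ℝ} (c : ℝ) :
    ∫ w in (-c)..c, fejS l w = ∫ w in (-(l * c))..(l * c), fejK w := by
  unfold fejS
  rw [intervalIntegral.integral_const_mul, intervalIntegral.mul_integral_comp_mul_left]
  simp

lemma fejS_refl_integrable {l : ℝ} (hl : 0 < l) (v : ℝ) : Integrable (fun u => fejS l (v - u)) :=
  (fejS_integrable hl).comp_sub_left v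

lemma fejS_refl_integral {l : ℝ} (hl : 0 < l) (v : ℝ) :
    ∫ u, fejS l (v - u) = ∫ w, fejK w := by
  rw [integral_sub_left_eq_self (fun u => fejS l u) volume v, fejS_integral hl]

lemma fejS_refl_interval {l : ℝ} (v c : ℝ) :
    ∫ u in (v - c)..(v + c), fejS l (v - u) = ∫ w in (-(l * c))..(l * c), fejK w := by
  rw [intervalIntegral.integral_comp_sub_left (fun u => fejS l u), ← fejS_interval]
  congr 1 <;> ring

end A1

section A2
open MeasureTheory Filter Topology Set intervalIntegral

lemma tau_base_integrable (D : ℝ → ℝ) (hm : Measurable D) (M : ℝ) (hM : ∀ u, 0 ≤ u → |D u| ≤ M)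
    {δ : ℝ} (hδ : 0 < δ) :
    IntegrableOn (fun u => D u * Real.exp (-δ * u)) (Ioi 0) := by
  have h := (integrableOn_exp_mul_Ioi (neg_lt_zero.2 hδ) 0).const_mul M
  refine h.mono' (by fun_prop) ?_
  filter_upwards [ae_restrict_mem measurableSet_Ioi] with u hu
  rw [norm_mul, Real.norm_eq_abs, Real.norm_eq_abs, Real.abs_exp]
  exact mul_le_mul_of_nonneg_right (hM u (le_of_lt hu)) (Real.exp_pos _).le

lemma tau_re (D : ℝ → ℝ) (hm : Measurable D) (M : ℝ) (hM : ∀ u, 0 ≤ u → |D u| ≤ M)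
    {δ : ℝ} (hδ : 0 < δ) (y v : ℝ) :
    (Complex.exp (Complex.I * (y * v)) *
      ∫ u in Ioi (0:ℝ), (D u : ℂ) * Complex.exp (-(u * (δ + Complex.I * y)))).re =
    ∫ u in Ioi (0:ℝ), D u * Real.exp (-δ * u) * Real.cos (y * (v - u)) := by
  rw [← MeasureTheory.integral_const_mul]
  have hre : ∀ f : ℝ → ℂ, IntegrableOn f (Ioi 0) →
    (∫ u in Ioi (0:ℝ), f u).re = ∫ u in Ioi (0:ℝ), (f u).re := fun f hf =>
      (integral_re hf).symm
  have key : ∀ u : ℝ, Complex.exp (Complex.I * (y * v)) *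
      ((D u : ℂ) * Complex.exp (-(u * (δ + Complex.I * y)))) =
      (D u * Real.exp (-δ * u) : ℝ) * Complex.exp ((y * (v - u) : ℝ) * Complex.I) := by
    intro u
    push_cast
    rw [mul_left_comm, ← Complex.exp_add, mul_assoc, ← Complex.exp_add]
    congr 2
    ring
  simp_rw [key]
  rw [hre]
  · apply MeasureTheory.integral_congr_ae
    filter_upwards with u
    rw [Complex.re_ofReal_mul, Complex.exp_ofReal_mul_I_re]
  · refine (tau_base_integrable D hm M hM hδ).norm.mono' ?_ ?_
    · apply Measurable.aestronglyMeasurable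
      fun_prop
    · filter_upwards with u
      rw [norm_mul, Complex.norm_exp_ofReal_mul_I, mul_one, Complex.norm_real]

lemma tau_fubini (D : ℝ → ℝ) (hm : Measurable D) (M : ℝ) (hM : ∀ u, 0 ≤ u → |D u| ≤ M)
    (g : ℂ → ℂ)
    (hg : ∀ s : ℂ, 0 < s.re → ∫ u in Ioi (0:ℝ), (D u : ℂ) * Complex.exp (-(u * s)) = g s)
    {δ : ℝ} (hδ : 0 < δ) (l v : ℝ) :
    ∫ u in Ioi (0:ℝ), D u * Real.exp (-δ * u) * fejS l (v - u) =
    ∫ s in (0:ℝ)..1, (2 * (1 - s) * l) *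
      (Complex.exp (Complex.I * ((s * l : ℝ) * v)) * g (δ + Complex.I * (s * l : ℝ))).re := by
  have h1 : ∀ s : ℝ, (Complex.exp (Complex.I * ((s * l : ℝ) * v)) *
      g (δ + Complex.I * (s * l : ℝ))).re =
      ∫ u in Ioi (0:ℝ), D u * Real.exp (-δ * u) * Real.cos ((s * l) * (v - u)) := by
    intro s
    rw [← hg _ (by simpa using hδ)]
    exact tau_re D hm M hM hδ (s * l) v
  simp_rw [h1]
  rw [intervalIntegral.integral_of_le zero_le_one]
  simp_rw [← MeasureTheory.integral_const_mul]
  rw [MeasureTheory.integral_integral_swap]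
  · apply MeasureTheory.integral_congr_ae
    filter_upwards with u
    unfold fejS fejK
    rw [intervalIntegral.integral_of_le zero_le_one]
    rw [← MeasureTheory.integral_const_mul, ← MeasureTheory.integral_const_mul]
    apply MeasureTheory.integral_congr_ae
    filter_upwards with s
    rw [mul_assoc s l]
    ring
  · have hb := (tau_base_integrable D hm M hM hδ)
    have hc : Integrable (fun s : ℝ => (2 * (1 - s) * l)) (volume.restrict (Ioc (0:ℝ) 1)) := by
      apply (Continuous.integrableOn_Icc (by fun_prop)).mono_set Ioc_subset_Icc_self
    have := hc.mul_prod hb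
    refine this.norm.mono' ?_ ?_
    · apply Measurable.aestronglyMeasurable
      unfold Function.uncurry
      fun_prop
    · filter_upwards with p
      simp only [Function.uncurry, norm_mul]
      rw [← mul_assoc]
      have : ‖Real.cos (p.1 * l * (v - p.2))‖ ≤ 1 := Real.abs_cos_le_one _
      exact mul_le_of_le_one_right (by positivity) this

/-- Limit as `δ → 0`. -/
lemma tau_limit (g : ℂ → ℂ) (hg : ContinuousOn g {s | 0 ≤ s.re}) (l v : ℝ) :
    Tendsto (fun δ : ℝ => ∫ s in (0:ℝ)..1, (2 * (1 - s) * l) *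
      (Complex.exp (Complex.I * ((s * l : ℝ) * v)) * g (δ + Complex.I * (s * l : ℝ))).re)
      (𝓝[>] 0) (𝓝 (∫ s in (0:ℝ)..1, (2 * (1 - s) * l) *
      (Complex.exp (Complex.I * ((s * l : ℝ) * v)) * g (Complex.I * (s * l : ℝ))).re)) := by
  set h : ℝ → ℝ → ℝ := fun δ s => (2 * (1 - s) * l) *
      (Complex.exp (Complex.I * ((s * l : ℝ) * v)) * g ((max δ 0 : ℝ) + Complex.I * (s * l : ℝ))).re
    with hh
  have hcont : Continuous (Function.uncurry h) := by
    have : Continuous (fun p : ℝ × ℝ => g ((max p.1 0 : ℝ) + Complex.I * (p.2 * l : ℝ))) := by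
      apply hg.comp_continuous
      · fun_prop
      · intro p; simp
    have e1 : Continuous (fun p : ℝ × ℝ => 2 * (1 - p.2) * l) := by fun_prop
    have e2 : Continuous (fun p : ℝ × ℝ => Complex.exp (Complex.I * ((p.2 * l : ℝ) * v))) := by
      fun_prop
    exact e1.mul (Complex.continuous_re.comp (e2.mul this))
  have h2 : Tendsto (fun δ => ∫ s in (0:ℝ)..1, h δ s) (𝓝 0) (𝓝 (∫ s in (0:ℝ)..1, h 0 s)) :=
    (continuous_parametric_intervalIntegral_of_continuous' hcont 0 1).tendsto 0
  have h3 := h2.mono_left (nhdsWithin_le_nhds (s := Ioi (0:ℝ)))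
  simp only [hh, max_self, Complex.ofReal_zero, zero_add] at h3
  refine h3.congr' ?_
  filter_upwards [self_mem_nhdsWithin] with δ hδ
  rw [max_eq_left (le_of_lt hδ)]

/-- Riemann-Lebesgue. -/
lemma tau_RL (g : ℂ → ℂ) (l : ℝ) (hl : 0 < l) (hg : ContinuousOn g {s | 0 ≤ s.re}) :
    Tendsto (fun v : ℝ => ∫ s in (0:ℝ)..1, (2 * (1 - s) * l) *
      (Complex.exp (Complex.I * ((s * l : ℝ) * v)) * g (Complex.I * (s * l : ℝ))).re)
      atTop (𝓝 0) := by
  set f : ℝ → ℂ := (Ioc (0:ℝ) 1).indicator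
    (fun s => ((2 * (1 - s) * l : ℝ) : ℂ) * g (Complex.I * (s * l : ℝ))) with hf
  have h1 := Real.tendsto_integral_exp_smul_cocompact f
  have h2 : Tendsto (fun v : ℝ => -(l / (2 * Real.pi)) * v) atTop (cocompact ℝ) := by
    apply Tendsto.mono_right _ atBot_le_cocompact
    apply Tendsto.const_mul_atTop_of_neg _ tendsto_id
    have := Real.pi_pos
    simp only [neg_lt_zero]; positivity
  have h3 := (Complex.continuous_re.tendsto 0).comp (h1.comp h2)
  simp only [Complex.zero_re] at h3
  refine h3.congr ?_
  intro v
  simp only [Function.comp]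
  have h4 : ∀ s : ℝ, Real.fourierChar (-(s * (-(l / (2 * Real.pi)) * v))) • f s =
      (Ioc (0:ℝ) 1).indicator (fun s : ℝ => ((2 * (1 - s) * l : ℝ) : ℂ) *
      (Complex.exp (Complex.I * ((s * l : ℝ) * v)) * g (Complex.I * (s * l : ℝ)))) s := by
    intro s
    rw [hf, Circle.smul_def, Real.fourierChar_apply]
    by_cases hs : s ∈ Ioc (0:ℝ) 1
    · rw [indicator_of_mem hs, indicator_of_mem hs, smul_eq_mul]
      have : (((2 * Real.pi * -(s * (-(l / (2 * Real.pi)) * v)) : ℝ)) : ℂ) * Complex.I =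
        Complex.I * ((s * l : ℝ) * v) := by
        have : (2 * Real.pi * -(s * (-(l / (2 * Real.pi)) * v)) : ℝ) = s * l * v := by
          have := Real.pi_ne_zero
          field_simp
        rw [this]; push_cast; ring
      rw [this]; ring
    · rw [indicator_of_notMem hs, indicator_of_notMem hs, smul_zero]
  simp_rw [h4]
  rw [MeasureTheory.integral_indicator measurableSet_Ioc,
    intervalIntegral.integral_of_le zero_le_one]
  have hre : ∀ f : ℝ → ℂ, IntegrableOn f (Ioc 0 1) →
    (∫ u in Ioc (0:ℝ) 1, f u).re = ∫ u in Ioc (0:ℝ) 1, (f u).re := fun f hf =>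
      (integral_re hf).symm
  rw [hre]
  · apply MeasureTheory.integral_congr_ae
    filter_upwards with s
    rw [Complex.re_ofReal_mul]
  · have : Continuous (fun p : ℝ => g (Complex.I * (p * l : ℝ))) := by
      apply hg.comp_continuous
      · fun_prop
      · intro p; simp
    have e1 : Continuous (fun s : ℝ => ((2 * (1 - s) * l : ℝ) : ℂ)) := by fun_prop
    have e2 : Continuous (fun s : ℝ => Complex.exp (Complex.I * ((s * l : ℝ) * v))) := by
      fun_prop
    exact (Continuous.integrableOn_Icc (e1.mul (e2.mul this))).mono_set Ioc_subset_Icc_self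

end A2

section A3
open MeasureTheory Filter Topology Set

lemma tau_int (H : ℝ → ℝ) (hm : Measurable H) (M : ℝ) (hM : ∀ u, 0 ≤ u → |H u| ≤ M)
    {δ l : ℝ} (hδ : 0 < δ) (hl : 0 < l) (v : ℝ) :
    IntegrableOn (fun u => H u * Real.exp (-δ * u) * fejS l (v - u)) (Ioi 0) := by
  have h := ((fejS_refl_integrable hl v).const_mul M).integrableOn (s := Ioi 0)
  have hc := fejS_cont l
  refine h.mono' ?_ ?_
  · apply Measurable.aestronglyMeasurable
    have := hc.measurable
    fun_prop
  · filter_upwards [ae_restrict_mem measurableSet_Ioi] with u hu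
    rw [norm_mul, norm_mul, Real.norm_eq_abs, Real.norm_eq_abs, Real.abs_exp,
      Real.norm_of_nonneg (fejS_nonneg hl _)]
    apply mul_le_mul_of_nonneg_right _ (fejS_nonneg hl _)
    have hu' : 0 < u := hu
    have h1 : Real.exp (-δ * u) ≤ 1 := by
      rw [Real.exp_le_one_iff]; nlinarith
    exact (mul_le_of_le_one_right (abs_nonneg _) h1).trans (hM u hu'.le)

lemma tau_upper_aux (H : ℝ → ℝ) (hm : Measurable H) (A C : ℝ) (hA : 0 ≤ A)
    (h0 : ∀ u, 0 ≤ u → 0 ≤ H u) (hC : ∀ u, 0 ≤ u → H u ≤ C)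
    (hslow : ∀ u w, 0 ≤ u → u ≤ w → H u ≤ H w * Real.exp (w - u))
    {δ l c v : ℝ} (hδ : 0 < δ) (hl : 0 < l) (hc : 0 < c) (hv : 0 ≤ v) :
    H v * Real.exp (-(2 * c)) * Real.exp (-δ * (v + 2 * c)) *
      (∫ w in (-(l * c))..(l * c), fejK w) ≤
    (∫ u in Ioi (0:ℝ), (H u - A) * Real.exp (-δ * u) * fejS l ((v + c) - u))
      + A * ∫ w, fejK w := by
  have i1 := tau_int H hm C (fun u hu => by rw [abs_of_nonneg (h0 u hu)]; exact hC u hu) hδ hl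
    (v + c)
  have i2 := tau_int (fun _ => A) measurable_const A (fun u hu => by rw [abs_of_nonneg hA]) hδ hl
    (v + c)
  have e1 : ∫ u in Ioi (0:ℝ), (H u - A) * Real.exp (-δ * u) * fejS l ((v + c) - u) =
      (∫ u in Ioi (0:ℝ), H u * Real.exp (-δ * u) * fejS l ((v + c) - u)) -
      ∫ u in Ioi (0:ℝ), A * Real.exp (-δ * u) * fejS l ((v + c) - u) := by
    rw [← integral_sub i1 i2]
    congr 1; ext u; ring
  have e2 : ∫ u in Ioi (0:ℝ), A * Real.exp (-δ * u) * fejS l ((v + c) - u) ≤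
      A * ∫ w, fejK w := by
    rw [← fejS_refl_integral hl (v + c), ← integral_const_mul]
    have j := (fejS_refl_integrable hl (v + c)).const_mul A
    refine le_trans (setIntegral_mono_on i2 j.integrableOn measurableSet_Ioi ?_)
      (setIntegral_le_integral j ?_)
    · intro u hu
      apply mul_le_mul_of_nonneg_right _ (fejS_nonneg hl _)
      apply mul_le_of_le_one_right hA
      rw [Real.exp_le_one_iff]; have : 0 < u := hu; nlinarith
    · filter_upwards with u
      exact mul_nonneg hA (fejS_nonneg hl _)
  have e3 : H v * Real.exp (-(2 * c)) * Real.exp (-δ * (v + 2 * c)) *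
      (∫ w in (-(l * c))..(l * c), fejK w) ≤
      ∫ u in Ioi (0:ℝ), H u * Real.exp (-δ * u) * fejS l ((v + c) - u) := by
    rw [← fejS_refl_interval (v + c) c, intervalIntegral.integral_of_le (by linarith),
      ← integral_const_mul]
    have hsub : Ioc (v + c - c) (v + c + c) ⊆ Ioi 0 := by
      intro u hu; have := hu.1; simp at this ⊢; linarith
    refine le_trans (setIntegral_mono_on
      (((fejS_refl_integrable hl (v + c)).const_mul _).integrableOn) (i1.mono_set hsub)
      measurableSet_Ioc ?_) (setIntegral_mono_set i1 ?_ (Eventually.of_forall hsub))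
    · intro u hu
      have hu1 : v < u := by have := hu.1; linarith
      have hu2 : u ≤ v + 2 * c := by have := hu.2; linarith
      apply mul_le_mul_of_nonneg_right _ (fejS_nonneg hl _)
      apply mul_le_mul _ _ (Real.exp_pos _).le (h0 u (by linarith))
      · have := hslow v u hv hu1.le
        calc H v * Real.exp (-(2 * c)) ≤ H u * Real.exp (u - v) * Real.exp (-(2 * c)) :=
              mul_le_mul_of_nonneg_right this (Real.exp_pos _).le
          _ = H u * Real.exp (u - v - 2 * c) := by rw [mul_assoc, ← Real.exp_add]; rfl
          _ ≤ H u := by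
              apply mul_le_of_le_one_right (h0 u (by linarith))
              rw [Real.exp_le_one_iff]; linarith
      · rw [Real.exp_le_exp]; nlinarith
    · filter_upwards [ae_restrict_mem measurableSet_Ioi] with u hu
      exact mul_nonneg (mul_nonneg (h0 u (le_of_lt hu)) (Real.exp_pos _).le) (fejS_nonneg hl _)
  linarith

lemma tau_lower_aux (H : ℝ → ℝ) (hm : Measurable H) (A C : ℝ) (hA : 0 ≤ A)
    (h0 : ∀ u, 0 ≤ u → 0 ≤ H u) (hC : ∀ u, 0 ≤ u → H u ≤ C)
    (hslow : ∀ u w, 0 ≤ u → u ≤ w → H u ≤ H w * Real.exp (w - u))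
    {δ l c v : ℝ} (hδ : 0 < δ) (hl : 0 < l) (hc : 0 < c) (hv : 2 * c ≤ v) :
    (∫ u in Ioi (0:ℝ), (H u - A) * Real.exp (-δ * u) * fejS l ((v - c) - u))
      + A * Real.exp (-δ * v) * (∫ w in (-(l * c))..(l * c), fejK w) ≤
    H v * Real.exp (2 * c) * (∫ w in (-(l * c))..(l * c), fejK w) +
      C * ((∫ w, fejK w) - (∫ w in (-(l * c))..(l * c), fejK w)) := by
  have i1 := tau_int H hm C (fun u hu => by rw [abs_of_nonneg (h0 u hu)]; exact hC u hu) hδ hl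
    (v - c)
  have i2 := tau_int (fun _ => A) measurable_const A (fun u hu => by rw [abs_of_nonneg hA]) hδ hl
    (v - c)
  have hC0 : 0 ≤ C := (h0 0 le_rfl).trans (hC 0 le_rfl)
  have e1 : ∫ u in Ioi (0:ℝ), (H u - A) * Real.exp (-δ * u) * fejS l ((v - c) - u) =
      (∫ u in Ioi (0:ℝ), H u * Real.exp (-δ * u) * fejS l ((v - c) - u)) -
      ∫ u in Ioi (0:ℝ), A * Real.exp (-δ * u) * fejS l ((v - c) - u) := by
    rw [← integral_sub i1 i2]
    congr 1; ext u; ring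
  have hsub : Ioc (v - c - c) (v - c + c) ⊆ Ioi 0 := by
      intro u hu; have := hu.1; simp at this ⊢; linarith
  have jint := fejS_refl_integrable hl (v - c)
  have e2 : A * Real.exp (-δ * v) * (∫ w in (-(l * c))..(l * c), fejK w) ≤
      ∫ u in Ioi (0:ℝ), A * Real.exp (-δ * u) * fejS l ((v - c) - u) := by
    rw [← fejS_refl_interval (v - c) c, intervalIntegral.integral_of_le (by linarith),
      ← integral_const_mul]
    refine le_trans (setIntegral_mono_on
      ((jint.const_mul _).integrableOn) (i2.mono_set hsub)
      measurableSet_Ioc ?_) (setIntegral_mono_set i2 ?_ (Eventually.of_forall hsub))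
    · intro u hu
      have hu2 : u ≤ v := by have := hu.2; linarith
      apply mul_le_mul_of_nonneg_right _ (fejS_nonneg hl _)
      apply mul_le_mul_of_nonneg_left _ hA
      rw [Real.exp_le_exp]; nlinarith
    · filter_upwards with u
      exact mul_nonneg (mul_nonneg hA (Real.exp_pos _).le) (fejS_nonneg hl _)
  have e3 : ∫ u in Ioi (0:ℝ), H u * Real.exp (-δ * u) * fejS l ((v - c) - u) ≤
      H v * Real.exp (2 * c) * (∫ w in (-(l * c))..(l * c), fejK w) +
      C * ((∫ w, fejK w) - (∫ w in (-(l * c))..(l * c), fejK w)) := by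
    rw [← fejS_refl_integral hl (v - c), ← fejS_refl_interval (v - c) c,
      intervalIntegral.integral_of_le (by linarith)]
    set B := Ioc (v - c - c) (v - c + c) with hB
    have hBm : MeasurableSet B := measurableSet_Ioc
    rw [← setIntegral_compl hBm jint, ← integral_const_mul, ← integral_const_mul]
    have split : ∫ u in Ioi (0:ℝ), H u * Real.exp (-δ * u) * fejS l ((v - c) - u) =
      (∫ u in B, H u * Real.exp (-δ * u) * fejS l ((v - c) - u)) +
      ∫ u in Ioi (0:ℝ) \ B, H u * Real.exp (-δ * u) * fejS l ((v - c) - u) := by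
      rw [← integral_inter_add_diff hBm i1, inter_eq_self_of_subset_right hsub]
    rw [split]
    apply add_le_add
    · refine setIntegral_mono_on (i1.mono_set hsub) (jint.const_mul _).integrableOn hBm ?_
      intro u hu
      have hu0 : 0 < u := hsub hu
      have hu1 : v - 2 * c < u := by have := hu.1; linarith
      have hu2 : u ≤ v := by have := hu.2; linarith
      apply mul_le_mul_of_nonneg_right _ (fejS_nonneg hl _)
      calc H u * Real.exp (-δ * u) ≤ H u := by
              apply mul_le_of_le_one_right (h0 u hu0.le)
              rw [Real.exp_le_one_iff]; nlinarith
        _ ≤ H v * Real.exp (v - u) := hslow u v hu0.le hu2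
        _ ≤ _ := by
            apply mul_le_mul_of_nonneg_left _ (h0 v (by linarith))
            rw [Real.exp_le_exp]; linarith
    · refine le_trans (setIntegral_mono_on (i1.mono_set diff_subset)
        (jint.const_mul C).integrableOn (measurableSet_Ioi.diff hBm) ?_)
        (setIntegral_mono_set (jint.const_mul C).integrableOn ?_
          (Eventually.of_forall (fun u hu => hu.2)))
      · intro u hu
        have hu0 : 0 < u := hu.1
        apply mul_le_mul_of_nonneg_right _ (fejS_nonneg hl _)
        calc H u * Real.exp (-δ * u) ≤ H u := by
              apply mul_le_of_le_one_right (h0 u hu0.le)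
              rw [Real.exp_le_one_iff]; nlinarith
          _ ≤ C := hC u hu0.le
      · filter_upwards with u
        exact mul_nonneg hC0 (fejS_nonneg hl _)
  linarith

theorem tauber_H (H : ℝ → ℝ) (hm : Measurable H) (A C : ℝ) (hA : 0 ≤ A)
    (h0 : ∀ u, 0 ≤ u → 0 ≤ H u) (hC : ∀ u, 0 ≤ u → H u ≤ C)
    (hslow : ∀ u w, 0 ≤ u → u ≤ w → H u ≤ H w * Real.exp (w - u))
    (g : ℂ → ℂ) (hgc : ContinuousOn g {s | 0 ≤ s.re})
    (hg : ∀ s : ℂ, 0 < s.re →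
      ∫ u in Ioi (0:ℝ), ((H u - A : ℝ) : ℂ) * Complex.exp (-(u * s)) = g s) :
    Tendsto H atTop (𝓝 A) := by
  set I := ∫ w, fejK w with hI
  have hIpos : 0 < I := fejK_integral_pos
  have hC0 : 0 ≤ C := (h0 0 le_rfl).trans (hC 0 le_rfl)
  set R : ℝ → ℝ → ℝ := fun l v => ∫ s in (0:ℝ)..1, (2 * (1 - s) * l) *
      (Complex.exp (Complex.I * ((s * l : ℝ) * v)) * g (Complex.I * (s * l : ℝ))).re with hR
  have hDb : ∀ u, 0 ≤ u → |H u - A| ≤ C + A := by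
    intro u hu
    have := h0 u hu
    have := hC u hu
    rw [abs_le]; constructor <;> linarith
  have hlim : ∀ l v, Tendsto (fun δ : ℝ =>
      ∫ u in Ioi (0:ℝ), (H u - A) * Real.exp (-δ * u) * fejS l (v - u)) (𝓝[>] 0)
      (𝓝 (R l v)) := by
    intro l v
    refine (tau_limit g hgc l v).congr' ?_
    filter_upwards [self_mem_nhdsWithin] with δ hδ
    exact (tau_fubini (fun u => H u - A) (hm.sub_const A) (C + A) hDb g hg hδ l v).symm
  have hup : ∀ l c v, 0 < l → 0 < c → 0 ≤ v →
      H v * Real.exp (-(2 * c)) * (∫ w in (-(l * c))..(l * c), fejK w) ≤ R l (v + c) + A * I := by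
    intro l c v hl hc hv
    have t1 := (hlim l (v + c)).add_const (A * I)
    have t2 : Tendsto (fun δ : ℝ => H v * Real.exp (-(2 * c)) * Real.exp (-δ * (v + 2 * c)) *
      (∫ w in (-(l * c))..(l * c), fejK w)) (𝓝[>] 0)
      (𝓝 (H v * Real.exp (-(2 * c)) * Real.exp (-0 * (v + 2 * c)) *
      (∫ w in (-(l * c))..(l * c), fejK w))) := by
      apply (Continuous.tendsto _ 0).mono_left nhdsWithin_le_nhds
      fun_prop
    simp only [neg_zero, zero_mul, Real.exp_zero, mul_one] at t2
    refine le_of_tendsto_of_tendsto t2 t1 ?_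
    filter_upwards [self_mem_nhdsWithin] with δ hδ
    exact tau_upper_aux H hm A C hA h0 hC hslow hδ hl hc hv
  have hlo : ∀ l c v, 0 < l → 0 < c → 2 * c ≤ v →
      R l (v - c) + A * (∫ w in (-(l * c))..(l * c), fejK w) ≤
      H v * Real.exp (2 * c) * (∫ w in (-(l * c))..(l * c), fejK w) +
      C * (I - (∫ w in (-(l * c))..(l * c), fejK w)) := by
    intro l c v hl hc hv
    have t2 : Tendsto (fun δ : ℝ => A * Real.exp (-δ * v) *
      (∫ w in (-(l * c))..(l * c), fejK w)) (𝓝[>] 0)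
      (𝓝 (A * Real.exp (-0 * v) *
      (∫ w in (-(l * c))..(l * c), fejK w))) := by
      apply (Continuous.tendsto _ 0).mono_left nhdsWithin_le_nhds
      fun_prop
    simp only [neg_zero, zero_mul, Real.exp_zero, mul_one] at t2
    have t1 := (hlim l (v - c)).add t2
    refine le_of_tendsto t1 ?_
    filter_upwards [self_mem_nhdsWithin] with δ hδ
    exact tau_lower_aux H hm A C hA h0 hC hslow hδ hl hc hv
  rw [Metric.tendsto_atTop]
  intro ε hε
  obtain ⟨c, hc, hc1, hc2⟩ : ∃ c : ℝ, 0 < c ∧ (A + ε / 4) * Real.exp (2 * c) < A + ε / 2 ∧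
      A - ε / 2 < (A - ε / 4) * Real.exp (-(2 * c)) := by
    have t1 : Tendsto (fun c : ℝ => (A + ε / 4) * Real.exp (2 * c)) (𝓝[>] 0)
        (𝓝 ((A + ε / 4) * Real.exp (2 * 0))) :=
      (Continuous.tendsto (by fun_prop) 0).mono_left nhdsWithin_le_nhds
    have t2 : Tendsto (fun c : ℝ => (A - ε / 4) * Real.exp (-(2 * c))) (𝓝[>] 0)
        (𝓝 ((A - ε / 4) * Real.exp (-(2 * 0)))) :=
      (Continuous.tendsto (by fun_prop) 0).mono_left nhdsWithin_le_nhds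
    simp only [mul_zero, neg_zero, Real.exp_zero, mul_one] at t1 t2
    have := (t1.eventually_lt_const (by linarith : A + ε/4 < A + ε/2)).and
      ((t2.eventually_const_lt (by linarith : A - ε/2 < A - ε/4)).and self_mem_nhdsWithin)
    obtain ⟨c, h1, h2, h3⟩ := this.exists
    exact ⟨c, h3, h1, h2⟩
  obtain ⟨l, hl, hJpos, hl1, hl2⟩ : ∃ l : ℝ, 0 < l ∧ 0 < (∫ w in (-(l * c))..(l * c), fejK w) ∧
      A * I < (A + ε / 8) * (∫ w in (-(l * c))..(l * c), fejK w) ∧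
      C * (I - (∫ w in (-(l * c))..(l * c), fejK w)) <
        (ε / 8) * (∫ w in (-(l * c))..(l * c), fejK w) := by
    have t := fejK_tendsto c hc
    have t1 := t.const_mul (A + ε / 8)
    have t2 := ((t.const_sub I).const_mul C).sub (t.const_mul (ε / 8))
    have := (eventually_gt_atTop (0:ℝ)).and ((t.eventually_const_lt hIpos).and
      ((t1.eventually_const_lt (by nlinarith : A * I < (A + ε / 8) * I)).and
      (t2.eventually_lt_const (by rw [← hI]; nlinarith :
        C * (I - ∫ w, fejK w) - ε / 8 * (∫ w, fejK w) < 0))))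
    obtain ⟨l, h1, h2, h3, h4⟩ := this.exists
    exact ⟨l, h1, h2, h3, by linarith⟩
  set J := (∫ w in (-(l * c))..(l * c), fejK w) with hJ
  have hRL : Tendsto (R l) atTop (𝓝 0) := tau_RL g l hl hgc
  have hev : ∀ᶠ v in atTop, |R l v| < (ε / 8) * J := by
    have := hRL.abs
    simp only [abs_zero] at this
    exact this.eventually_lt_const (by positivity)
  obtain ⟨V, hV⟩ := eventually_atTop.1 hev
  refine ⟨max (V + c) (max (2 * c) (max V 0)), fun v hv => ?_⟩
  have hv1 : V + c ≤ v := (le_max_left _ _).trans hv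
  have hv2 : 2 * c ≤ v := ((le_max_left _ _).trans (le_max_right _ _)).trans hv
  have hv3 : V ≤ v := by linarith
  have u1 := hup l c v hl hc (by linarith)
  have u2 := hlo l c v hl hc hv2
  have r1 := abs_lt.1 (hV (v + c) (by linarith))
  have r2 := abs_lt.1 (hV (v - c) (by linarith))
  rw [Real.dist_eq, abs_lt]
  have hee : Real.exp (-(2 * c)) * Real.exp (2 * c) = 1 := by
    rw [← Real.exp_add]; simp
  have x1 : H v * Real.exp (-(2 * c)) < A + ε / 4 := by
    have : (H v * Real.exp (-(2 * c))) * J < (A + ε / 4) * J := by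
      rw [← hJ] at u1; nlinarith [r1.2]
    exact lt_of_mul_lt_mul_right this hJpos.le
  have x2 : A - ε / 4 < H v * Real.exp (2 * c) := by
    have : (A - ε / 4) * J < (H v * Real.exp (2 * c)) * J := by
      rw [← hJ] at u2; nlinarith [r2.1]
    exact lt_of_mul_lt_mul_right this hJpos.le
  have p1 := Real.exp_pos (2 * c)
  have p2 := Real.exp_pos (-(2 * c))
  constructor
  · have : (A - ε / 4) * Real.exp (-(2 * c)) < H v := by
      calc _ < H v * Real.exp (2 * c) * Real.exp (-(2 * c)) := mul_lt_mul_of_pos_right x2 p2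
        _ = H v := by rw [mul_assoc, mul_comm (Real.exp (2*c)), hee, mul_one]
    linarith
  · have : H v < (A + ε / 4) * Real.exp (2 * c) := by
      calc H v = H v * Real.exp (-(2 * c)) * Real.exp (2 * c) := by rw [mul_assoc, hee, mul_one]
        _ < _ := mul_lt_mul_of_pos_right x1 p1
    linarith

end A3

section A4
open MeasureTheory Filter Topology Set

theorem wiener_ikehara (f : ℕ → ℝ) (hf : ∀ n, 0 ≤ f n) (C : ℝ)
    (hC : ∀ n : ℕ, ∑ k ∈ Finset.Icc 1 n, f k ≤ C * n) (A : ℝ) (hA : 0 ≤ A)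
    (G : ℂ → ℂ) (hG : ContinuousOn G {s | 1 ≤ s.re})
    (hGeq : ∀ s : ℂ, 1 < s.re → G s = LSeries (fun n => (f n : ℂ)) s - A / (s - 1)) :
    Tendsto (fun x : ℝ => (∑ k ∈ Finset.Icc 1 ⌊x⌋₊, f k) / x) atTop (𝓝 A) := by
  set S : ℝ → ℝ := fun t => ∑ k ∈ Finset.Icc 1 ⌊t⌋₊, f k with hS
  have hSm : Measurable S := by
    have : S = (fun n : ℕ => ∑ k ∈ Finset.Icc 1 n, f k) ∘ (fun t : ℝ => ⌊t⌋₊) := rfl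
    rw [this]
    exact (measurable_of_countable _).comp Nat.measurable_floor
  have hC0 : 0 ≤ C := by
    have := hC 1
    simp at this
    exact (hf 1).trans this
  have hS0 : ∀ t, 0 ≤ S t := fun t => Finset.sum_nonneg fun k _ => hf k
  have hSC : ∀ t, 0 ≤ t → S t ≤ C * t := fun t ht =>
    (hC _).trans (mul_le_mul_of_nonneg_left (Nat.floor_le ht) hC0)
  have hSmono : Monotone S := by
    intro a b hab
    apply Finset.sum_le_sum_of_subset_of_nonneg
    · exact Finset.Icc_subset_Icc le_rfl (Nat.floor_mono hab)
    · intros; exact hf _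
  set H : ℝ → ℝ := fun u => S (Real.exp u) * Real.exp (-u) with hH
  have hHm : Measurable H := by
    simp only [hH]
    fun_prop
  have hH0 : ∀ u, 0 ≤ H u := fun u => mul_nonneg (hS0 _) (Real.exp_pos _).le
  have hHC : ∀ u, H u ≤ C := by
    intro u
    have := hSC (Real.exp u) (Real.exp_pos _).le
    calc H u ≤ C * Real.exp u * Real.exp (-u) :=
          mul_le_mul_of_nonneg_right this (Real.exp_pos _).le
      _ = C := by rw [mul_assoc, ← Real.exp_add]; simp
  have main : Tendsto H atTop (𝓝 A) := by
    refine tauber_H H hHm A C hA (fun u _ => hH0 u) (fun u _ => hHC u) ?_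
      (fun s => (G (s + 1) - A) / (s + 1)) ?_ ?_
    · intro u w _ huw
      have := hSmono (Real.exp_le_exp.2 huw)
      calc H u ≤ S (Real.exp w) * Real.exp (-u) :=
            mul_le_mul_of_nonneg_right this (Real.exp_pos _).le
        _ = H w * Real.exp (w - u) := by
            simp only [hH]; rw [mul_assoc, ← Real.exp_add]; congr 2; ring
    · apply ContinuousOn.div
      · apply ContinuousOn.sub _ continuousOn_const
        apply hG.comp (by fun_prop)
        intro s hs
        simp at hs ⊢
        exact hs
      · fun_prop
      · intro s hs h
        have := congrArg Complex.re h
        simp at this hs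
        linarith
    · intro s hs
      have hO : (fun n : ℕ => ∑ k ∈ Finset.Icc 1 n, f k) =O[atTop] fun n => (n : ℝ) ^ (1:ℝ) := by
        apply Asymptotics.IsBigO.of_bound C
        filter_upwards with n
        rw [Real.norm_of_nonneg (Finset.sum_nonneg fun k _ => hf k), Real.rpow_one,
          Real.norm_of_nonneg (Nat.cast_nonneg n)]
        exact hC n
      have hL := LSeries_eq_mul_integral_of_nonneg f zero_le_one (s := s + 1)
        (by simpa using hs) hO hf
      have himg : Set.image Real.exp (Ioi 0) = Ioi 1 := by
        ext t
        simp only [mem_image, mem_Ioi]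
        constructor
        · rintro ⟨u, hu, rfl⟩; exact Real.one_lt_exp_iff.2 hu
        · intro ht; exact ⟨Real.log t, Real.log_pos ht, Real.exp_log (by linarith)⟩
      rw [← himg, integral_image_eq_integral_abs_deriv_smul measurableSet_Ioi
        (fun x _ => (Real.hasDerivAt_exp x).hasDerivWithinAt) Real.exp_injective.injOn] at hL
      have hIntg : ∫ u in Ioi (0:ℝ), |Real.exp u| • ((∑ k ∈ Finset.Icc 1 ⌊Real.exp u⌋₊, (f k : ℂ)) *
          ((Real.exp u : ℝ) : ℂ) ^ (-(s + 1 + 1))) =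
          ∫ u in Ioi (0:ℝ), (H u : ℂ) * Complex.exp (-(u * s)) := by
        apply integral_congr_ae
        filter_upwards with u
        have : ((Real.exp u : ℝ) : ℂ) ^ (-(s + 1 + 1)) = Complex.exp (u * (-(s + 1 + 1))) := by
          rw [Complex.cpow_def_of_ne_zero (by simp), ← Complex.ofReal_log (Real.exp_pos _).le,
            Real.log_exp]
        rw [this, abs_of_pos (Real.exp_pos _), Complex.real_smul]
        simp only [hH, hS]
        push_cast
        rw [mul_left_comm, ← Complex.exp_add, mul_assoc, ← Complex.exp_add]
        congr 2; ring
      rw [hIntg] at hL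
      have hs1 : s + 1 ≠ 0 := by
        intro h; have := congrArg Complex.re h; simp at this; linarith
      have hs0 : s ≠ 0 := by
        intro h; rw [h] at hs; simp at hs
      have hexp : ∫ u in Ioi (0:ℝ), (A : ℂ) * Complex.exp (-(u * s)) = A / s := by
        rw [integral_const_mul]
        have := integral_exp_mul_complex_Ioi (a := -s) (by simpa using hs) 0
        simp only [Complex.ofReal_zero, mul_zero, Complex.exp_zero] at this
        have h2 : ∫ u in Ioi (0:ℝ), Complex.exp (-(u * s)) = 1 / s := by
          rw [show (1 : ℂ) / s = -1 / -s by field_simp, ← this]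
          congr 1; ext u; congr 1; ring
        rw [h2]; ring
      have hi0 : ∀ D : ℝ → ℝ, Measurable D → (∃ M, ∀ u, |D u| ≤ M) →
          IntegrableOn (fun u : ℝ => (D u : ℂ) * Complex.exp (-(u * s))) (Ioi 0) := by
        rintro D hD ⟨M, hM⟩
        refine (tau_base_integrable D hD M (fun u _ => hM u) hs).norm.mono' ?_ ?_
        · apply Measurable.aestronglyMeasurable; fun_prop
        · filter_upwards with u
          rw [norm_mul, Complex.norm_exp, Complex.norm_real, norm_mul,
            Real.norm_of_nonneg (Real.exp_pos _).le]
          simp [mul_comm]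
      have hsplit : ∫ u in Ioi (0:ℝ), ((H u - A : ℝ) : ℂ) * Complex.exp (-(u * s)) =
          (∫ u in Ioi (0:ℝ), (H u : ℂ) * Complex.exp (-(u * s))) - A / s := by
        rw [← hexp, ← integral_sub (hi0 H hHm ⟨C, fun u => by
          rw [abs_of_nonneg (hH0 u)]; exact hHC u⟩)
          (hi0 (fun _ => A) measurable_const ⟨|A|, fun u => le_rfl⟩)]
        congr 1; ext u; push_cast; ring
      rw [hsplit, hGeq (s + 1) (by simpa using hs), hL]
      simp only [add_sub_cancel_right]
      field_simp
      ring
  have h2 := main.comp Real.tendsto_log_atTop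
  refine h2.congr' ?_
  filter_upwards [eventually_gt_atTop 0] with x hx
  simp only [hH, Function.comp, Real.exp_neg, Real.exp_log hx]
  rfl
end A4

section Base
open Finset

/-- Primes in the interval `(u, v]`. -/
noncomputable def primesIoc (u v : ℝ) : Finset ℕ := (Ioc ⌊u⌋₊ ⌊v⌋₊).filter Nat.Prime

lemma mem_primesIoc {u v : ℝ} (hu : 0 ≤ u) {p : ℕ} :
    p ∈ primesIoc u v ↔ p.Prime ∧ u < p ∧ (p : ℝ) ≤ v := by
  unfold primesIoc
  rw [mem_filter, mem_Ioc, Nat.floor_lt hu]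
  constructor
  · rintro ⟨⟨h1, h2⟩, h3⟩
    exact ⟨h3, h1, (Nat.le_floor_iff' h3.ne_zero).1 h2⟩
  · rintro ⟨h3, h1, h2⟩
    exact ⟨⟨h1, (Nat.le_floor_iff' h3.ne_zero).2 h2⟩, h3⟩

end Base

section A5
open Filter Topology Finset ArithmeticFunction

theorem primes_AP_window (q : ℕ) [NeZero q] (b : ZMod q) (hb : IsUnit b) (ρ : ℝ) (hρ : 1 < ρ) :
    ∃ z₀ : ℝ, ∀ z : ℝ, z₀ ≤ z →
      ((q.totient : ℝ)⁻¹ * (ρ - 1) / 4) * (z / Real.log z) ≤ (((primesIoc z (ρ * z)).filter (fun p : ℕ => (p : ZMod q) = b)).card : ℝ) := by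
  set f := vonMangoldt.residueClass b with hf
  have hWI := wiener_ikehara f (vonMangoldt.residueClass_nonneg b) (Real.log 4 + 4) ?_
    ((q.totient : ℝ)⁻¹) (by positivity) (vonMangoldt.LFunctionResidueClassAux b)
    (vonMangoldt.continuousOn_LFunctionResidueClassAux b) ?_
  rotate_left
  · intro n
    refine le_trans ?_ (Chebyshev.psi_le_const_mul_self (x := n) (by positivity))
    unfold Chebyshev.psi
    rw [Nat.floor_natCast]
    exact sum_le_sum (fun k _ => vonMangoldt.residueClass_le b k)
  · intro s hs
    have := vonMangoldt.eqOn_LFunctionResidueClassAux hb hs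
    rw [this]
    push_cast
    rfl
  set A := ((q.totient : ℝ)⁻¹) with hA
  have hApos : 0 < A := by
    rw [hA]; have := Nat.totient_pos.2 (NeZero.pos q); positivity
  set S : ℝ → ℝ := fun x => ∑ k ∈ Icc 1 ⌊x⌋₊, f k with hS
  have hρ0 : 0 < ρ := by linarith
  have t1 : Tendsto (fun z : ℝ => S (ρ * z) / z) atTop (𝓝 (A * ρ)) := by
    have := (hWI.comp (tendsto_id.const_mul_atTop hρ0)).mul_const ρ
    refine this.congr' ?_
    filter_upwards [eventually_gt_atTop 0] with z hz
    simp only [Function.comp, id, hS]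
    field_simp
  have t2 := t1.sub hWI
  obtain ⟨C, hC⟩ := Chebyshev.psi_sub_theta_le_mul_sqrt
  have t3 : Tendsto (fun z : ℝ => C * Real.sqrt (ρ * z) / z) atTop (𝓝 0) := by
    have : Tendsto (fun z : ℝ => (C * Real.sqrt ρ) * (Real.sqrt z)⁻¹) atTop (𝓝 ((C * Real.sqrt ρ) * 0)) :=
      (tendsto_inv_atTop_zero.comp Real.tendsto_sqrt_atTop).const_mul _
    rw [mul_zero] at this
    refine this.congr' ?_
    filter_upwards [eventually_gt_atTop 0] with z hz
    rw [Real.sqrt_mul hρ0.le]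
    have h1 : Real.sqrt z ≠ 0 := (Real.sqrt_pos.2 hz).ne'
    have h2 : z = Real.sqrt z * Real.sqrt z := (Real.mul_self_sqrt hz.le).symm
    nth_rewrite 3 [h2]
    field_simp
  have t4 := t2.sub t3
  have hlim : A * (ρ - 1) / 2 < A * ρ - A - 0 := by nlinarith
  have ev := t4.eventually_const_lt hlim
  obtain ⟨z₀, hz₀⟩ := eventually_atTop.1 ev
  refine ⟨max z₀ (max ρ 2), fun z hz => ?_⟩
  have hz1 : z₀ ≤ z := (le_max_left _ _).trans hz
  have hz2 : ρ ≤ z := ((le_max_left _ _).trans (le_max_right _ _)).trans hz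
  have hz3 : 2 ≤ z := ((le_max_right _ _).trans (le_max_right _ _)).trans hz
  have hz0 : 0 < z := by linarith
  have key := hz₀ z hz1
  have key2 : A * (ρ - 1) / 2 * z < S (ρ * z) - S z - C * Real.sqrt (ρ * z) := by
    have : A * (ρ - 1) / 2 * z < (S (ρ * z) / z - S z / z - C * Real.sqrt (ρ * z) / z) * z :=
      mul_lt_mul_of_pos_right key hz0
    refine this.trans_eq ?_
    field_simp
  have hfl : ⌊z⌋₊ ≤ ⌊ρ * z⌋₊ := Nat.floor_mono (by nlinarith)
  have e1 : S (ρ * z) - S z = ∑ k ∈ Ioc ⌊z⌋₊ ⌊ρ * z⌋₊, f k := by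
    simp only [hS]
    rw [sub_eq_iff_eq_add']
    have h1 : ∀ n, Icc 1 n = Ioc 0 n := fun n => by ext k; simp [Nat.succ_le_iff]
    rw [h1, h1, ← sum_union (Finset.disjoint_left.2 (by intro a; simp; omega))]
    rw [Finset.Ioc_union_Ioc_eq_Ioc (Nat.zero_le _) hfl]
  have e2 : ∑ k ∈ Ioc ⌊z⌋₊ ⌊ρ * z⌋₊, f k ≤
      (∑ k ∈ (Ioc ⌊z⌋₊ ⌊ρ * z⌋₊).filter Nat.Prime, f k) +
      (Chebyshev.psi (ρ * z) - Chebyshev.theta (ρ * z)) := by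
    rw [← sum_filter_add_sum_filter_not _ Nat.Prime]
    apply add_le_add le_rfl
    have : Chebyshev.psi (ρ * z) - Chebyshev.theta (ρ * z) =
      ∑ k ∈ (Ioc 0 ⌊ρ * z⌋₊).filter (fun p => ¬ p.Prime), Λ k := by
      unfold Chebyshev.psi Chebyshev.theta
      rw [← sum_filter_add_sum_filter_not (Ioc 0 ⌊ρ * z⌋₊) Nat.Prime]
      rw [sum_congr rfl (fun k hk => vonMangoldt_apply_prime (mem_filter.1 hk).2)]
      ring
    rw [this]
    refine (sum_le_sum (fun k _ => vonMangoldt.residueClass_le b k)).trans ?_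
    apply sum_le_sum_of_subset_of_nonneg
    · apply filter_subset_filter
      apply Ioc_subset_Ioc_left (Nat.zero_le _)
    · intros; exact vonMangoldt_nonneg
  have e3 : (∑ k ∈ (Ioc ⌊z⌋₊ ⌊ρ * z⌋₊).filter Nat.Prime, f k) ≤
      (((primesIoc z (ρ * z)).filter (fun p : ℕ => (p : ZMod q) = b)).card : ℝ) * (2 * Real.log z) := by
    rw [← nsmul_eq_mul, ← sum_const, sum_filter (fun p : ℕ => (p : ZMod q) = b)]
    apply sum_le_sum
    intro p hp
    have hp' := (mem_primesIoc hz0.le).1 hp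
    rw [hf, vonMangoldt.residueClass, Set.indicator_apply]
    by_cases h : (p : ZMod q) = b
    · simp only [Set.mem_setOf_eq, h, if_true]
      rw [vonMangoldt_apply_prime hp'.1]
      have : Real.log p ≤ Real.log (z * z) := by
        apply Real.log_le_log (by exact_mod_cast hp'.1.pos)
        nlinarith [hp'.2.2]
      rw [Real.log_mul hz0.ne' hz0.ne'] at this
      linarith
    · simp [h]
  have e4 := hC (ρ * z)
  have hlog : 0 < Real.log z := Real.log_pos (by linarith)
  rw [← mul_div_assoc, div_le_iff₀ hlog]
  linarith
end A5

section A6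
open Filter Topology Finset

/-- `e(α n)` -/
noncomputable def ee (α : ℝ) (n : ℤ) : ℂ := Complex.exp ((2 * Real.pi * (α * n) : ℝ) * Complex.I)

lemma ee_norm (α : ℝ) (n : ℤ) : ‖ee α n‖ = 1 := Complex.norm_exp_ofReal_mul_I _

lemma ee_add (α : ℝ) (m n : ℤ) : ee α (m + n) = ee α m * ee α n := by
  unfold ee
  rw [← Complex.exp_add]
  congr 1
  push_cast
  ring

lemma ee_zero (α : ℝ) : ee α 0 = 1 := by simp [ee]

lemma ee_neg (α : ℝ) (n : ℤ) : ee α (-n) = (starRingEnd ℂ) (ee α n) := by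
  unfold ee
  rw [← Complex.exp_conj]
  congr 1
  rw [map_mul, Complex.conj_ofReal, Complex.conj_I]
  push_cast
  ring

lemma ee_sub (α : ℝ) (m n : ℤ) : ee α (m - n) = ee α m * (starRingEnd ℂ) (ee α n) := by
  rw [sub_eq_add_neg, ee_add, ee_neg]

lemma ee_period {q : ℕ} (hq : 0 < q) (t : ℤ) {m n : ℤ} (h : (m : ZMod q) = (n : ZMod q)) :
    ee (t / q) m = ee (t / q) n := by
  rw [ZMod.intCast_eq_intCast_iff_dvd_sub] at h
  obtain ⟨k, hk⟩ := h
  have : m = n - q * k := by linarith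
  rw [this, ee_sub]
  have : ee (t / q) (q * k) = 1 := by
    unfold ee
    have hq' : (q : ℝ) ≠ 0 := by positivity
    rw [Complex.exp_eq_one_iff]
    refine ⟨t * k, ?_⟩
    have : (2 * Real.pi * ((t / q : ℝ) * ((q * k : ℤ) : ℝ)) : ℝ) = 2 * Real.pi * (t * k) := by
      push_cast; field_simp
    rw [this]; push_cast; ring
  rw [this]; simp

lemma ee_one_lt {q : ℕ} (hq : 3 ≤ q) (t : ℤ) (ht : IsCoprime t (q : ℤ)) :
    ‖ee (t / q) 1 + ee (t / q) (-1)‖ < 2 := by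
  have h1 : ee (t / q) 1 + ee (t / q) (-1) = ((2 * Real.cos (2 * Real.pi * (t / q)) : ℝ) : ℂ) := by
    rw [ee_neg, Complex.add_conj]
    unfold ee
    rw [Complex.exp_ofReal_mul_I_re]
    norm_num
  rw [h1, Complex.norm_real, Real.norm_eq_abs, abs_mul, abs_two]
  suffices |Real.cos (2 * Real.pi * (t / q))| < 1 by linarith
  refine lt_of_le_of_ne (Real.abs_cos_le_one _) ?_
  intro h
  have hs : Real.sin (2 * Real.pi * (t / q)) = 0 := by
    have := Real.sin_sq_add_cos_sq (2 * Real.pi * (t / q))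
    rw [← sq_abs (Real.cos _), h] at this
    nlinarith
  rw [Real.sin_eq_zero_iff] at hs
  obtain ⟨n, hn⟩ := hs
  have hq' : (q : ℝ) ≠ 0 := by have : 0 < q := by omega
                               positivity
  have hpi := Real.pi_ne_zero
  have h2 : (n : ℝ) * q = 2 * t := by
    field_simp at hn
    linarith
  have h3 : n * q = 2 * t := by exact_mod_cast h2
  have h4 : (q : ℤ) ∣ 2 * t := ⟨n, by linarith⟩
  have h5 : (q : ℤ) ∣ 2 := ht.symm.dvd_of_dvd_mul_right h4
  have := Int.le_of_dvd (by norm_num) h5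
  omega

end A6

section A7
open Filter Topology Finset

/-- the completely multiplicative function `(-1)^(number of odd prime factors)` -/
noncomputable def parH : ℕ →*₀ ℝ where
  toFun n := if n = 0 then 0 else (-1) ^ (n.primeFactorsList.countP (fun p => p % 2 = 1))
  map_zero' := by simp
  map_one' := by simp
  map_mul' m n := by
    by_cases hm : m = 0
    · simp [hm]
    by_cases hn : n = 0
    · simp [hn]
    rw [if_neg hm, if_neg hn, if_neg (mul_ne_zero hm hn),
      (Nat.perm_primeFactorsList_mul hm hn).countP_eq, List.countP_append, pow_add]

lemma parH_apply {n : ℕ} (hn : n ≠ 0) :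
    parH n = (-1) ^ (n.primeFactorsList.countP (fun p => p % 2 = 1)) := by
  change (if n = 0 then (0:ℝ) else _) = _
  rw [if_neg hn]

lemma parH_abs_le (n : ℕ) : |parH n| ≤ 1 := by
  by_cases hn : n = 0
  · simp [hn]
  · rw [parH_apply hn]; simp

lemma parH_prime {p : ℕ} (hp : p.Prime) (h2 : p ≠ 2) : parH p = -1 := by
  rw [parH_apply hp.ne_zero, Nat.primeFactorsList_prime hp]
  have := hp.eq_two_or_odd
  simp [this.resolve_left h2]

lemma parH_two : parH 2 = 1 := by
  rw [parH_apply two_ne_zero, Nat.primeFactorsList_prime Nat.prime_two]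
  simp

noncomputable def parHs {s : ℂ} (hs : s ≠ 0) : ℕ →*₀ ℂ where
  toFun n := (parH n : ℂ) * riemannZetaSummandHom hs n
  map_zero' := by simp
  map_one' := by simp
  map_mul' m n := by simp only [map_mul]; push_cast; ring

lemma parHs_apply {s : ℂ} (hs : s ≠ 0) (n : ℕ) : parHs hs n = (parH n : ℂ) * (n : ℂ) ^ (-s) := rfl

lemma parHs_summable {s : ℂ} (hs : 1 < s.re) :
    Summable (fun n => ‖parHs (Complex.ne_zero_of_one_lt_re hs) n‖) := by
  refine (summable_riemannZetaSummand hs).of_nonneg_of_le (fun n => norm_nonneg _) (fun n => ?_)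
  change ‖(parH n : ℂ) * riemannZetaSummandHom _ n‖ ≤ _
  rw [norm_mul, Complex.norm_real]
  exact mul_le_of_le_one_left (norm_nonneg _) (parH_abs_le n)

lemma parH_term {s : ℂ} (hs : s ≠ 0) (n : ℕ) :
    LSeries.term (fun n => (parH n : ℂ)) s n = parHs hs n := by
  rw [parHs_apply]
  by_cases hn : n = 0
  · simp [hn]
  · rw [LSeries.term_of_ne_zero hn, Complex.cpow_neg, div_eq_mul_inv]

lemma norm_two_cpow_lt {s : ℂ} (hs : 0 < s.re) : ‖(2 : ℂ) ^ (-s)‖ < 1 := by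
  have : ‖((2 : ℕ) : ℂ) ^ (-s)‖ = _ := Complex.norm_natCast_cpow_of_pos (by norm_num) (-s)
  rw [show (2 : ℂ) = ((2 : ℕ) : ℂ) by norm_num, this]
  apply Real.rpow_lt_one_of_one_lt_of_neg
  · norm_num
  · simpa using hs

lemma one_sub_two_cpow_ne {s : ℂ} (hs : 0 < s.re) : (1 : ℂ) - 2 ^ (-s) ≠ 0 := by
  intro h
  have h1 := norm_two_cpow_lt hs
  rw [← sub_eq_zero.1 h] at h1
  simp at h1

lemma one_add_two_cpow_ne {s : ℂ} (hs : 0 < s.re) : (1 : ℂ) + 2 ^ (-s) ≠ 0 := by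
  intro h
  have h1 := norm_two_cpow_lt hs
  rw [eq_neg_of_add_eq_zero_right h] at h1
  simp at h1

lemma parH_LSeries {s : ℂ} (hs : 1 < s.re) :
    LSeries (fun n => (parH n : ℂ)) s * riemannZeta s =
      riemannZeta (2 * s) * ((1 + 2 ^ (-s)) / (1 - 2 ^ (-s))) := by
  classical
  have hs0 : 0 < s.re := by linarith
  have h1 := EulerProduct.eulerProduct_completely_multiplicative_hasProd (parHs_summable hs)
  have h2 := riemannZeta_eulerProduct_hasProd hs
  have h3 := riemannZeta_eulerProduct_hasProd (s := 2 * s) (by simp; linarith)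
  have h4 : HasProd (fun p : Nat.Primes => if p = ⟨2, Nat.prime_two⟩ then
      (((1 : ℂ) + 2 ^ (-s)) / (1 - 2 ^ (-s))) else 1) (((1 : ℂ) + 2 ^ (-s)) / (1 - 2 ^ (-s))) :=
    hasProd_ite_eq _ _
  have hL : LSeries (fun n => (parH n : ℂ)) s =
      ∑' n, parHs (Complex.ne_zero_of_one_lt_re hs) n := by
    unfold LSeries
    exact tsum_congr (fun n => parH_term _ n)
  rw [hL]
  refine (h1.mul h2).unique ?_
  convert h3.mul h4 using 1
  ext p
  rw [parHs_apply]
  have e2 : (p : ℂ) ^ (-(2 * s)) = ((p : ℂ) ^ (-s)) ^ 2 := by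
    rw [← Complex.cpow_nat_mul]; congr 1; push_cast; ring
  by_cases hp : p = ⟨2, Nat.prime_two⟩
  · rw [if_pos hp, e2, hp]
    simp only [parH_two]
    have := one_sub_two_cpow_ne hs0
    have := one_add_two_cpow_ne hs0
    push_cast
    rw [show (1 : ℂ) - (2 ^ (-s)) ^ 2 = (1 - 2 ^ (-s)) * (1 + 2 ^ (-s)) by ring]
    field_simp
  · rw [if_neg hp, e2, parH_prime p.2 (fun h => hp (Subtype.ext h))]
    rw [mul_one, ← mul_inv]
    congr 1
    push_cast
    ring

lemma update_cont {F : ℂ → ℂ} {a : ℂ} (h1 : ∀ s, s ≠ 1 → ContinuousAt F s)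
    (h2 : Tendsto F (𝓝[≠] 1) (𝓝 a)) : Continuous (Function.update F 1 a) := by
  rw [continuous_iff_continuousAt]
  intro s
  by_cases hs : s = 1
  · subst hs; exact continuousAt_update_same.2 h2
  · exact (continuousAt_update_of_ne hs).2 (h1 s hs)

theorem parH_sum : Tendsto (fun x : ℝ => (∑ k ∈ Icc 1 ⌊x⌋₊, parH k) / x) atTop (𝓝 0) := by
  classical
  set W := Function.update (fun s : ℂ => (s - 1) * riemannZeta s) 1 1 with hW
  set V := Function.update (fun s : ℂ => riemannZeta s - 1 / (s - 1)) 1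
    (Real.eulerMascheroniConstant : ℂ) with hV
  have hzc : ∀ s : ℂ, s ≠ 1 → ContinuousAt riemannZeta s := fun s hs =>
    (differentiableAt_riemannZeta hs).continuousAt
  have hWc : Continuous W := by
    apply update_cont _ riemannZeta_residue_one
    intro s hs
    exact (by fun_prop : ContinuousAt (fun s : ℂ => s - 1) s).mul (hzc s hs)
  have hVc : Continuous V := by
    apply update_cont _ tendsto_riemannZeta_sub_one_div
    intro s hs
    apply (hzc s hs).sub
    apply ContinuousAt.div (by fun_prop) (by fun_prop)
    exact sub_ne_zero.2 hs
  have hW0 : ∀ s : ℂ, 1 ≤ s.re → W s ≠ 0 := by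
    intro s hs
    by_cases h : s = 1
    · simp [hW, h]
    · simp only [hW, Function.update_of_ne h]
      exact mul_ne_zero (sub_ne_zero.2 h) (riemannZeta_ne_zero_of_one_le_re hs)
  have hWI := wiener_ikehara (fun n => 1 + parH n) (fun n => by
      have := abs_le.1 (parH_abs_le n); linarith) 2 ?_ 1 zero_le_one
    (fun s => V s + riemannZeta (2 * s) * ((1 + 2 ^ (-s)) / (1 - 2 ^ (-s))) * ((s - 1) / W s))
    ?_ ?_
  rotate_left
  · intro n
    calc ∑ k ∈ Icc 1 n, (1 + parH k) ≤ ∑ k ∈ Icc 1 n, (2 : ℝ) :=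
          sum_le_sum (fun k _ => by have := abs_le.1 (parH_abs_le k); linarith)
      _ = 2 * n := by simp [mul_comm]
  · apply ContinuousOn.add hVc.continuousOn
    have h2c : Continuous (fun s : ℂ => (2 : ℂ) ^ (-s)) := by
      apply Continuous.const_cpow (by fun_prop) (Or.inl two_ne_zero)
    apply ContinuousOn.mul
    · apply ContinuousOn.mul
      · intro s hs
        apply ContinuousAt.continuousWithinAt
        apply ContinuousAt.comp (g := riemannZeta)
        · apply hzc
          intro h
          have := congrArg Complex.re h
          simp at this hs
          linarith
        · fun_prop
      · apply ContinuousOn.div (by fun_prop) (by fun_prop)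
        intro s hs
        simp at hs
        exact one_sub_two_cpow_ne (by linarith)
    · apply ContinuousOn.div (by fun_prop) hWc.continuousOn
      intro s hs
      exact hW0 s hs
  · intro s hs
    have hs1 : s ≠ 1 := by
      intro h; rw [h] at hs; simp at hs
    have hsum2 : LSeriesSummable (fun n => (parH n : ℂ)) s := by
      refine (parHs_summable hs).of_norm.congr (fun n => (parH_term _ n).symm)
    have hadd : LSeries (fun n => ((1 + parH n : ℝ) : ℂ)) s =
        riemannZeta s + LSeries (fun n => (parH n : ℂ)) s := by
      rw [← LSeries_one_eq_riemannZeta hs, ← LSeries_add (LSeriesSummable_one_iff.2 hs) hsum2]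
      congr 1
      ext n
      simp
    rw [hadd]
    have hz : riemannZeta s ≠ 0 := riemannZeta_ne_zero_of_one_le_re hs.le
    simp only [hW, hV, Function.update_of_ne hs1]
    have h3 := sub_ne_zero.2 hs1
    rw [← parH_LSeries hs]
    push_cast
    field_simp
    ring
  have hfl : Tendsto (fun x : ℝ => (⌊x⌋₊ : ℝ) / x) atTop (𝓝 1) := tendsto_nat_floor_div_atTop
  have := hWI.sub hfl
  rw [sub_self] at this
  refine this.congr ?_
  intro x
  rw [sum_add_distrib]
  simp
  ring
end A7

section B1
open Finset

/-- Finite Euler product bound. -/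
lemma euler_le (f : ℕ →* ℝ) (hf : ∀ n, 0 ≤ f n) (h1 : ∀ p : ℕ, p.Prime → f p < 1)
    (s T : Finset ℕ) (hT : ∀ n ∈ T, n ≠ 0 ∧ ∀ p : ℕ, p.Prime → p ∣ n → p ∈ s) :
    ∑ n ∈ T, f n ≤ ∏ p ∈ s with p.Prime, (1 - f p)⁻¹ := by
  have h := EulerProduct.summable_and_hasSum_factoredNumbers_prod_filter_prime_geometric
    (f := f) (fun {p} hp => by rw [Real.norm_of_nonneg (hf p)]; exact h1 p hp) s
  rw [← h.2.tsum_eq]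
  have hmem : ∀ n ∈ T, n ∈ Nat.factoredNumbers s := by
    intro n hn
    obtain ⟨h0, h2⟩ := hT n hn
    exact ⟨h0, fun p hp => h2 p (Nat.prime_of_mem_primeFactorsList hp)
      (Nat.dvd_of_mem_primeFactorsList hp)⟩
  have e : ∑ n ∈ T, f n
      = ∑ m ∈ T.attach.map ⟨fun n : {x // x ∈ T} => (⟨n.1, hmem n.1 n.2⟩ : Nat.factoredNumbers s),
        fun a b hab => Subtype.ext (congrArg (fun z : Nat.factoredNumbers s => (z : ℕ)) hab)⟩, f m := by
    rw [sum_map]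
    exact (sum_attach T (fun n => f n)).symm
  rw [e]
  exact h.2.summable.sum_le_tsum _ (fun m _ => hf m)

lemma sum_moebius_between {m l : ℕ} (hm : Squarefree m) :
    ∑ d ∈ m.divisors with l ∣ d, ArithmeticFunction.moebius d
      = if l = m then ArithmeticFunction.moebius l else 0 := by
  have hm0 : m ≠ 0 := hm.ne_zero
  by_cases hl : l ∣ m
  · obtain ⟨k, rfl⟩ := hl
    have hl0 : l ≠ 0 := left_ne_zero_of_mul hm0
    have hk0 : k ≠ 0 := right_ne_zero_of_mul hm0
    have hcop : l.Coprime k := Nat.coprime_of_squarefree_mul hm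
    have e : ((l * k).divisors.filter (fun d => l ∣ d)) = k.divisors.image (fun e => l * e) := by
      ext d
      simp only [mem_filter, Nat.mem_divisors, mem_image]
      constructor
      · rintro ⟨⟨h1, h2⟩, ⟨e, rfl⟩⟩
        exact ⟨e, ⟨Nat.dvd_of_mul_dvd_mul_left (Nat.pos_of_ne_zero hl0) h1, hk0⟩, rfl⟩
      · rintro ⟨e, ⟨h1, h2⟩, rfl⟩
        exact ⟨⟨Nat.mul_dvd_mul_left l h1, hm0⟩, dvd_mul_right _ _⟩
    rw [e, sum_image (fun a _ b _ hab => Nat.eq_of_mul_eq_mul_left (Nat.pos_of_ne_zero hl0) hab)]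
    have e2 : ∀ e ∈ k.divisors, ArithmeticFunction.moebius (l * e)
        = ArithmeticFunction.moebius l * ArithmeticFunction.moebius e := by
      intro e he
      exact ArithmeticFunction.isMultiplicative_moebius.map_mul_of_coprime
        (hcop.coprime_dvd_right (Nat.dvd_of_mem_divisors he))
    rw [sum_congr rfl e2, ← mul_sum]
    have e3 : ∑ e ∈ k.divisors, ArithmeticFunction.moebius e = if k = 1 then 1 else 0 := by
      have := congrArg (fun f => f k) ArithmeticFunction.moebius_mul_coe_zeta
      simp only [ArithmeticFunction.coe_mul_zeta_apply, ArithmeticFunction.one_apply] at this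
      exact this
    rw [e3]
    by_cases hk1 : k = 1
    · simp [hk1]
    · have : l ≠ l * k := by
        intro h
        exact hk1 (Nat.eq_of_mul_eq_mul_left (Nat.pos_of_ne_zero hl0) (by omega))
      simp [hk1, this]
  · have h1 : l ≠ m := fun h => hl (h ▸ dvd_rfl)
    rw [if_neg h1, filter_eq_empty_iff.2, sum_empty]
    intro d hd h
    exact hl (h.trans (Nat.dvd_of_mem_divisors hd))

/-- index set of the Selberg weights -/
def selL (q D : ℕ) : Finset ℕ := (Icc 1 D).filter (fun l => Squarefree l ∧ l.Coprime q)

/-- Selberg's sum -/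
noncomputable def selS (q D : ℕ) : ℝ := ∑ l ∈ selL q D, (1 : ℝ) / (Nat.totient l : ℝ)

noncomputable def selh (q D l : ℕ) : ℝ := 1 / ((Nat.totient l : ℝ) * selS q D)

/-- Selberg weights -/
noncomputable def lam (q D d : ℕ) : ℝ :=
  d * ((ArithmeticFunction.moebius d : ℤ) : ℝ) * ∑ l ∈ (selL q D).filter (fun l => d ∣ l), selh q D l

lemma selS_pos {q D : ℕ} (hD : 1 ≤ D) : 0 < selS q D := by
  unfold selS
  have h1 : 1 ∈ selL q D := by
    simp [selL, hD]
  refine sum_pos' (fun l _ => by positivity) ⟨1, h1, by simp⟩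

lemma selh_nonneg {q D l : ℕ} (hD : 1 ≤ D) : 0 ≤ selh q D l := by
  have := selS_pos (q := q) hD
  unfold selh; positivity

lemma sum_selh {q D : ℕ} (hD : 1 ≤ D) : ∑ l ∈ selL q D, selh q D l = 1 := by
  have h := selS_pos (q := q) hD
  have : ∀ l ∈ selL q D, selh q D l = (1 / (Nat.totient l : ℝ)) * (1 / selS q D) := by
    intro l _
    unfold selh
    rw [one_div_mul_one_div]
  rw [sum_congr rfl this, ← sum_mul]
  change selS q D * (1 / selS q D) = 1
  field_simp

lemma lam_one {q D : ℕ} (hD : 1 ≤ D) : lam q D 1 = 1 := by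
  simp [lam, sum_selh hD]

lemma abs_lam_le {q D d : ℕ} (hD : 1 ≤ D) : |lam q D d| ≤ d := by
  unfold lam
  rw [abs_mul, abs_mul, Nat.abs_cast]
  have h1 : |((ArithmeticFunction.moebius d : ℤ) : ℝ)| ≤ 1 := by
    exact_mod_cast ArithmeticFunction.abs_moebius_le_one
  have h2 : |∑ l ∈ (selL q D).filter (fun l => d ∣ l), selh q D l| ≤ 1 := by
    rw [abs_of_nonneg (sum_nonneg fun l _ => selh_nonneg hD), ← sum_selh (q := q) hD]
    exact sum_le_sum_of_subset_of_nonneg (filter_subset _ _) (fun l _ _ => selh_nonneg hD)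
  calc _ ≤ (d : ℝ) * 1 * 1 := by gcongr
    _ = d := by ring

lemma lam_coprime {q D d : ℕ} (h : ¬ d.Coprime q) : lam q D d = 0 := by
  unfold lam
  rw [filter_eq_empty_iff.2, sum_empty, mul_zero]
  intro l hl hd
  simp only [selL, mem_filter] at hl
  exact h (hl.2.2.coprime_dvd_left hd)

lemma lam_inv {q D l : ℕ} :
    ∑ d ∈ (Icc 1 D).filter (fun d => l ∣ d), lam q D d / d
      = if l ∈ selL q D then ((ArithmeticFunction.moebius l : ℤ) : ℝ) * selh q D l else 0 := by
  have e1 : ∀ d ∈ (Icc 1 D).filter (fun d => l ∣ d), lam q D d / d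
      = ∑ m ∈ selL q D, if d ∣ m then ((ArithmeticFunction.moebius d : ℤ) : ℝ) * selh q D m else 0 := by
    intro d hd
    simp only [mem_filter, mem_Icc] at hd
    have hd0 : (d : ℝ) ≠ 0 := by
      have := hd.1.1
      positivity
    unfold lam
    rw [← sum_filter, ← mul_sum]
    field_simp
  rw [sum_congr rfl e1, sum_comm]
  have e2 : ∀ m ∈ selL q D, (∑ d ∈ (Icc 1 D).filter (fun d => l ∣ d),
      if d ∣ m then ((ArithmeticFunction.moebius d : ℤ) : ℝ) * selh q D m else 0)
      = if l = m then ((ArithmeticFunction.moebius l : ℤ) : ℝ) * selh q D l else 0 := by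
    intro m hm
    simp only [selL, mem_filter, mem_Icc] at hm
    rw [← sum_filter, filter_filter, ← sum_mul]
    have e3 : (Icc 1 D).filter (fun d => l ∣ d ∧ d ∣ m) = m.divisors.filter (fun d => l ∣ d) := by
      ext d
      simp only [mem_filter, mem_Icc, Nat.mem_divisors]
      constructor
      · rintro ⟨_, h1, h2⟩
        exact ⟨⟨h2, by omega⟩, h1⟩
      · rintro ⟨⟨h1, h2⟩, h3⟩
        exact ⟨⟨Nat.pos_of_dvd_of_pos h1 (by omega), (Nat.le_of_dvd (by omega) h1).trans hm.1.2⟩, h3, h1⟩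
    rw [e3]
    have := sum_moebius_between (l := l) hm.2.1
    rw [← Int.cast_sum, this]
    by_cases h : l = m
    · simp [h]
    · simp [h]
  rw [sum_congr rfl e2, sum_ite_eq]

lemma lam_quad {q D : ℕ} (hD : 1 ≤ D) :
    ∑ d ∈ Icc 1 D, ∑ e ∈ Icc 1 D, lam q D d * lam q D e / (Nat.lcm d e : ℝ) = 1 / selS q D := by
  have e1 : ∀ d ∈ Icc 1 D, ∀ e ∈ Icc 1 D, lam q D d * lam q D e / (Nat.lcm d e : ℝ)
      = ∑ l ∈ Icc 1 D, (if l ∣ d ∧ l ∣ e then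
          (Nat.totient l : ℝ) * ((lam q D d / d) * (lam q D e / e)) else 0) := by
    intro d hd e he
    rw [mem_Icc] at hd he
    have hd0 : (d : ℝ) ≠ 0 := by have := hd.1; positivity
    have he0 : (e : ℝ) ≠ 0 := by have := he.1; positivity
    have hg : (∑ l ∈ (Icc 1 D).filter (fun l => l ∣ d ∧ l ∣ e), (Nat.totient l : ℝ)) = (Nat.gcd d e : ℝ) := by
      have : (Icc 1 D).filter (fun l => l ∣ d ∧ l ∣ e) = (Nat.gcd d e).divisors := by
        ext l
        simp only [mem_filter, mem_Icc, Nat.mem_divisors, Nat.dvd_gcd_iff]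
        constructor
        · rintro ⟨_, h⟩
          exact ⟨h, (Nat.gcd_pos_of_pos_left _ (by omega)).ne'⟩
        · rintro ⟨h, _⟩
          exact ⟨⟨Nat.pos_of_dvd_of_pos h.1 (by omega), (Nat.le_of_dvd (by omega) h.1).trans hd.2⟩, h⟩
      rw [this]
      exact_mod_cast Nat.sum_totient (Nat.gcd d e)
    rw [← sum_filter, ← sum_mul, hg]
    have hgl : (Nat.gcd d e : ℝ) * (Nat.lcm d e : ℝ) = d * e := by exact_mod_cast Nat.gcd_mul_lcm d e
    have hl0 : (Nat.lcm d e : ℝ) ≠ 0 := by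
      intro h; rw [h, mul_zero] at hgl
      exact (mul_ne_zero hd0 he0) hgl.symm
    field_simp
    linear_combination (-(lam q D d * lam q D e)) * hgl
  rw [sum_congr rfl (fun d hd => sum_congr rfl (e1 d hd))]
  have e2 : ∑ d ∈ Icc 1 D, ∑ e ∈ Icc 1 D, ∑ l ∈ Icc 1 D, (if l ∣ d ∧ l ∣ e then
          (Nat.totient l : ℝ) * ((lam q D d / d) * (lam q D e / e)) else 0)
      = ∑ l ∈ Icc 1 D, (Nat.totient l : ℝ) *
        (∑ d ∈ (Icc 1 D).filter (fun d => l ∣ d), lam q D d / d) ^ 2 := by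
    rw [sum_congr rfl (fun d _ => sum_comm), sum_comm]
    refine sum_congr rfl fun l _ => ?_
    rw [sq, sum_mul_sum, sum_filter, mul_sum]
    refine sum_congr rfl fun d _ => ?_
    by_cases hd : l ∣ d
    · simp only [hd, true_and, if_true]
      rw [sum_filter, mul_sum]
      refine sum_congr rfl fun e _ => ?_
      split_ifs <;> simp
    · simp [hd]
  rw [e2]
  have e3 : ∀ l ∈ Icc 1 D, (Nat.totient l : ℝ) *
        (∑ d ∈ (Icc 1 D).filter (fun d => l ∣ d), lam q D d / d) ^ 2
      = if Squarefree l ∧ l.Coprime q then (1 / (Nat.totient l : ℝ)) * (1 / selS q D ^ 2) else 0 := by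
    intro l hl
    rw [lam_inv]
    have : l ∈ selL q D ↔ (Squarefree l ∧ l.Coprime q) := by
      simp only [selL, mem_filter, hl, true_and]
    simp only [this]
    split_ifs with h
    · have hs := selS_pos (q := q) hD
      have ht : (Nat.totient l : ℝ) ≠ 0 := by
        rw [mem_Icc] at hl
        have := Nat.totient_pos.2 (show 0 < l by omega)
        positivity
      have hmu : ((ArithmeticFunction.moebius l : ℤ) : ℝ) ^ 2 = 1 := by
        have := ArithmeticFunction.moebius_sq_eq_one_of_squarefree h.1
        exact_mod_cast this
      rw [mul_pow, hmu]
      unfold selh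
      field_simp
    · simp
  rw [sum_congr rfl e3, ← sum_filter, ← sum_mul]
  change selS q D * (1 / selS q D ^ 2) = _
  have hs := selS_pos (q := q) hD
  field_simp

end B1

section B2
open Finset

lemma prod_inv_totient {n : ℕ} (hn : n ≠ 0) :
    ∏ p ∈ n.primeFactors, (1 - (p : ℝ)⁻¹)⁻¹ = n / (Nat.totient n : ℝ) := by
  have h := Nat.totient_eq_mul_prod_factors n
  have h2 : (Nat.totient n : ℝ) = n * ∏ p ∈ n.primeFactors, (1 - (p : ℝ)⁻¹) := by
    have := congrArg (fun z : ℚ => (z : ℝ)) h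
    push_cast at this
    exact this
  have hn' : (n : ℝ) ≠ 0 := by exact_mod_cast hn
  have ht : (Nat.totient n : ℝ) ≠ 0 := by
    have := Nat.totient_pos.2 (Nat.pos_of_ne_zero hn)
    positivity
  rw [prod_inv_distrib]
  have hp : ∏ p ∈ n.primeFactors, (1 - (p : ℝ)⁻¹) ≠ 0 := by
    intro h0; rw [h0, mul_zero] at h2; exact ht h2
  rw [h2]
  field_simp

/-- the monoid hom n ↦ 1/n -/
noncomputable def invHom : ℕ →* ℝ where
  toFun n := (n : ℝ)⁻¹
  map_one' := by simp
  map_mul' a b := by push_cast; rw [mul_inv]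

lemma selS_lower {q D : ℕ} (hq : 0 < q) (hD : 1 ≤ D) :
    Real.log D ≤ selS q D * (q / (Nat.totient q : ℝ)) := by
  have h1 : Real.log D ≤ ∑ n ∈ Icc 1 D, (n : ℝ)⁻¹ := by
    have := log_add_one_le_harmonic D
    have h3 : Real.log D ≤ Real.log (D + 1 : ℝ) := Real.log_le_log (by positivity) (by linarith)
    have h4 : ((harmonic D : ℚ) : ℝ) = ∑ n ∈ Icc 1 D, (n : ℝ)⁻¹ := by
      rw [harmonic_eq_sum_Icc]; push_cast; rfl
    rw [← h4]
    push_cast at this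
    linarith
  refine h1.trans ?_
  let rd : ℕ → ℕ := fun n => ∏ p ∈ n.primeFactors.filter (fun p => ¬ p ∣ q), p
  have hrd_dvd : ∀ n, n ≠ 0 → rd n ∣ n := by
    intro n hn
    refine (prod_dvd_prod_of_subset _ _ _ (filter_subset _ _)).trans (Nat.prod_primeFactors_dvd n)
  have hpf : ∀ n, (rd n).primeFactors = n.primeFactors.filter (fun p => ¬ p ∣ q) := by
    intro n
    exact Nat.primeFactors_prod (fun p hp => Nat.prime_of_mem_primeFactors (mem_filter.1 hp).1)
  have hmaps : ∀ n ∈ Icc 1 D, rd n ∈ selL q D := by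
    intro n hn
    rw [mem_Icc] at hn
    have hr0 : rd n ≠ 0 := fun h => by
      have := hrd_dvd n (by omega); rw [h, zero_dvd_iff] at this; omega
    simp only [selL, mem_filter, mem_Icc]
    refine ⟨⟨Nat.pos_of_ne_zero hr0, (Nat.le_of_dvd (by omega) (hrd_dvd n (by omega))).trans hn.2⟩, ?_, ?_⟩
    · exact (Finset.squarefree_prod_of_pairwise_isCoprime
        (fun a ha b hb hab => by
          have ha := Nat.prime_of_mem_primeFactors (mem_filter.1 (mem_coe.1 ha)).1
          have hb := Nat.prime_of_mem_primeFactors (mem_filter.1 (mem_coe.1 hb)).1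
          exact Nat.coprime_iff_isRelPrime.1 ((Nat.coprime_primes ha hb).2 hab))
        (fun p hp => (Nat.prime_of_mem_primeFactors (mem_filter.1 hp).1).prime.irreducible.squarefree))
    · refine Nat.Coprime.prod_left fun p hp => ?_
      have hp' := mem_filter.1 hp
      exact (Nat.Prime.coprime_iff_not_dvd (Nat.prime_of_mem_primeFactors hp'.1)).2 hp'.2
  rw [← sum_fiberwise_of_maps_to hmaps]
  unfold selS
  rw [sum_mul]
  refine sum_le_sum fun l hl => ?_
  simp only [selL, mem_filter, mem_Icc] at hl
  have hl0 : l ≠ 0 := by omega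
  have e1 : ∑ n ∈ (Icc 1 D).filter (fun n => rd n = l), (n : ℝ)⁻¹
      = (l : ℝ)⁻¹ * ∑ c ∈ ((Icc 1 D).filter (fun n => rd n = l)).image (fun n => n / l), invHom c := by
    rw [sum_image, mul_sum]
    · refine sum_congr rfl fun n hn => ?_
      rw [mem_filter, mem_Icc] at hn
      have hd : l ∣ n := hn.2 ▸ hrd_dvd n (by omega)
      change _ = (l : ℝ)⁻¹ * ((n / l : ℕ) : ℝ)⁻¹
      rw [← mul_inv, ← Nat.cast_mul, Nat.mul_div_cancel' hd]
    · intro a ha b hb hab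
      simp only [coe_filter, mem_Icc, Set.mem_ofPred_eq] at ha hb
      have h1 : l ∣ a := ha.2 ▸ hrd_dvd a (by omega)
      have h2 : l ∣ b := hb.2 ▸ hrd_dvd b (by omega)
      simp only at hab
      rw [← Nat.mul_div_cancel' h1, ← Nat.mul_div_cancel' h2, hab]
  rw [e1]
  have hlq : l * q ≠ 0 := by positivity
  have e2 := euler_le invHom (fun n => by change 0 ≤ (n : ℝ)⁻¹; positivity)
    (fun p hp => by
      change (p : ℝ)⁻¹ < 1
      exact inv_lt_one_of_one_lt₀ (by exact_mod_cast hp.one_lt)) (l * q).primeFactors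
    (((Icc 1 D).filter (fun n => rd n = l)).image (fun n => n / l)) (by
      intro c hc
      simp only [mem_image, mem_filter, mem_Icc] at hc
      obtain ⟨n, ⟨hn, hrn⟩, rfl⟩ := hc
      have hd : l ∣ n := hrn ▸ hrd_dvd n (by omega)
      refine ⟨(Nat.div_pos (Nat.le_of_dvd (by omega) hd) (by omega)).ne', fun p hp hpd => ?_⟩
      have hpn : p ∣ n := hpd.trans (Nat.div_dvd_of_dvd hd)
      rw [Nat.mem_primeFactors]
      refine ⟨hp, ?_, hlq⟩
      by_cases hpq : p ∣ q
      · exact hpq.mul_left l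
      · have : p ∈ (rd n).primeFactors := by
          rw [hpf, mem_filter, Nat.mem_primeFactors]
          exact ⟨⟨hp, hpn, by omega⟩, hpq⟩
        rw [hrn] at this
        exact (Nat.dvd_of_mem_primeFactors this).mul_right q)
  rw [filter_true_of_mem (fun p hp => Nat.prime_of_mem_primeFactors hp)] at e2
  have e3 := prod_inv_totient hlq
  change _ ≤ ∏ p ∈ (l * q).primeFactors, (1 - (p : ℝ)⁻¹)⁻¹ at e2
  rw [e3, Nat.totient_mul hl.2.2] at e2
  have hl' : (0 : ℝ) < l := by positivity
  calc _ ≤ (l : ℝ)⁻¹ * (((l * q : ℕ) : ℝ) / ((Nat.totient l * Nat.totient q : ℕ) : ℝ)) := by gcongr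
    _ = _ := by
      push_cast
      field_simp

end B2

section B3
open Finset

lemma count_crt {q m : ℕ} (hq : 0 < q) (hm : 0 < m) (hc : m.Coprime q) (b u v : ℕ) (huv : u ≤ v) :
    |((#{n ∈ Ioc u v | n ≡ b [MOD q] ∧ m ∣ n} : ℕ) : ℝ) - (v - u : ℝ) / (q * m)| ≤ 1 := by
  obtain ⟨c, hc1, hc2⟩ := Nat.chineseRemainder hc 0 b
  have e : ({n ∈ Ioc u v | n ≡ b [MOD q] ∧ m ∣ n}) = {n ∈ Ioc u v | n ≡ c [MOD (m * q)]} := by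
    ext n
    simp only [mem_filter, and_congr_right_iff]
    intro _
    rw [← Nat.modEq_and_modEq_iff_modEq_mul hc, ← Nat.modEq_zero_iff_dvd]
    constructor
    · rintro ⟨h1, h2⟩
      exact ⟨h2.trans hc1.symm, h1.trans hc2.symm⟩
    · rintro ⟨h1, h2⟩
      exact ⟨h2.trans hc2, h1.trans hc1⟩
  have hmq : 0 < m * q := Nat.mul_pos hm hq
  rw [e]
  have h := Nat.Ioc_filter_modEq_card u v hmq c
  have h' : (((#{n ∈ Ioc u v | n ≡ c [MOD (m * q)]} : ℕ) : ℤ) : ℝ)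
    = ((max (⌊((v : ℚ) - c) / ((m * q : ℕ) : ℚ)⌋ - ⌊((u : ℚ) - c) / ((m * q : ℕ) : ℚ)⌋) 0 : ℤ) : ℝ) := by
    rw [h]
  rw [Int.cast_natCast] at h'
  rw [h']
  set A : ℚ := ((v : ℚ) - c) / ((m * q : ℕ) : ℚ) with hA
  set B : ℚ := ((u : ℚ) - c) / ((m * q : ℕ) : ℚ) with hB
  have hpos : (0 : ℚ) < ((m * q : ℕ) : ℚ) := by exact_mod_cast hmq
  have hBA : B ≤ A := by
    rw [hA, hB]
    have : (u : ℚ) ≤ v := by exact_mod_cast huv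
    gcongr
  rw [max_eq_left (by have := Int.floor_le_floor hBA; omega)]
  have hAB : (A : ℝ) - B = (v - u : ℝ) / (q * m) := by
    rw [hA, hB]; push_cast
    have : (q : ℝ) ≠ 0 := by positivity
    have : (m : ℝ) ≠ 0 := by positivity
    field_simp
    ring
  rw [← hAB]
  have h1 := Int.floor_le A
  have h2 := Int.lt_floor_add_one A
  have h3 := Int.floor_le B
  have h4 := Int.lt_floor_add_one B
  have h1' : ((⌊A⌋ : ℤ) : ℝ) ≤ A := by exact_mod_cast h1
  have h2' : (A : ℝ) < (⌊A⌋ : ℤ) + 1 := by exact_mod_cast h2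
  have h3' : ((⌊B⌋ : ℤ) : ℝ) ≤ B := by exact_mod_cast h3
  have h4' : (B : ℝ) < (⌊B⌋ : ℤ) + 1 := by exact_mod_cast h4
  push_cast
  rw [abs_le]
  constructor <;> linarith

lemma selberg_bound {q D : ℕ} (hq : 0 < q) (hD : 1 ≤ D) (b u v : ℕ) (huv : u ≤ v) :
    ((#{p ∈ Ioc u v | p ≡ b [MOD q] ∧ p.Prime ∧ D < p} : ℕ) : ℝ)
      ≤ (v - u : ℝ) / q / selS q D + (D : ℝ) ^ 4 := by
  have h1 : ((#{p ∈ Ioc u v | p ≡ b [MOD q] ∧ p.Prime ∧ D < p} : ℕ) : ℝ)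
      ≤ ∑ n ∈ Ioc u v with n ≡ b [MOD q], (∑ d ∈ Icc 1 D with d ∣ n, lam q D d) ^ 2 := by
    rw [← nsmul_one, ← sum_const]
    have hsub : ({p ∈ Ioc u v | p ≡ b [MOD q] ∧ p.Prime ∧ D < p})
        ⊆ {n ∈ Ioc u v | n ≡ b [MOD q]} := by
      intro p hp; rw [mem_filter] at hp ⊢; exact ⟨hp.1, hp.2.1⟩
    refine le_trans (sum_le_sum ?_) (sum_le_sum_of_subset_of_nonneg hsub (fun _ _ _ => sq_nonneg _))
    intro p hp
    rw [mem_filter] at hp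
    obtain ⟨_, _, hpp, hDp⟩ := hp
    have : (Icc 1 D).filter (fun d => d ∣ p) = {1} := by
      ext d
      simp only [mem_filter, mem_Icc, mem_singleton]
      constructor
      · rintro ⟨⟨_, h⟩, hd⟩
        rcases (Nat.dvd_prime hpp).1 hd with h | h
        · exact h
        · omega
      · rintro rfl
        exact ⟨⟨le_rfl, hD⟩, one_dvd _⟩
    rw [this, sum_singleton, lam_one hD]; norm_num
  refine h1.trans ?_
  have h2 : ∑ n ∈ Ioc u v with n ≡ b [MOD q], (∑ d ∈ Icc 1 D with d ∣ n, lam q D d) ^ 2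
      = ∑ d ∈ Icc 1 D, ∑ e ∈ Icc 1 D, lam q D d * lam q D e *
        ((#{n ∈ Ioc u v | n ≡ b [MOD q] ∧ Nat.lcm d e ∣ n} : ℕ) : ℝ) := by
    have : ∀ n ∈ (Ioc u v).filter (fun n => n ≡ b [MOD q]),
        (∑ d ∈ Icc 1 D with d ∣ n, lam q D d) ^ 2
        = ∑ d ∈ Icc 1 D, ∑ e ∈ Icc 1 D, if Nat.lcm d e ∣ n then lam q D d * lam q D e else 0 := by
      intro n _
      rw [sq, sum_mul_sum, sum_filter]
      refine sum_congr rfl fun d _ => ?_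
      rw [sum_filter]
      by_cases hd : d ∣ n
      · simp [hd, Nat.lcm_dvd_iff]
      · simp [hd, Nat.lcm_dvd_iff]
    rw [sum_congr rfl this, sum_comm]
    refine sum_congr rfl fun d _ => ?_
    rw [sum_comm]
    refine sum_congr rfl fun e _ => ?_
    rw [← sum_filter, filter_filter, sum_const, nsmul_eq_mul, mul_comm]
  rw [h2]
  have h3 : ∀ d ∈ Icc 1 D, ∀ e ∈ Icc 1 D, lam q D d * lam q D e *
        ((#{n ∈ Ioc u v | n ≡ b [MOD q] ∧ Nat.lcm d e ∣ n} : ℕ) : ℝ)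
      ≤ (v - u : ℝ) / q * (lam q D d * lam q D e / (Nat.lcm d e : ℝ)) + (d : ℝ) * e := by
    intro d hd e he
    rw [mem_Icc] at hd he
    by_cases hdq : d.Coprime q
    · by_cases heq : e.Coprime q
      · have hm : 0 < Nat.lcm d e := Nat.lcm_pos (by omega) (by omega)
        have hcop : (Nat.lcm d e).Coprime q :=
          (Nat.Coprime.mul_left hdq heq).coprime_dvd_left (Nat.lcm_dvd_mul d e)
        have hcount := count_crt hq hm hcop b u v huv
        set N : ℝ := ((#{n ∈ Ioc u v | n ≡ b [MOD q] ∧ Nat.lcm d e ∣ n} : ℕ) : ℝ)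
        have hq' : (q : ℝ) ≠ 0 := by positivity
        have hm' : (Nat.lcm d e : ℝ) ≠ 0 := by positivity
        have e1 : lam q D d * lam q D e * N = (v - u : ℝ) / q * (lam q D d * lam q D e / (Nat.lcm d e : ℝ))
            + (lam q D d * lam q D e) * (N - (v - u : ℝ) / (q * (Nat.lcm d e : ℝ))) := by
          field_simp
          ring
        rw [e1]
        have e2 : (lam q D d * lam q D e) * (N - (v - u : ℝ) / (q * (Nat.lcm d e : ℝ)))
            ≤ (d : ℝ) * e := by
          refine (le_abs_self _).trans ?_
          rw [abs_mul, abs_mul]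
          calc _ ≤ ((d : ℝ) * e) * 1 := by
                gcongr
                · exact abs_lam_le hD
                · exact abs_lam_le hD
            _ = _ := mul_one _
        linarith
      · rw [lam_coprime heq]; simp; positivity
    · rw [lam_coprime hdq]; simp; positivity
  refine (sum_le_sum fun d hd => sum_le_sum (h3 d hd)).trans ?_
  simp_rw [sum_add_distrib, ← mul_sum]
  rw [lam_quad hD, ← sum_mul, ← sq]
  have h4 : (∑ d ∈ Icc 1 D, (d : ℝ)) ≤ (D : ℝ) ^ 2 := by
    calc (∑ d ∈ Icc 1 D, (d : ℝ)) ≤ ∑ d ∈ Icc 1 D, (D : ℝ) :=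
          sum_le_sum fun d hd => by exact_mod_cast (mem_Icc.1 hd).2
      _ = (D : ℝ) ^ 2 := by rw [sum_const, Nat.card_Icc, nsmul_eq_mul, Nat.add_sub_cancel]; ring
  have h5 : (∑ d ∈ Icc 1 D, (d : ℝ)) ^ 2 ≤ (D : ℝ) ^ 4 := by
    calc _ ≤ ((D : ℝ) ^ 2) ^ 2 := by gcongr
      _ = _ := by ring
  have h6 : (v - u : ℝ) / q * (1 / selS q D) = (v - u : ℝ) / q / selS q D := by ring
  rw [h6]
  linarith

/-- Brun–Titchmarsh, raw form. -/
lemma bt_raw {q D : ℕ} (hq : 0 < q) (hD : 2 ≤ D) (b u v : ℕ) (huv : u ≤ v) :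
    ((#{p ∈ Ioc u v | p ≡ b [MOD q] ∧ p.Prime ∧ D < p} : ℕ) : ℝ)
      ≤ (v - u : ℝ) / (Nat.totient q * Real.log D) + (D : ℝ) ^ 4 := by
  refine (selberg_bound hq (by omega : 1 ≤ D) b u v huv).trans ?_
  have h1 := selS_lower hq (by omega : 1 ≤ D)
  have hs := selS_pos (q := q) (by omega : 1 ≤ D)
  have hl : 0 < Real.log D := Real.log_pos (by exact_mod_cast hD)
  have ht : (0 : ℝ) < Nat.totient q := by exact_mod_cast Nat.totient_pos.2 hq
  have hq' : (0 : ℝ) < q := by exact_mod_cast hq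
  have hvu : (0 : ℝ) ≤ v - u := by
    have : (u : ℝ) ≤ v := by exact_mod_cast huv
    linarith
  have : (v - u : ℝ) / q / selS q D ≤ (v - u : ℝ) / (Nat.totient q * Real.log D) := by
    rw [div_div]
    refine div_le_div_of_nonneg_left hvu (by positivity) ?_
    have : Real.log D * Nat.totient q ≤ selS q D * (q / (Nat.totient q : ℝ)) * Nat.totient q := by gcongr
    have e : selS q D * (q / (Nat.totient q : ℝ)) * Nat.totient q = q * selS q D := by
      field_simp
    linarith
  linarith

end B3

section B4
open Finset Filter

lemma ev_log_pow (c : ℝ) (hc : 0 < c) (A : ℝ) : ∀ᶠ z : ℝ in atTop, A * Real.log z ≤ z ^ c := by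
  have h := (isLittleO_log_rpow_atTop hc).bound (show (0:ℝ) < 1 / (|A| + 1) by positivity)
  filter_upwards [h, eventually_ge_atTop (1:ℝ)] with z hz h1
  have hl : 0 ≤ Real.log z := Real.log_nonneg h1
  have hp : 0 ≤ z ^ c := by positivity
  rw [Real.norm_of_nonneg hl, Real.norm_of_nonneg hp] at hz
  have : (|A| + 1) * Real.log z ≤ z ^ c := by
    calc (|A| + 1) * Real.log z ≤ (|A| + 1) * (1 / (|A| + 1) * z ^ c) := by gcongr
      _ = z ^ c := by field_simp
  have h2 : A * Real.log z ≤ (|A| + 1) * Real.log z := by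
    gcongr
    linarith [le_abs_self A]
  linarith

/-- Short interval Brun–Titchmarsh. -/
lemma bt_short : ∃ z₀ : ℝ, ∀ z ≥ z₀, ∀ H : ℝ, z ^ (9/10 : ℝ) ≤ H → ∀ q : ℕ, 0 < q →
    (q : ℝ) ≤ z ^ (1/10 : ℝ) → ∀ b : ZMod q,
    ((#{p ∈ primesIoc z (z + H) | ((p : ℕ) : ZMod q) = b} : ℕ) : ℝ)
      ≤ 33 * H / (Nat.totient q * Real.log z) := by
  have e1 := ev_log_pow (1/10) (by norm_num) 1
  have e2 := eventually_ge_atTop ((2:ℝ)^(16:ℕ))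
  obtain ⟨z₀, hz₀⟩ := eventually_atTop.1 (e1.and e2)
  refine ⟨z₀, fun z hz H hH q hq hqz b => ?_⟩
  obtain ⟨hlog, hbig⟩ := hz₀ z hz
  have : NeZero q := ⟨hq.ne'⟩
  have hz1 : (1:ℝ) ≤ z := le_trans (by norm_num) hbig
  have hzpos : 0 < z := by linarith
  set D := ⌊z ^ (1/8 : ℝ)⌋₊ with hD
  have hD4 : (4:ℝ) ≤ z ^ (1/8 : ℝ) := by
    calc (4:ℝ) = ((2:ℝ)^(16:ℕ)) ^ (1/8 : ℝ) := by
          rw [← Real.rpow_natCast, ← Real.rpow_mul (by norm_num)]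
          norm_num
      _ ≤ _ := by gcongr
  have hDle : (D : ℝ) ≤ z ^ (1/8 : ℝ) := Nat.floor_le (by positivity)
  have hDge : z ^ (1/8 : ℝ) / 2 ≤ D := by
    have := Nat.lt_floor_add_one (z ^ (1/8 : ℝ))
    rw [← hD] at this
    linarith
  have hD2 : 2 ≤ D := by
    have : (2:ℝ) ≤ D := by linarith
    exact_mod_cast this
  have hDz : (D : ℝ) ≤ z := hDle.trans (by
    calc z ^ (1/8 : ℝ) ≤ z ^ (1:ℝ) := Real.rpow_le_rpow_of_exponent_le hz1 (by norm_num)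
      _ = z := Real.rpow_one z)
  have hH1 : 1 ≤ H := le_trans (Real.one_le_rpow hz1 (by norm_num)) hH
  have huv : ⌊z⌋₊ ≤ ⌊z + H⌋₊ := Nat.floor_le_floor (by linarith)
  have h := bt_raw hq hD2 b.val ⌊z⌋₊ ⌊z + H⌋₊ huv
  have hsub : (primesIoc z (z + H)).filter (fun p : ℕ => (p : ZMod q) = b)
      ⊆ {p ∈ Ioc ⌊z⌋₊ ⌊z + H⌋₊ | p ≡ b.val [MOD q] ∧ p.Prime ∧ D < p} := by
    intro p hp
    rw [mem_filter] at hp ⊢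
    have hp1 := (mem_primesIoc hzpos.le).1 hp.1
    refine ⟨(mem_filter.1 hp.1).1, ?_, hp1.1, ?_⟩
    · rw [← ZMod.natCast_eq_natCast_iff, hp.2]; simp
    · have : (D : ℝ) < p := lt_of_le_of_lt hDz hp1.2.1
      exact_mod_cast this
  have hcard : ((#{p ∈ primesIoc z (z + H) | ((p : ℕ) : ZMod q) = b} : ℕ) : ℝ) ≤ _ :=
    le_trans (by exact_mod_cast card_le_card hsub) h
  refine hcard.trans ?_
  have hlz : 0 < Real.log z := Real.log_pos (lt_of_lt_of_le (by norm_num) hbig)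
  have ht : (0 : ℝ) < Nat.totient q := by exact_mod_cast Nat.totient_pos.2 hq
  have hlD : Real.log z / 16 ≤ Real.log D := by
    have h16 : z ^ (1/16 : ℝ) ≤ D := by
      refine le_trans ?_ hDge
      have h2 : (2:ℝ) ≤ z ^ (1/16 : ℝ) := by
        calc (2:ℝ) = ((2:ℝ)^(16:ℕ)) ^ (1/16 : ℝ) := by
              rw [← Real.rpow_natCast, ← Real.rpow_mul (by norm_num)]
              norm_num
          _ ≤ _ := by gcongr
      have h3 : z ^ (1/8 : ℝ) = z ^ (1/16 : ℝ) * z ^ (1/16 : ℝ) := by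
        rw [← Real.rpow_add hzpos]; norm_num
      rw [h3]
      nlinarith
    calc Real.log z / 16 = Real.log (z ^ (1/16 : ℝ)) := by rw [Real.log_rpow hzpos]; ring
      _ ≤ _ := Real.log_le_log (by positivity) h16
  have hvu : ((⌊z + H⌋₊ : ℝ) - ⌊z⌋₊) ≤ 2 * H := by
    have h1 := Nat.floor_le (show 0 ≤ z + H by linarith)
    have h2 := Nat.lt_floor_add_one z
    linarith
  have hD4' : (D : ℝ) ^ 4 ≤ H / (Nat.totient q * Real.log z) := by
    rw [le_div_iff₀ (by positivity)]
    have h1 : (D : ℝ) ^ 4 ≤ z ^ (1/2 : ℝ) := by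
      calc (D : ℝ) ^ 4 ≤ (z ^ (1/8 : ℝ)) ^ 4 := by gcongr
        _ = z ^ (1/2 : ℝ) := by
          rw [← Real.rpow_natCast, ← Real.rpow_mul hzpos.le]; norm_num
    have h2 : (Nat.totient q : ℝ) ≤ z ^ (1/10 : ℝ) :=
      le_trans (by exact_mod_cast Nat.totient_le q) hqz
    calc _ ≤ z ^ (1/2 : ℝ) * (z ^ (1/10 : ℝ) * z ^ (1/10 : ℝ)) := by
          gcongr
          linarith
      _ = z ^ (7/10 : ℝ) := by
          rw [← Real.rpow_add hzpos, ← Real.rpow_add hzpos]; norm_num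
      _ ≤ z ^ (9/10 : ℝ) := Real.rpow_le_rpow_of_exponent_le hz1 (by norm_num)
      _ ≤ H := hH
  have hmain : ((⌊z + H⌋₊ : ℝ) - ⌊z⌋₊) / (Nat.totient q * Real.log D)
      ≤ 32 * H / (Nat.totient q * Real.log z) := by
    calc _ ≤ (2 * H) / (Nat.totient q * (Real.log z / 16)) := by gcongr
      _ = _ := by field_simp; ring
  have : 33 * H / (Nat.totient q * Real.log z)
    = 32 * H / (Nat.totient q * Real.log z) + H / (Nat.totient q * Real.log z) := by ring
  linarith

/-- Long interval Brun–Titchmarsh. -/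
lemma bt_long : ∃ X₀ : ℝ, ∀ X ≥ X₀, ∀ q : ℕ, 0 < q →
    (q : ℝ) ≤ X ^ (1/20 : ℝ) → ∀ b : ZMod q,
    ((#{p ∈ primesIoc 0 X | ((p : ℕ) : ZMod q) = b} : ℕ) : ℝ)
      ≤ 68 * X / (Nat.totient q * Real.log X) := by
  obtain ⟨z₀, hz₀⟩ := bt_short
  have e1 := ev_log_pow (1/10) (by norm_num) 1
  obtain ⟨X₀, hX₀⟩ := eventually_atTop.1 (e1.and (eventually_ge_atTop (max 2 (max z₀ 0 ^ 2))))
  refine ⟨X₀, fun X hX q hq hqX b => ?_⟩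
  obtain ⟨hlog, hbig⟩ := hX₀ X hX
  have hX2 : 2 ≤ X := le_trans (le_max_left _ _) hbig
  have hX0 : 0 < X := by linarith
  have hX1 : 1 ≤ X := by linarith
  have hzX : z₀ ≤ X ^ (1/2 : ℝ) := by
    rw [← Real.sqrt_eq_rpow]
    refine le_trans (le_max_left _ 0) (Real.le_sqrt_of_sq_le (le_trans (le_max_right _ _) hbig))
  have h := hz₀ (X ^ (1/2 : ℝ)) hzX X (by
    rw [← Real.rpow_mul hX0.le]
    calc _ ≤ X ^ (1:ℝ) := Real.rpow_le_rpow_of_exponent_le hX1 (by norm_num)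
      _ = X := Real.rpow_one X) q hq (by
    rw [← Real.rpow_mul hX0.le]; norm_num; norm_num at hqX; exact hqX) b
  rw [Real.log_rpow hX0] at h
  have hlX : 0 < Real.log X := Real.log_pos (by linarith)
  have ht : (0 : ℝ) < Nat.totient q := by exact_mod_cast Nat.totient_pos.2 hq
  have hsub : (primesIoc 0 X).filter (fun p : ℕ => (p : ZMod q) = b)
      ⊆ (primesIoc (X ^ (1/2 : ℝ)) (X ^ (1/2 : ℝ) + X)).filter (fun p : ℕ => (p : ZMod q) = b)
        ∪ Icc 1 ⌊X ^ (1/2 : ℝ)⌋₊ := by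
    intro p hp
    rw [mem_filter] at hp
    have hp1 := (mem_primesIoc le_rfl).1 hp.1
    by_cases hpX : X ^ (1/2 : ℝ) < p
    · refine mem_union_left _ (mem_filter.2 ⟨(mem_primesIoc (by positivity)).2 ⟨hp1.1, hpX, ?_⟩, hp.2⟩)
      have : 0 ≤ X ^ (1/2 : ℝ) := by positivity
      linarith [hp1.2.2]
    · refine mem_union_right _ (mem_Icc.2 ⟨hp1.1.one_lt.le, Nat.le_floor (not_lt.1 hpX)⟩)
  have hc : ((#{p ∈ primesIoc 0 X | ((p : ℕ) : ZMod q) = b} : ℕ) : ℝ)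
      ≤ 33 * X / (Nat.totient q * (1/2 * Real.log X)) + X ^ (1/2 : ℝ) := by
    have h1 := (card_le_card hsub).trans (card_union_le _ _)
    rw [Nat.card_Icc, Nat.add_sub_cancel] at h1
    have h2 : (⌊X ^ (1/2 : ℝ)⌋₊ : ℝ) ≤ X ^ (1/2 : ℝ) := Nat.floor_le (by positivity)
    have h3 := (Nat.cast_le (α := ℝ)).2 h1
    push_cast at h3
    linarith
  refine hc.trans ?_
  have h4 : X ^ (1/2 : ℝ) ≤ X / (Nat.totient q * Real.log X) := by
    rw [le_div_iff₀ (by positivity)]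
    have h2 : (Nat.totient q : ℝ) ≤ X ^ (1/20 : ℝ) :=
      le_trans (by exact_mod_cast Nat.totient_le q) hqX
    calc _ ≤ X ^ (1/2 : ℝ) * (X ^ (1/20 : ℝ) * X ^ (1/10 : ℝ)) := by
          gcongr
          linarith
      _ = X ^ (13/20 : ℝ) := by
          rw [← Real.rpow_add hX0, ← Real.rpow_add hX0]; norm_num
      _ ≤ X ^ (1 : ℝ) := Real.rpow_le_rpow_of_exponent_le hX1 (by norm_num)
      _ = X := Real.rpow_one X
  have e5 : 33 * X / (Nat.totient q * (1/2 * Real.log X)) = 66 * X / (Nat.totient q * Real.log X) := by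
    field_simp; ring
  have e6 : 68 * X / (Nat.totient q * Real.log X) = 66 * X / (Nat.totient q * Real.log X)
    + 2 * (X / (Nat.totient q * Real.log X)) := by ring
  have e7 : 0 ≤ X / (Nat.totient q * Real.log X) := by positivity
  rw [e5, e6]
  linarith

/-- von Mangoldt version. -/
lemma bt_vm : ∃ z₀ : ℝ, ∀ z ≥ z₀, ∀ H : ℝ, z ^ (9/10 : ℝ) ≤ H → H ≤ z → ∀ q : ℕ, 0 < q →
    (q : ℝ) ≤ z ^ (1/10 : ℝ) → ∀ b : ZMod q,
    ∑ n ∈ Ioc ⌊z⌋₊ ⌊z + H⌋₊ with ((n : ℕ) : ZMod q) = b, ArithmeticFunction.vonMangoldt n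
      ≤ 67 * H / Nat.totient q := by
  obtain ⟨z₁, hz₁⟩ := bt_short
  have e1 := ev_log_pow (1/10) (by norm_num) 8
  obtain ⟨z₀, hz₀⟩ := eventually_atTop.1 (e1.and (eventually_ge_atTop (max 2 z₁)))
  refine ⟨z₀, fun z hz H hH hHz q hq hqz b => ?_⟩
  obtain ⟨hlog, hbig⟩ := hz₀ z hz
  have hz2 : 2 ≤ z := le_trans (le_max_left _ _) hbig
  have hz0 : 0 < z := by linarith
  have h := hz₁ z (le_trans (le_max_right _ _) hbig) H hH q hq hqz b
  have hlz : 0 < Real.log z := Real.log_pos (by linarith)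
  have ht : (0 : ℝ) < Nat.totient q := by exact_mod_cast Nat.totient_pos.2 hq
  have hH0 : 0 < H := lt_of_lt_of_le (by positivity) hH
  rw [← sum_filter_add_sum_filter_not _ (fun n : ℕ => n.Prime)]
  have h2z : Real.log (z + H) ≤ 2 * Real.log z := by
    have : Real.log (z + H) ≤ Real.log (z * z) := Real.log_le_log (by linarith) (by nlinarith)
    rw [Real.log_mul hz0.ne' hz0.ne'] at this
    linarith
  have hp1 : ∑ n ∈ ((Ioc ⌊z⌋₊ ⌊z + H⌋₊).filter (fun n : ℕ => (n : ZMod q) = b)).filter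
      (fun n : ℕ => n.Prime), ArithmeticFunction.vonMangoldt n ≤ 66 * H / Nat.totient q := by
    have e : ((Ioc ⌊z⌋₊ ⌊z + H⌋₊).filter (fun n : ℕ => (n : ZMod q) = b)).filter
      (fun n : ℕ => n.Prime) = (primesIoc z (z + H)).filter (fun p : ℕ => (p : ZMod q) = b) := by
      unfold primesIoc
      rw [filter_filter, filter_filter]
      simp only [and_comm]
    rw [e]
    calc _ ≤ ∑ n ∈ (primesIoc z (z + H)).filter (fun p : ℕ => (p : ZMod q) = b), 2 * Real.log z := by
          refine sum_le_sum fun p hp => ?_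
          have hp := (mem_primesIoc hz0.le).1 (mem_filter.1 hp).1
          rw [ArithmeticFunction.vonMangoldt_apply_prime hp.1]
          exact (Real.log_le_log (by exact_mod_cast hp.1.pos) hp.2.2).trans h2z
      _ ≤ (33 * H / (Nat.totient q * Real.log z)) * (2 * Real.log z) := by
          rw [sum_const, nsmul_eq_mul]
          gcongr
      _ = _ := by field_simp; ring
  have hp2 : ∑ n ∈ ((Ioc ⌊z⌋₊ ⌊z + H⌋₊).filter (fun n : ℕ => (n : ZMod q) = b)).filter
      (fun n : ℕ => ¬ n.Prime), ArithmeticFunction.vonMangoldt n ≤ H / Nat.totient q := by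
    have h1 : ∑ n ∈ ((Ioc ⌊z⌋₊ ⌊z + H⌋₊).filter (fun n : ℕ => (n : ZMod q) = b)).filter
      (fun n : ℕ => ¬ n.Prime), ArithmeticFunction.vonMangoldt n
        ≤ Chebyshev.psi (z + H) - Chebyshev.theta (z + H) := by
      rw [Chebyshev.psi_sub_theta_eq_sum_not_prime]
      refine sum_le_sum_of_subset_of_nonneg ?_ (fun _ _ _ => ArithmeticFunction.vonMangoldt_nonneg)
      intro n hn
      simp only [mem_filter, mem_Ioc] at hn ⊢
      exact ⟨⟨by omega, hn.1.1.2⟩, hn.2⟩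
    have h2 := Chebyshev.psi_sub_theta_le (show 1 ≤ z + H by linarith)
    refine (h1.trans h2).trans ?_
    rw [le_div_iff₀ ht]
    have h3 : √(z + H) ≤ 2 * z ^ (1/2 : ℝ) := by
      rw [← Real.sqrt_eq_rpow]
      calc √(z + H) ≤ √(2 ^ 2 * z) := Real.sqrt_le_sqrt (by linarith)
        _ = 2 * √z := by rw [Real.sqrt_mul (by norm_num), Real.sqrt_sq (by norm_num)]
    have h4 : (Nat.totient q : ℝ) ≤ z ^ (1/10 : ℝ) :=
      le_trans (by exact_mod_cast Nat.totient_le q) hqz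
    have h5 : 0 ≤ Real.log (z + H) := Real.log_nonneg (by linarith)
    calc 2 * √(z + H) * Real.log (z + H) * Nat.totient q
        ≤ 2 * (2 * z ^ (1/2 : ℝ)) * (2 * Real.log z) * z ^ (1/10 : ℝ) := by gcongr
      _ = z ^ (1/2 : ℝ) * (8 * Real.log z) * z ^ (1/10 : ℝ) := by ring
      _ ≤ z ^ (1/2 : ℝ) * z ^ (1/10 : ℝ) * z ^ (1/10 : ℝ) := by gcongr
      _ = z ^ (7/10 : ℝ) := by
          rw [← Real.rpow_add hz0, ← Real.rpow_add hz0]; norm_num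
      _ ≤ z ^ (9/10 : ℝ) := Real.rpow_le_rpow_of_exponent_le (by linarith) (by norm_num)
      _ ≤ H := hH
  have : 67 * H / (Nat.totient q : ℝ) = 66 * H / Nat.totient q + H / Nat.totient q := by ring
  linarith

lemma prod_ratio_le (S : Finset ℕ) : (∀ p ∈ S, 2 ≤ p) →
    ∏ p ∈ S, (1 - (p : ℝ)⁻¹)⁻¹ ≤ #S + 1 := by
  induction S using Finset.induction_on_max with
  | empty => intro _; simp
  | insert a S ha ih =>
    intro h
    have h1 := ih (fun p hp => h p (mem_insert_of_mem hp))
    have haS : a ∉ S := fun hh => lt_irrefl _ (ha a hh)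
    have ha2 : 2 ≤ a := h a (mem_insert_self _ _)
    rw [prod_insert haS, card_insert_of_notMem haS]
    have hcard : #S + 2 ≤ a := by
      have : S ⊆ Ico 2 a := fun p hp => mem_Ico.2 ⟨h p (mem_insert_of_mem hp), ha p hp⟩
      have := card_le_card this
      rw [Nat.card_Ico] at this
      omega
    have hc : (#S : ℝ) + 2 ≤ a := by exact_mod_cast hcard
    have ha1 : (0:ℝ) < (a : ℝ) - 1 := by
      have : (2:ℝ) ≤ a := by exact_mod_cast ha2
      linarith
    have e : (1 - (a : ℝ)⁻¹)⁻¹ = a / (a - 1) := by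
      have : (a : ℝ) ≠ 0 := by positivity
      field_simp
    rw [e]
    push_cast
    calc (a : ℝ) / (a - 1) * ∏ p ∈ S, (1 - (p : ℝ)⁻¹)⁻¹ ≤ (a : ℝ) / (a - 1) * (#S + 1) := by gcongr
      _ ≤ #S + 1 + 1 := by
        rw [div_mul_eq_mul_div, div_le_iff₀ ha1]
        nlinarith

lemma gq_le {q : ℕ} (hq : 0 < q) : (q : ℝ) / Nat.totient q ≤ 1 + Real.log q / Real.log 2 := by
  rw [← prod_inv_totient hq.ne']
  refine (prod_ratio_le _ (fun p hp => (Nat.prime_of_mem_primeFactors hp).two_le)).trans ?_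
  have h1 : 2 ^ #q.primeFactors ≤ q := by
    calc 2 ^ #q.primeFactors = ∏ p ∈ q.primeFactors, 2 := by rw [prod_const]
      _ ≤ ∏ p ∈ q.primeFactors, p := prod_le_prod' fun p hp => (Nat.prime_of_mem_primeFactors hp).two_le
      _ ≤ q := Nat.le_of_dvd hq (Nat.prod_primeFactors_dvd q)
  have h2 : (#q.primeFactors : ℝ) * Real.log 2 ≤ Real.log q := by
    rw [← Real.log_pow]
    exact Real.log_le_log (by positivity) (by exact_mod_cast h1)
  have : (#q.primeFactors : ℝ) ≤ Real.log q / Real.log 2 := by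
    rw [le_div_iff₀ (Real.log_pos (by norm_num))]; exact h2
  linarith

/-- `q/φ(q) ≤ C q^c`. -/
lemma gq_le_rpow {q : ℕ} (hq : 0 < q) {c : ℝ} (hc : 0 < c) :
    (q : ℝ) / Nat.totient q ≤ (1 + 2 / c) * (q : ℝ) ^ c := by
  have h := gq_le hq
  have hq1 : (1:ℝ) ≤ q := by exact_mod_cast hq
  have h1 : Real.log q ≤ (q:ℝ) ^ c / c := Real.log_le_rpow_div (by positivity) hc
  have h2 : (1:ℝ) ≤ (q:ℝ) ^ c := Real.one_le_rpow hq1 hc.le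
  have h3 : (1:ℝ)/2 ≤ Real.log 2 := by linarith [Real.log_two_gt_d9]
  have h4 : Real.log q / Real.log 2 ≤ ((q:ℝ) ^ c / c) / (1/2) := by
    have : 0 ≤ Real.log q := Real.log_nonneg hq1
    gcongr
  have h5 : ((q:ℝ) ^ c / c) / (1/2) = 2 / c * (q:ℝ) ^ c := by ring
  rw [h5] at h4
  linarith

end B4

section C1
open Finset

lemma bilin {q : ℕ} [NeZero q] (t : ZMod q) (ht : IsUnit t) (a b : ZMod q → ℂ) (A B : ℝ)
    (ha : ∀ u, ‖a u‖ ≤ A) (hb : ∀ u, ‖b u‖ ≤ B) :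
    ‖∑ u, ∑ v, a u * b v * ZMod.stdAddChar (t * (u * v))‖ ≤ A * B * (q * √q) := by
  have hA : 0 ≤ A := (norm_nonneg _).trans (ha 0)
  have hB : 0 ≤ B := (norm_nonneg _).trans (hb 0)
  let G : ZMod q → ℂ := fun u => ∑ v, b v * ZMod.stdAddChar (t * (u * v))
  have hq0 : (0:ℝ) < q := by exact_mod_cast NeZero.pos q
  have h1 : ∑ u, ‖G u‖ ^ 2 = q * ∑ v, ‖b v‖ ^ 2 := by
    have hc : ∑ u, ((‖G u‖ ^ 2 : ℝ) : ℂ) = q * ∑ v, ((‖b v‖ ^ 2 : ℝ) : ℂ) := by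
      have e1 : ∀ u, ((‖G u‖ ^ 2 : ℝ) : ℂ) = ∑ v, ∑ w, b v * (starRingEnd ℂ) (b w) *
          ZMod.stdAddChar (u * (t * (v - w))) := by
        intro u
        rw [Complex.ofReal_pow, ← Complex.mul_conj']
        simp only [G]
        rw [map_sum, sum_mul_sum]
        refine sum_congr rfl fun v _ => sum_congr rfl fun w _ => ?_
        rw [map_mul (starRingEnd ℂ)]
        have e2 : (ZMod.stdAddChar (u * (t * (v - w))) : ℂ) = ZMod.stdAddChar (t * (u * v)) *
            (starRingEnd ℂ) (ZMod.stdAddChar (t * (u * w))) := by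
          rw [← AddChar.map_neg_eq_conj, ← AddChar.map_add_eq_mul]
          congr 1; ring
        rw [e2]; ring
      simp_rw [e1]
      rw [sum_comm]
      simp_rw [sum_comm (s := univ) (t := univ) (f := fun u w => _ * ZMod.stdAddChar (u * (t * (_ - w)))),
        ← mul_sum]
      rw [mul_sum]
      refine sum_congr rfl fun v _ => ?_
      have e3 : ∀ w, ∑ u : ZMod q, (ZMod.stdAddChar (u * (t * (v - w))) : ℂ)
          = if v = w then (q : ℂ) else 0 := by
        intro w
        have := AddChar.sum_mulShift (R := ZMod q) (R' := ℂ) (ψ := ZMod.stdAddChar) (t * (v - w))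
          (ZMod.isPrimitive_stdAddChar q)
        rw [this, ZMod.card]
        have h2 : t * (v - w) = 0 ↔ v = w := by
          rw [ht.mul_right_eq_zero, sub_eq_zero]
        simp only [h2]
        split_ifs <;> simp
      simp_rw [e3]
      simp only [mul_ite, mul_zero, sum_ite_eq, mem_univ, if_true]
      rw [Complex.mul_conj']
      push_cast; ring
    exact_mod_cast hc
  have h2 : ∑ u, ‖G u‖ ^ 2 ≤ (q * B) ^ 2 := by
    rw [h1]
    have : ∑ v : ZMod q, ‖b v‖ ^ 2 ≤ ∑ v : ZMod q, B ^ 2 :=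
      sum_le_sum fun v _ => by gcongr; exact hb v
    rw [sum_const, card_univ, ZMod.card, nsmul_eq_mul] at this
    calc _ ≤ (q:ℝ) * (q * B ^ 2) := by gcongr
      _ = _ := by ring
  have h3 : ∑ u, ‖G u‖ ≤ √q * (q * B) := by
    have := Finset.sum_mul_sq_le_sq_mul_sq univ (fun _ : ZMod q => (1:ℝ)) (fun u => ‖G u‖)
    simp only [one_mul, one_pow, sum_const, card_univ, ZMod.card, nsmul_eq_mul, mul_one] at this
    have h4 : (∑ u, ‖G u‖) ^ 2 ≤ (√q * (q * B)) ^ 2 := by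
      rw [mul_pow, Real.sq_sqrt hq0.le]
      refine this.trans ?_
      gcongr
    exact le_of_sq_le_sq h4 (by positivity)
  calc ‖∑ u, ∑ v, a u * b v * ZMod.stdAddChar (t * (u * v))‖
      = ‖∑ u, a u * G u‖ := by
        congr 1
        refine sum_congr rfl fun u _ => ?_
        simp only [G]
        rw [mul_sum]
        refine sum_congr rfl fun v _ => by ring
    _ ≤ ∑ u, ‖a u * G u‖ := norm_sum_le _ _
    _ ≤ ∑ u, A * ‖G u‖ := sum_le_sum fun u _ => by
        rw [norm_mul]; gcongr; exact ha u
    _ = A * ∑ u, ‖G u‖ := by rw [mul_sum]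
    _ ≤ A * (√q * (q * B)) := by gcongr
    _ = _ := by ring

open Classical in
/-- mean value of the additive character over units -/
noncomputable def cq (q : ℕ) [NeZero q] (t : ZMod q) : ℂ :=
  (∑ u : ZMod q, if IsUnit u then ZMod.stdAddChar (t * u) else 0) / (Nat.totient q : ℂ)

open Classical in
noncomputable def fq (q : ℕ) [NeZero q] (t u : ZMod q) : ℂ :=
  if IsUnit u then ZMod.stdAddChar (t * u) - cq q t else 0

open Classical in
lemma card_units_filter (q : ℕ) [NeZero q] :
    #{u : ZMod q | IsUnit u} = Nat.totient q := by
  rw [← ZMod.card_units_eq_totient q, ← Fintype.card_coe]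
  refine Fintype.card_congr ?_
  refine (Equiv.ofBijective (fun u : (ZMod q)ˣ => (⟨(u : ZMod q), by simp⟩ :
    {x // x ∈ ({u : ZMod q | IsUnit u} : Finset (ZMod q))})) ⟨?_, ?_⟩).symm
  · intro a b h
    exact Units.ext (by simpa using h)
  · rintro ⟨x, hx⟩
    rw [mem_filter] at hx
    obtain ⟨u, rfl⟩ := hx.2
    exact ⟨u, rfl⟩

lemma totient_ne_zero' (q : ℕ) [NeZero q] : (Nat.totient q : ℂ) ≠ 0 := by
  have := Nat.totient_pos.2 (NeZero.pos q)
  exact_mod_cast this.ne'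

lemma sum_fq (q : ℕ) [NeZero q] (t : ZMod q) : ∑ u, fq q t u = 0 := by
  classical
  unfold fq
  have : ∀ u : ZMod q, (if IsUnit u then ZMod.stdAddChar (t * u) - cq q t else 0)
      = (if IsUnit u then (ZMod.stdAddChar (t * u) : ℂ) else 0) - (if IsUnit u then cq q t else 0) := by
    intro u; split_ifs <;> simp
  rw [sum_congr rfl (fun u _ => this u), sum_sub_distrib, ← sum_filter (p := fun u => IsUnit u) (f := fun _ => cq q t),
    sum_const, card_units_filter, nsmul_eq_mul]
  unfold cq
  rw [mul_div_cancel₀ _ (totient_ne_zero' q), sub_self]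

lemma norm_cq_le_one (q : ℕ) [NeZero q] (t : ZMod q) : ‖cq q t‖ ≤ 1 := by
  classical
  unfold cq
  rw [norm_div, Complex.norm_natCast]
  have ht : (0:ℝ) < Nat.totient q := by exact_mod_cast Nat.totient_pos.2 (NeZero.pos q)
  rw [div_le_one ht, ← sum_filter]
  refine (norm_sum_le _ _).trans ?_
  rw [← card_units_filter q, ← nsmul_one, ← sum_const]
  exact sum_le_sum fun u _ => (AddChar.norm_apply _ _).le

lemma norm_fq_le (q : ℕ) [NeZero q] (t u : ZMod q) : ‖fq q t u‖ ≤ 2 := by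
  unfold fq
  split_ifs
  · refine (norm_sub_le _ _).trans ?_
    have := norm_cq_le_one q t
    rw [AddChar.norm_apply]; linarith
  · simp

lemma norm_cq_le (q : ℕ) [NeZero q] (t : ZMod q) (ht : IsUnit t) :
    ‖cq q t‖ ≤ q * √q / (Nat.totient q : ℝ) ^ 2 := by
  classical
  have hp : (0:ℝ) < Nat.totient q := by exact_mod_cast Nat.totient_pos.2 (NeZero.pos q)
  have h := bilin t ht (fun u => if IsUnit u then 1 else 0) (fun u => if IsUnit u then 1 else 0) 1 1
    (fun u => by split_ifs <;> simp) (fun u => by split_ifs <;> simp)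
  have e : ∑ u : ZMod q, ∑ v : ZMod q, (if IsUnit u then (1:ℂ) else 0) * (if IsUnit v then 1 else 0) *
      ZMod.stdAddChar (t * (u * v)) = (Nat.totient q : ℂ) ^ 2 * cq q t := by
    have e1 : ∀ u : ZMod q, (∑ v : ZMod q, (if IsUnit u then (1:ℂ) else 0) * (if IsUnit v then 1 else 0) *
      ZMod.stdAddChar (t * (u * v))) = if IsUnit u then (Nat.totient q : ℂ) * cq q t else 0 := by
      intro u
      split_ifs with hu
      · unfold cq
        rw [mul_div_cancel₀ _ (totient_ne_zero' q)]
        obtain ⟨u, rfl⟩ := hu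
        refine Fintype.sum_equiv (Units.mulLeft u) _ _ fun v => ?_
        have : IsUnit ((Units.mulLeft u) v) ↔ IsUnit v := by
          simp
        simp only [this]
        split_ifs <;> simp
      · simp
    rw [sum_congr rfl (fun u _ => e1 u), ← sum_filter, sum_const, card_units_filter, nsmul_eq_mul]
    ring
  rw [e, norm_mul, norm_pow, Complex.norm_natCast, one_mul, one_mul] at h
  rw [le_div_iff₀ (by positivity)]
  linarith

lemma bilin_fq (q : ℕ) [NeZero q] (t : ZMod q) (ht : IsUnit t) (a b : ZMod q → ℝ) (A B : ℝ)
    (ha0 : ∀ u, 0 ≤ a u) (hb0 : ∀ u, 0 ≤ b u)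
    (ha : ∀ u, a u ≤ A) (hb : ∀ u, b u ≤ B) :
    ‖∑ u, ∑ v, (a u : ℂ) * b v * fq q t (u * v)‖
      ≤ A * B * (q * √q) * (1 + (q / (Nat.totient q : ℝ)) ^ 2) := by
  classical
  have hA : 0 ≤ A := (ha0 0).trans (ha 0)
  have hB : 0 ≤ B := (hb0 0).trans (hb 0)
  have hp : (0:ℝ) < Nat.totient q := by exact_mod_cast Nat.totient_pos.2 (NeZero.pos q)
  let a' : ZMod q → ℂ := fun u => if IsUnit u then (a u : ℂ) else 0
  let b' : ZMod q → ℂ := fun u => if IsUnit u then (b u : ℂ) else 0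
  have ha' : ∀ u, ‖a' u‖ ≤ A := by
    intro u; simp only [a']; split_ifs
    · rw [Complex.norm_real, Real.norm_of_nonneg (ha0 u)]; exact ha u
    · simpa using hA
  have hb' : ∀ u, ‖b' u‖ ≤ B := by
    intro u; simp only [b']; split_ifs
    · rw [Complex.norm_real, Real.norm_of_nonneg (hb0 u)]; exact hb u
    · simpa using hB
  have e : ∑ u, ∑ v, (a u : ℂ) * b v * fq q t (u * v)
      = ∑ u, ∑ v, a' u * b' v * ZMod.stdAddChar (t * (u * v)) - cq q t * ((∑ u, a' u) * ∑ v, b' v) := by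
    rw [sum_mul_sum, mul_sum, ← sum_sub_distrib]
    refine sum_congr rfl fun u _ => ?_
    rw [mul_sum, ← sum_sub_distrib]
    refine sum_congr rfl fun v _ => ?_
    simp only [fq, a', b', IsUnit.mul_iff]
    by_cases hu : IsUnit u
    · by_cases hv : IsUnit v
      · simp only [hu, hv, and_self, if_true]; ring
      · simp [hv]
    · simp [hu]
  rw [e]
  refine (norm_sub_le _ _).trans ?_
  have h1 := bilin t ht a' b' A B ha' hb'
  have h2 : ‖∑ u, a' u‖ ≤ q * A := by
    refine (norm_sum_le _ _).trans ?_
    refine (sum_le_sum fun u _ => ha' u).trans ?_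
    rw [sum_const, card_univ, ZMod.card, nsmul_eq_mul]
  have h3 : ‖∑ u, b' u‖ ≤ q * B := by
    refine (norm_sum_le _ _).trans ?_
    refine (sum_le_sum fun u _ => hb' u).trans ?_
    rw [sum_const, card_univ, ZMod.card, nsmul_eq_mul]
  have h4 : ‖cq q t * ((∑ u, a' u) * ∑ v, b' v)‖
      ≤ (q * √q / (Nat.totient q : ℝ) ^ 2) * ((q * A) * (q * B)) := by
    rw [norm_mul, norm_mul]
    gcongr
    exact norm_cq_le q t ht
  refine (add_le_add h1 h4).trans (le_of_eq ?_)
  field_simp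

lemma sum_period {q : ℕ} [NeZero q] (F : ZMod q → ℂ) (B : ℝ) (hF : ∑ u, F u = 0)
    (hB : ∀ u, ‖F u‖ ≤ B) (a b : ℕ) : ‖∑ m ∈ Ioc a b, F (m : ZMod q)‖ ≤ B * q := by
  have hB0 : 0 ≤ B := (norm_nonneg _).trans (hB 0)
  rcases lt_or_ge b a with hab | hab
  · rw [Ioc_eq_empty_of_le hab.le]; simp; positivity
  have e1 : ∑ m ∈ Ioc a b, F (m : ZMod q)
      = ∑ u : ZMod q, ((#{m ∈ Ioc a b | ((m : ℕ) : ZMod q) = u} : ℕ) : ℂ) * F u := by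
    rw [← sum_fiberwise_of_maps_to (g := fun m : ℕ => (m : ZMod q)) (t := univ) (fun _ _ => mem_univ _)]
    refine sum_congr rfl fun u _ => ?_
    rw [sum_congr rfl (g := fun _ => F u) (fun m hm => by rw [(mem_filter.1 hm).2]), sum_const, nsmul_eq_mul]
  have e2 : ∑ m ∈ Ioc a b, F (m : ZMod q)
      = ∑ u : ZMod q, (((#{m ∈ Ioc a b | ((m : ℕ) : ZMod q) = u} : ℕ) : ℝ) - (b - a : ℝ) / (q * (1:ℕ)) : ℝ) * F u := by
    rw [e1]
    have : ∑ u : ZMod q, (((b - a : ℝ) / (q * (1:ℕ)) : ℝ) : ℂ) * F u = 0 := by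
      rw [← mul_sum, hF, mul_zero]
    rw [← sub_zero (∑ u : ZMod q, _), ← this, ← sum_sub_distrib]
    refine sum_congr rfl fun u _ => ?_
    push_cast; ring
  rw [e2]
  refine (norm_sum_le _ _).trans ?_
  calc _ ≤ ∑ u : ZMod q, 1 * B := by
        refine sum_le_sum fun u _ => ?_
        rw [norm_mul, Complex.norm_real]
        gcongr
        · have h := count_crt (NeZero.pos q) one_pos (Nat.coprime_one_left q) u.val a b hab
          rw [Real.norm_eq_abs]
          have e3 : (Ioc a b).filter (fun m : ℕ => (m : ZMod q) = u)
            = (Ioc a b).filter (fun n => n ≡ u.val [MOD q] ∧ 1 ∣ n) := by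
            refine filter_congr fun m _ => ?_
            rw [← ZMod.natCast_eq_natCast_iff]; simp
          rw [e3]
          exact h
        · exact hB u
    _ = _ := by rw [sum_const, card_univ, ZMod.card, nsmul_eq_mul]; ring

end C1

section C2
open Finset ArithmeticFunction
open scoped ArithmeticFunction.Moebius ArithmeticFunction.zeta

lemma sum_antidiag_swap {R : Type*} [AddCommMonoid R] (u v : ℕ) (g : ℕ → ℕ → R) :
    ∑ n ∈ Ioc u v, ∑ x ∈ n.divisorsAntidiagonal, g x.1 x.2
      = ∑ d ∈ Ioc 0 v, ∑ m ∈ Ioc (u / d) (v / d), g d m := by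
  rw [sum_sigma', sum_sigma']
  refine sum_bij' (fun x _ => ⟨x.2.1, x.2.2⟩) (fun y _ => ⟨y.1 * y.2, (y.1, y.2)⟩) ?_ ?_ ?_ ?_ ?_
  · rintro ⟨n, ⟨d, m⟩⟩ h
    simp only [mem_sigma, mem_Ioc, Nat.mem_divisorsAntidiagonal] at h ⊢
    obtain ⟨⟨h1, h2⟩, h3, h4⟩ := h
    subst h3
    have hd : 0 < d := Nat.pos_of_ne_zero fun h => h4 (by simp [h])
    have hm : 0 < m := Nat.pos_of_ne_zero fun h => h4 (by simp [h])
    refine ⟨⟨hd, le_trans (Nat.le_mul_of_pos_right d hm) h2⟩, ?_, ?_⟩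
    · rw [Nat.div_lt_iff_lt_mul hd, mul_comm]; exact h1
    · rw [Nat.le_div_iff_mul_le hd, mul_comm]; exact h2
  · rintro ⟨d, m⟩ h
    simp only [mem_sigma, mem_Ioc, Nat.mem_divisorsAntidiagonal] at h ⊢
    obtain ⟨⟨h1, h2⟩, h3, h4⟩ := h
    rw [Nat.div_lt_iff_lt_mul h1, mul_comm] at h3
    rw [Nat.le_div_iff_mul_le h1, mul_comm] at h4
    exact ⟨⟨h3, h4⟩, trivial, by omega⟩
  · rintro ⟨n, ⟨d, m⟩⟩ h
    simp only [mem_sigma, mem_Ioc, Nat.mem_divisorsAntidiagonal] at h ⊢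
    obtain ⟨⟨h1, h2⟩, h3, h4⟩ := h
    subst h3; rfl
  · rintro ⟨d, m⟩ h; rfl
  · rintro ⟨n, ⟨d, m⟩⟩ h; rfl

/-- logarithmic derivation -/
noncomputable def Dl (f : ArithmeticFunction ℝ) : ArithmeticFunction ℝ := pmul f log

lemma Dl_mul (f g : ArithmeticFunction ℝ) : Dl (f * g) = Dl f * g + f * Dl g := by
  ext n
  simp only [Dl, pmul_apply, mul_apply, ArithmeticFunction.add_apply, log_apply]
  rw [sum_mul, ← sum_add_distrib]
  refine sum_congr rfl fun x hx => ?_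
  obtain ⟨h1, h2⟩ := Nat.mem_divisorsAntidiagonal.1 hx
  have ha : (x.1 : ℝ) ≠ 0 := by
    intro h; apply h2; rw [← h1]; simp only [Nat.cast_eq_zero] at h; simp [h]
  have hb : (x.2 : ℝ) ≠ 0 := by
    intro h; apply h2; rw [← h1]; simp only [Nat.cast_eq_zero] at h; simp [h]
  rw [← h1, Nat.cast_mul, Real.log_mul ha hb]
  ring

lemma Dl_mu_zeta : Dl (μ : ArithmeticFunction ℝ) * (ζ : ArithmeticFunction ℝ) = - Λ := by
  ext n
  rw [coe_mul_zeta_apply, ArithmeticFunction.neg_apply, ← sum_moebius_mul_log_eq]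
  rfl

lemma Dl2_mu_zeta : Dl (Dl (μ : ArithmeticFunction ℝ)) * (ζ : ArithmeticFunction ℝ) = Λ * Λ - Dl Λ := by
  have h := congrArg Dl Dl_mu_zeta
  rw [Dl_mul] at h
  have h1 : Dl (ζ : ArithmeticFunction ℝ) = (ζ : ArithmeticFunction ℝ) * Λ := by
    rw [zeta_mul_vonMangoldt]
    ext n
    simp only [Dl, pmul_apply, natCoe_apply, zeta_apply]
    by_cases hn : n = 0 <;> simp [hn]
  have h2 : Dl (-Λ) = - Dl Λ := by
    ext n; simp only [Dl, pmul_apply, ArithmeticFunction.neg_apply]; ring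
  rw [h1, ← mul_assoc, Dl_mu_zeta, h2] at h
  rw [eq_sub_of_add_eq h]
  ring

lemma selberg_id (n : ℕ) (hn : 1 < n) (L : ℝ) :
    ∑ d ∈ n.divisors, (μ d : ℝ) * (L - Real.log d) ^ 2
      = Λ n * (2 * L - Real.log n) + (Λ * Λ) n := by
  have h0 : ∑ d ∈ n.divisors, (μ d : ℝ) = 0 := by
    have := congrArg (fun f => f n) (coe_moebius_mul_coe_zeta (R := ℝ))
    simp only [coe_mul_zeta_apply, intCoe_apply, one_apply, hn.ne', if_false] at this
    exact this
  have h1 := sum_moebius_mul_log_eq (n := n)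
  have h2 := congrArg (fun f => f n) Dl2_mu_zeta
  rw [show (Λ * Λ - Dl Λ) = Λ * Λ + -Dl Λ from sub_eq_add_neg _ _] at h2
  simp only [coe_mul_zeta_apply, ArithmeticFunction.add_apply, ArithmeticFunction.neg_apply] at h2
  simp only [Dl, pmul_apply, intCoe_apply, log_apply] at h2
  simp only [log_apply] at h1
  have : ∑ d ∈ n.divisors, (μ d : ℝ) * (L - Real.log d) ^ 2
      = L ^ 2 * ∑ d ∈ n.divisors, (μ d : ℝ) - 2 * L * ∑ d ∈ n.divisors, (μ d : ℝ) * Real.log d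
        + ∑ d ∈ n.divisors, (μ d : ℝ) * Real.log d * Real.log d := by
    rw [mul_sum, mul_sum, ← sum_sub_distrib, ← sum_add_distrib]
    exact sum_congr rfl fun d _ => by ring
  rw [this, h0, h1, h2]
  ring

lemma sum_rpow_le (s : ℝ) (hs : 0 < s) (hs1 : s ≤ 1) (N : ℕ) :
    ∑ d ∈ Ioc 0 N, (d : ℝ) ^ (s - 1) ≤ (N : ℝ) ^ s / s := by
  induction N with
  | zero => simp [Real.zero_rpow hs.ne']
  | succ N ih =>
    rw [sum_Ioc_succ_top (Nat.zero_le _)]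
    have hp : (0:ℝ) < (N + 1 : ℕ) := by positivity
    have h := rpow_one_add_le_one_add_mul_self (s := -1 / (N + 1 : ℕ))
      (by rw [le_div_iff₀ hp]; push_cast; nlinarith) hs.le hs1
    have e : (1 + -1 / ((N + 1 : ℕ):ℝ)) = N / (N + 1 : ℕ) := by
      field_simp; push_cast; ring
    rw [e, Real.div_rpow (by positivity) hp.le, div_le_iff₀ (by positivity)] at h
    have e2 : ((N + 1 : ℕ) : ℝ) ^ (s - 1) = ((N + 1 : ℕ) : ℝ) ^ s / (N + 1 : ℕ) := by
      rw [Real.rpow_sub hp, Real.rpow_one]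
    rw [e2]
    have : (N:ℝ) ^ s / s + ((N + 1 : ℕ) : ℝ) ^ s / (N + 1 : ℕ) ≤ ((N + 1 : ℕ) : ℝ) ^ s / s := by
      rw [div_add_div _ _ hs.ne' hp.ne', div_le_div_iff₀ (by positivity) hs]
      have h3 := mul_le_mul_of_nonneg_right h (by positivity : 0 ≤ ((N + 1 : ℕ) : ℝ) * s)
      have e4 : (1 + s * (-1 / ((N + 1 : ℕ):ℝ))) * ((N + 1 : ℕ):ℝ) ^ s * (((N + 1 : ℕ):ℝ) * s)
        = ((N + 1 : ℕ):ℝ) ^ s * ((((N + 1 : ℕ):ℝ) - s) * s) := by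
        field_simp; ring
      rw [e4] at h3
      nlinarith
    linarith

lemma fq_inner (q : ℕ) [NeZero q] (t : ZMod q) (d a b : ℕ) :
    ‖∑ m ∈ Ioc a b, fq q t ((d * m : ℕ) : ZMod q)‖ ≤ 2 * q := by
  by_cases hd : IsUnit (d : ZMod q)
  · have := sum_period (fun u => fq q t ((d : ZMod q) * u)) 2 ?_ (fun u => norm_fq_le q t _) a b
    · simpa using this
    · rw [← sum_fq q t]
      obtain ⟨u, hu⟩ := hd
      rw [← hu]
      exact Fintype.sum_equiv (Units.mulLeft u) _ _ fun v => rfl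
  · have : ∀ m ∈ Ioc a b, fq q t ((d * m : ℕ) : ZMod q) = 0 := by
      intro m _
      unfold fq
      rw [if_neg]
      push_cast
      rw [IsUnit.mul_iff]; tauto
    rw [sum_eq_zero this]; simp

lemma logsq_min (ε : ℝ) (hε : 0 < ε) (hε1 : ε ≤ 1) (q y : ℝ) (hq : 1 ≤ q) (hy : 1 ≤ y) (s : ℝ)
    (hs0 : 0 ≤ s) (hs1 : s ≤ 2 * q) (hs2 : s ≤ 2 * y) :
    Real.log y ^ 2 * s ≤ 32 / ε ^ 2 * q ^ ε * y ^ (1 - ε / 2) := by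
  have hl : Real.log y ≤ y ^ (ε / 4) / (ε / 4) := Real.log_le_rpow_div (by linarith) (by positivity)
  have hl0 : 0 ≤ Real.log y := Real.log_nonneg hy
  have h1 : Real.log y ^ 2 ≤ 16 / ε ^ 2 * y ^ (ε / 2) := by
    calc Real.log y ^ 2 ≤ (y ^ (ε / 4) / (ε / 4)) ^ 2 := by gcongr
      _ = 16 / ε ^ 2 * (y ^ (ε / 4)) ^ 2 := by field_simp; ring
      _ = _ := by rw [← Real.rpow_mul_natCast (by linarith)]; congr 2; push_cast; ring
  have h2 : s ≤ 2 * (q ^ ε * y ^ (1 - ε)) := by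
    have e : s / 2 = (s / 2) ^ ε * (s / 2) ^ (1 - ε) := by
      rcases hs0.eq_or_lt with h | h
      · rw [← h]; simp [Real.zero_rpow hε.ne']
      · rw [← Real.rpow_add (by linarith)]; simp
    have : s / 2 ≤ q ^ ε * y ^ (1 - ε) := by
      rw [e]
      gcongr
      · linarith
      · linarith
    linarith
  calc Real.log y ^ 2 * s ≤ (16 / ε ^ 2 * y ^ (ε / 2)) * (2 * (q ^ ε * y ^ (1 - ε))) := by gcongr
    _ = 32 / ε ^ 2 * q ^ ε * (y ^ (ε / 2) * y ^ (1 - ε)) := by ring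
    _ = _ := by rw [← Real.rpow_add (by linarith)]; congr 2; ring

lemma T_bound (ε : ℝ) (hε : 0 < ε) (hε1 : ε ≤ 1) (q : ℕ) [NeZero q] (t : ZMod q) (z X : ℝ)
    (hX : 1 ≤ X) :
    ‖∑ n ∈ Ioc ⌊z⌋₊ ⌊X⌋₊, fq q t (n : ZMod q) *
      ((∑ d ∈ n.divisors, (μ d : ℝ) * (Real.log X - Real.log d) ^ 2 : ℝ) : ℂ)‖
      ≤ 64 / ε ^ 3 * (q:ℝ) ^ ε * X := by
  have hq : (1:ℝ) ≤ q := by exact_mod_cast NeZero.pos q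
  have e : ∑ n ∈ Ioc ⌊z⌋₊ ⌊X⌋₊, fq q t (n : ZMod q) *
      ((∑ d ∈ n.divisors, (μ d : ℝ) * (Real.log X - Real.log d) ^ 2 : ℝ) : ℂ)
      = ∑ d ∈ Ioc 0 ⌊X⌋₊, ∑ m ∈ Ioc (⌊z⌋₊ / d) (⌊X⌋₊ / d),
        (((μ d : ℝ) * (Real.log X - Real.log d) ^ 2 : ℝ) : ℂ) * fq q t ((d * m : ℕ) : ZMod q) := by
    rw [← sum_antidiag_swap ⌊z⌋₊ ⌊X⌋₊ (fun d m => (((μ d : ℝ) * (Real.log X - Real.log d) ^ 2 : ℝ) : ℂ) * fq q t ((d * m : ℕ) : ZMod q))]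
    refine sum_congr rfl fun n hn => ?_
    rw [← Nat.sum_divisorsAntidiagonal (f := fun d _ => (μ d : ℝ) * (Real.log X - Real.log d) ^ 2),
      Complex.ofReal_sum, mul_sum]
    refine sum_congr rfl fun x hx => ?_
    rw [(Nat.mem_divisorsAntidiagonal.1 hx).1, mul_comm]
  rw [e]
  refine (norm_sum_le _ _).trans ?_
  have hb : ∀ d ∈ Ioc 0 ⌊X⌋₊, ‖∑ m ∈ Ioc (⌊z⌋₊ / d) (⌊X⌋₊ / d),
        (((μ d : ℝ) * (Real.log X - Real.log d) ^ 2 : ℝ) : ℂ) * fq q t ((d * m : ℕ) : ZMod q)‖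
        ≤ 32 / ε ^ 2 * (q:ℝ) ^ ε * X ^ (1 - ε / 2) * (d : ℝ) ^ (ε / 2 - 1) := by
    intro d hd
    obtain ⟨hd0, hd1⟩ := mem_Ioc.1 hd
    have hd0' : (0:ℝ) < d := by exact_mod_cast hd0
    have hdX : (d:ℝ) ≤ X := le_trans (by exact_mod_cast hd1) (Nat.floor_le (by linarith))
    rw [← mul_sum, norm_mul, Complex.norm_real, Real.norm_eq_abs, abs_mul,
      abs_of_nonneg (sq_nonneg (Real.log X - Real.log d)), ← Real.log_div (by linarith) hd0'.ne']
    have hmu : |((μ d : ℤ) : ℝ)| ≤ 1 := by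
      have := abs_moebius_le_one (n := d)
      exact_mod_cast this
    have h2 : ‖∑ m ∈ Ioc (⌊z⌋₊ / d) (⌊X⌋₊ / d), fq q t ((d * m : ℕ) : ZMod q)‖ ≤ 2 * (X / d) := by
      refine (norm_sum_le _ _).trans ((sum_le_sum fun m _ => norm_fq_le q t _).trans ?_)
      rw [sum_const, nsmul_eq_mul, Nat.card_Ioc, mul_comm]
      gcongr
      calc ((⌊X⌋₊ / d - ⌊z⌋₊ / d : ℕ) : ℝ) ≤ ((⌊X⌋₊ / d : ℕ) : ℝ) := by
            exact_mod_cast Nat.sub_le _ _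
        _ ≤ (⌊X⌋₊ : ℝ) / d := Nat.cast_div_le
        _ ≤ X / d := by gcongr; exact Nat.floor_le (by linarith)
    have h3 := logsq_min ε hε hε1 q (X / d) hq (by rw [le_div_iff₀ hd0']; linarith) _
      (norm_nonneg _) (fq_inner q t d (⌊z⌋₊ / d) (⌊X⌋₊ / d)) h2
    have e5 : (X / d) ^ (1 - ε / 2) = X ^ (1 - ε / 2) * (d : ℝ) ^ (ε / 2 - 1) := by
      rw [Real.div_rpow (by linarith) hd0'.le, div_eq_mul_inv, ← Real.rpow_neg hd0'.le]
      congr 2; ring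
    rw [e5] at h3
    calc _ ≤ 1 * Real.log (X / d) ^ 2 * ‖∑ m ∈ Ioc (⌊z⌋₊ / d) (⌊X⌋₊ / d), fq q t ((d * m : ℕ) : ZMod q)‖ := by
          gcongr
      _ ≤ _ := by rw [one_mul]; refine h3.trans (le_of_eq (by ring))
  refine (sum_le_sum hb).trans ?_
  rw [← mul_sum]
  have h6 := sum_rpow_le (ε / 2) (by positivity) (by linarith) ⌊X⌋₊
  have h7 : (⌊X⌋₊ : ℝ) ^ (ε / 2) ≤ X ^ (ε / 2) := by
    gcongr; exact Nat.floor_le (by linarith)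
  calc _ ≤ 32 / ε ^ 2 * (q:ℝ) ^ ε * X ^ (1 - ε / 2) * (X ^ (ε / 2) / (ε / 2)) := by
        gcongr
        refine h6.trans ?_
        gcongr
    _ = 64 / ε ^ 3 * (q:ℝ) ^ ε * (X ^ (1 - ε / 2) * X ^ (ε / 2)) := by field_simp; ring
    _ = _ := by rw [← Real.rpow_add (by linarith)]; simp

/-- upper Mertens for the von Mangoldt function -/
lemma mertens_vm : ∃ C : ℝ, 0 < C ∧ ∀ w : ℝ, 1 ≤ w → ∑ a ∈ Ioc 0 ⌊w⌋₊, Λ a / a ≤ Real.log w + C := by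
  refine ⟨Real.log 4 + 4, by positivity, fun w hw => ?_⟩
  set N := ⌊w⌋₊ with hN
  have hN1 : 1 ≤ N := Nat.one_le_floor_iff _ |>.2 hw
  have hNp : (0:ℝ) < N := by exact_mod_cast hN1
  have h1 := ArithmeticFunction.sum_Ioc_mul_zeta_eq_sum (Λ) N
  rw [vonMangoldt_mul_zeta] at h1
  have h2 : ∑ n ∈ Ioc 0 N, log n ≤ N * Real.log N := by
    calc _ ≤ ∑ n ∈ Ioc 0 N, Real.log N := by
          refine sum_le_sum fun n hn => ?_
          rw [log_apply]
          obtain ⟨h, h'⟩ := mem_Ioc.1 hn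
          exact Real.log_le_log (by exact_mod_cast h) (by exact_mod_cast h')
      _ = _ := by rw [sum_const, Nat.card_Ioc, nsmul_eq_mul]; simp
  have h3 : ∑ n ∈ Ioc 0 N, Λ n ≤ (Real.log 4 + 4) * N := by
    have := Chebyshev.psi_le_const_mul_self (x := N) hNp.le
    rw [Chebyshev.psi, Nat.floor_natCast] at this
    exact this
  have h4 : ∑ a ∈ Ioc 0 N, Λ a / a * N ≤ ∑ a ∈ Ioc 0 N, (Λ a * (N / a : ℕ) + Λ a) := by
    refine sum_le_sum fun a ha => ?_
    have ha0 : (0:ℝ) < a := by exact_mod_cast (mem_Ioc.1 ha).1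
    have : (N:ℝ) / a ≤ (N / a : ℕ) + 1 := by
      rw [← Nat.floor_div_eq_div (K := ℝ)]
      exact (Nat.lt_floor_add_one _).le
    calc Λ a / a * N = Λ a * (N / a) := by ring
      _ ≤ Λ a * ((N / a : ℕ) + 1) := by gcongr
      _ = _ := by ring
  rw [sum_add_distrib, ← h1, ← sum_mul] at h4
  have h5 : (∑ a ∈ Ioc 0 N, Λ a / a) * N ≤ (Real.log N + (Real.log 4 + 4)) * N := by linarith
  have h6 := le_of_mul_le_mul_right h5 hNp
  have h7 : Real.log N ≤ Real.log w := Real.log_le_log hNp (Nat.floor_le (by linarith))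
  linarith

end C2

section C3
open Finset ArithmeticFunction Filter

/-- bilinear von Mangoldt sum -/
noncomputable def VV (q : ℕ) [NeZero q] (t : ZMod q) (z X : ℝ) (s r : ℕ) : ℂ :=
  ∑ a ∈ Ioc s r, ∑ b ∈ Ioc (⌊z⌋₊ / a) (⌊X⌋₊ / a), ((Λ a * Λ b : ℝ) : ℂ) * fq q t ((a * b : ℕ) : ZMod q)

lemma VV_eq (q : ℕ) [NeZero q] (t : ZMod q) (z X : ℝ) :
    ∑ n ∈ Ioc ⌊z⌋₊ ⌊X⌋₊, fq q t (n : ZMod q) * (((Λ * Λ) n : ℝ) : ℂ) = VV q t z X 0 ⌊X⌋₊ := by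
  unfold VV
  rw [← sum_antidiag_swap ⌊z⌋₊ ⌊X⌋₊ (fun a b => ((Λ a * Λ b : ℝ) : ℂ) * fq q t ((a * b : ℕ) : ZMod q))]
  refine sum_congr rfl fun n hn => ?_
  rw [ArithmeticFunction.mul_apply, Complex.ofReal_sum, mul_sum]
  refine sum_congr rfl fun x hx => ?_
  rw [(Nat.mem_divisorsAntidiagonal.1 hx).1, mul_comm]

lemma VV_add (q : ℕ) [NeZero q] (t : ZMod q) (z X : ℝ) {a b c : ℕ} (hab : a ≤ b) (hbc : b ≤ c) :
    VV q t z X a c = VV q t z X a b + VV q t z X b c := by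
  unfold VV
  rw [← sum_Ioc_consecutive _ hab hbc]

lemma VV_term (q : ℕ) [NeZero q] (t : ZMod q) (a b : ℕ) :
    ‖((Λ a * Λ b : ℝ) : ℂ) * fq q t ((a * b : ℕ) : ZMod q)‖ ≤ 2 * (Λ a * Λ b) := by
  have h0 : 0 ≤ Λ a * Λ b := mul_nonneg vonMangoldt_nonneg vonMangoldt_nonneg
  rw [norm_mul, Complex.norm_real, Real.norm_of_nonneg h0, mul_comm]
  exact mul_le_mul_of_nonneg_right (norm_fq_le q t _) h0

lemma sum_vm_le (X : ℝ) (hX : 0 ≤ X) (a : ℕ) : ∑ b ∈ Ioc 0 (⌊X⌋₊ / a), Λ b ≤ (Real.log 4 + 4) * (X / a) := by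
  have := Chebyshev.psi_le_const_mul_self (x := X / a) (by positivity)
  rw [Chebyshev.psi, Nat.floor_div_natCast] at this
  exact this

lemma vm_double (X w C : ℝ) (hX : 0 ≤ X) (hC : ∑ a ∈ Ioc 0 ⌊w⌋₊, Λ a / a ≤ C) :
    ∑ a ∈ Ioc 0 ⌊w⌋₊, Λ a * ∑ b ∈ Ioc 0 (⌊X⌋₊ / a), Λ b ≤ (Real.log 4 + 4) * X * C := by
  have hl : 0 ≤ Real.log 4 := Real.log_nonneg (by norm_num)
  calc _ ≤ ∑ a ∈ Ioc 0 ⌊w⌋₊, (Real.log 4 + 4) * X * (Λ a / a) := by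
        refine sum_le_sum fun a _ => ?_
        calc _ ≤ Λ a * ((Real.log 4 + 4) * (X / a)) := by
              have := sum_vm_le X hX a
              have h0 : 0 ≤ Λ a := vonMangoldt_nonneg
              gcongr
          _ = _ := by ring
    _ = (Real.log 4 + 4) * X * ∑ a ∈ Ioc 0 ⌊w⌋₊, Λ a / a := by rw [mul_sum]
    _ ≤ _ := by gcongr

lemma VV_small (q : ℕ) [NeZero q] (t : ZMod q) (z X w C : ℝ) (hX : 0 ≤ X)
    (hC : ∑ a ∈ Ioc 0 ⌊w⌋₊, Λ a / a ≤ C) :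
    ‖VV q t z X 0 ⌊w⌋₊‖ ≤ 2 * ((Real.log 4 + 4) * X * C) := by
  refine le_trans ?_ (mul_le_mul_of_nonneg_left (vm_double X w C hX hC) (by norm_num))
  unfold VV
  rw [mul_sum]
  refine (norm_sum_le _ _).trans (sum_le_sum fun a _ => ?_)
  refine (norm_sum_le _ _).trans ((sum_le_sum fun b _ => VV_term q t a b).trans ?_)
  rw [mul_sum, mul_sum]
  refine sum_le_sum_of_subset_of_nonneg (Ioc_subset_Ioc_left (Nat.zero_le _)) fun b _ _ => ?_
  have h0 : 0 ≤ Λ a * Λ b := mul_nonneg vonMangoldt_nonneg vonMangoldt_nonneg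
  positivity

lemma VV_large (q : ℕ) [NeZero q] (t : ZMod q) (z X w C M : ℝ) (hX : 0 ≤ X) (hM : 0 < M)
    (hw : X / M ≤ w)
    (hC : ∑ a ∈ Ioc 0 ⌊w⌋₊, Λ a / a ≤ C) :
    ‖VV q t z X ⌊M⌋₊ ⌊X⌋₊‖ ≤ 2 * ((Real.log 4 + 4) * X * C) := by
  refine le_trans ?_ (mul_le_mul_of_nonneg_left (vm_double X w C hX hC) (by norm_num))
  unfold VV
  have hn : ∀ a b : ℕ, 0 ≤ Λ a * Λ b := fun a b => mul_nonneg vonMangoldt_nonneg vonMangoldt_nonneg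
  calc _ ≤ ∑ a ∈ Ioc ⌊M⌋₊ ⌊X⌋₊, ∑ b ∈ Ioc 0 (⌊X⌋₊ / a), 2 * (Λ a * Λ b) := by
        refine (norm_sum_le _ _).trans (sum_le_sum fun a _ => ?_)
        refine (norm_sum_le _ _).trans ((sum_le_sum fun b _ => VV_term q t a b).trans ?_)
        refine sum_le_sum_of_subset_of_nonneg (Ioc_subset_Ioc_left (Nat.zero_le _)) fun b _ _ => ?_
        have := hn a b
        positivity
    _ = ∑ b ∈ Ioc 0 ⌊w⌋₊, ∑ a ∈ Ioc ⌊M⌋₊ ⌊X⌋₊ with a * b ≤ ⌊X⌋₊, 2 * (Λ a * Λ b) := by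
        refine sum_comm' fun a b => ?_
        simp only [mem_Ioc, mem_filter]
        constructor
        · rintro ⟨⟨h1, h2⟩, h3, h4⟩
          have ha : 0 < a := by omega
          rw [Nat.le_div_iff_mul_le ha, mul_comm] at h4
          refine ⟨⟨⟨h1, h2⟩, h4⟩, h3, Nat.le_floor ?_⟩
          have h5 : (a:ℝ) * b ≤ X := le_trans (by exact_mod_cast h4) (Nat.floor_le hX)
          have h6 : M < a := (Nat.floor_lt hM.le).1 h1
          refine le_trans ?_ hw
          rw [le_div_iff₀ hM]
          have : (0:ℝ) ≤ b := by positivity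
          nlinarith
        · rintro ⟨⟨⟨h1, h2⟩, h4⟩, h3, h5⟩
          have ha : 0 < a := by omega
          refine ⟨⟨h1, h2⟩, h3, ?_⟩
          rw [Nat.le_div_iff_mul_le ha, mul_comm]; exact h4
    _ ≤ ∑ b ∈ Ioc 0 ⌊w⌋₊, ∑ a ∈ Ioc 0 (⌊X⌋₊ / b), 2 * (Λ a * Λ b) := by
        refine sum_le_sum fun b hb => ?_
        refine sum_le_sum_of_subset_of_nonneg ?_ fun a _ _ => ?_
        · intro a
          simp only [mem_Ioc, mem_filter]
          rintro ⟨⟨h1, h2⟩, h3⟩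
          exact ⟨by omega, by rw [Nat.le_div_iff_mul_le (mem_Ioc.1 hb).1]; exact h3⟩
        · have := hn a b
          positivity
    _ = _ := by
        rw [mul_sum]
        refine sum_congr rfl fun b _ => ?_
        rw [mul_sum, mul_sum]
        exact sum_congr rfl fun a _ => by ring

lemma sum_Ioc_diff {E : Type*} [AddCommGroup E] (g : ℕ → E) {u v u' v' : ℕ} (h1 : u ≤ v) (h2 : u' ≤ v')
    (h3 : u ≤ u') (h4 : v ≤ v') :
    ∑ b ∈ Ioc u v, g b = ∑ b ∈ Ioc u' v', g b + ∑ b ∈ Ioc u u', g b - ∑ b ∈ Ioc v v', g b := by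
  have e1 := sum_Ioc_consecutive g h1 h4
  have e2 := sum_Ioc_consecutive g h3 h2
  rw [eq_sub_iff_add_eq, e1, ← e2, add_comm]

lemma VV_box (q : ℕ) [NeZero q] (t : ZMod q) (ht : IsUnit t) (z X M κ A B E₀ E₁ E₂ : ℝ)
    (hz : 0 ≤ z) (hzX : z ≤ X) (hM : 0 < M) (hκ : 0 < κ)
    (h1 : ∀ u : ZMod q, ∑ a ∈ Ioc ⌊M⌋₊ ⌊M * (1 + κ)⌋₊ with ((a : ℕ) : ZMod q) = u, Λ a ≤ A)
    (h2 : ∀ u : ZMod q, ∑ a ∈ Ioc ⌊z / M⌋₊ ⌊X / M⌋₊ with ((a : ℕ) : ZMod q) = u, Λ a ≤ B)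
    (h3 : ∑ a ∈ Ioc ⌊M⌋₊ ⌊M * (1 + κ)⌋₊, Λ a ≤ E₀)
    (h4 : ∑ a ∈ Ioc ⌊z / (M * (1 + κ))⌋₊ ⌊z / M⌋₊, Λ a ≤ E₁)
    (h5 : ∑ a ∈ Ioc ⌊X / (M * (1 + κ))⌋₊ ⌊X / M⌋₊, Λ a ≤ E₂) :
    ‖VV q t z X ⌊M⌋₊ ⌊M * (1 + κ)⌋₊‖ ≤ 2 * (E₀ * (E₁ + E₂)) +
      A * B * (q * √q) * (1 + (q / (Nat.totient q : ℝ)) ^ 2) := by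
  have hX : 0 ≤ X := hz.trans hzX
  have hM1 : 0 < M * (1 + κ) := by positivity
  have hE1 : 0 ≤ E₁ := le_trans (sum_nonneg fun _ _ => vonMangoldt_nonneg) h4
  have hE2 : 0 ≤ E₂ := le_trans (sum_nonneg fun _ _ => vonMangoldt_nonneg) h5
  set F : ℕ → ℕ → ℂ := fun a b => ((Λ a * Λ b : ℝ) : ℂ) * fq q t ((a * b : ℕ) : ZMod q) with hF
  have hmain : ‖∑ a ∈ Ioc ⌊M⌋₊ ⌊M * (1 + κ)⌋₊, ∑ b ∈ Ioc ⌊z / M⌋₊ ⌊X / M⌋₊, F a b‖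
      ≤ A * B * (q * √q) * (1 + (q / (Nat.totient q : ℝ)) ^ 2) := by
    have := bilin_fq q t ht (fun u => ∑ a ∈ Ioc ⌊M⌋₊ ⌊M * (1 + κ)⌋₊ with ((a : ℕ) : ZMod q) = u, Λ a)
      (fun u => ∑ a ∈ Ioc ⌊z / M⌋₊ ⌊X / M⌋₊ with ((a : ℕ) : ZMod q) = u, Λ a) A B
      (fun u => sum_nonneg fun _ _ => vonMangoldt_nonneg)
      (fun u => sum_nonneg fun _ _ => vonMangoldt_nonneg) h1 h2
    convert this using 2
    rw [← sum_fiberwise_of_maps_to (s := Ioc ⌊M⌋₊ ⌊M * (1 + κ)⌋₊) (g := fun a : ℕ => (a : ZMod q))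
      (t := univ) (fun _ _ => mem_univ _)]
    refine sum_congr rfl fun u _ => ?_
    have e6 : ∀ a : ℕ, ∑ b ∈ Ioc ⌊z / M⌋₊ ⌊X / M⌋₊, F a b
      = ∑ v : ZMod q, ∑ b ∈ Ioc ⌊z / M⌋₊ ⌊X / M⌋₊ with ((b : ℕ) : ZMod q) = v, F a b := fun a => by
      rw [sum_fiberwise_of_maps_to (g := fun a : ℕ => (a : ZMod q))
      (t := univ) (fun _ _ => mem_univ _)]
    simp_rw [e6]
    rw [sum_comm]
    refine sum_congr rfl fun v _ => ?_
    rw [Complex.ofReal_sum, Complex.ofReal_sum, sum_mul_sum, sum_mul]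
    refine sum_congr rfl fun a ha => ?_
    rw [sum_mul]
    refine sum_congr rfl fun b hb => ?_
    simp only [hF]
    rw [Nat.cast_mul, (mem_filter.1 ha).2, (mem_filter.1 hb).2]
    push_cast; ring
  have herr : ∀ a ∈ Ioc ⌊M⌋₊ ⌊M * (1 + κ)⌋₊,
      ‖∑ b ∈ Ioc (⌊z⌋₊ / a) (⌊X⌋₊ / a), F a b - ∑ b ∈ Ioc ⌊z / M⌋₊ ⌊X / M⌋₊, F a b‖
        ≤ Λ a * (2 * (E₁ + E₂)) := by
    intro a ha
    obtain ⟨ha1, ha2⟩ := mem_Ioc.1 ha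
    have ha1' : M < a := (Nat.floor_lt hM.le).1 ha1
    have ha2' : (a:ℝ) ≤ M * (1 + κ) := (Nat.le_floor_iff hM1.le).1 ha2
    have hap : (0:ℝ) < a := hM.trans ha1'
    have h0 : 0 ≤ Λ a := vonMangoldt_nonneg
    rw [← Nat.floor_div_natCast (K := ℝ), ← Nat.floor_div_natCast (K := ℝ)]
    rw [sum_Ioc_diff (F a) (u := ⌊z / a⌋₊) (v := ⌊X / a⌋₊) (u' := ⌊z / M⌋₊) (v' := ⌊X / M⌋₊)
      (by gcongr) (by gcongr) (by gcongr) (by gcongr)]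
    have b1 : ∀ s r : ℕ, ∀ E : ℝ, ∑ b ∈ Ioc s r, Λ b ≤ E → ‖∑ b ∈ Ioc s r, F a b‖ ≤ 2 * (Λ a * E) := by
      intro s r E hE
      refine (norm_sum_le _ _).trans ((sum_le_sum fun b _ => VV_term q t a b).trans ?_)
      rw [← mul_sum, ← mul_sum]
      gcongr
    have c1 : ∑ b ∈ Ioc ⌊z / a⌋₊ ⌊z / M⌋₊, Λ b ≤ E₁ :=
      le_trans (sum_le_sum_of_subset_of_nonneg (Ioc_subset_Ioc_left (by gcongr))
        fun _ _ _ => vonMangoldt_nonneg) h4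
    have c2 : ∑ b ∈ Ioc ⌊X / a⌋₊ ⌊X / M⌋₊, Λ b ≤ E₂ :=
      le_trans (sum_le_sum_of_subset_of_nonneg (Ioc_subset_Ioc_left (by gcongr))
        fun _ _ _ => vonMangoldt_nonneg) h5
    have d1 := b1 _ _ _ c1
    have d2 := b1 _ _ _ c2
    rw [show ∀ x y w : ℂ, x + y - w - x = y - w from fun x y w => by ring]
    refine (norm_sub_le _ _).trans ?_
    linarith
  have e : VV q t z X ⌊M⌋₊ ⌊M * (1 + κ)⌋₊
      = ∑ a ∈ Ioc ⌊M⌋₊ ⌊M * (1 + κ)⌋₊, (∑ b ∈ Ioc (⌊z⌋₊ / a) (⌊X⌋₊ / a), F a b - ∑ b ∈ Ioc ⌊z / M⌋₊ ⌊X / M⌋₊, F a b)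
      + ∑ a ∈ Ioc ⌊M⌋₊ ⌊M * (1 + κ)⌋₊, ∑ b ∈ Ioc ⌊z / M⌋₊ ⌊X / M⌋₊, F a b := by
    rw [← sum_add_distrib]
    refine sum_congr rfl fun a _ => by simp only [hF]; ring
  rw [e]
  refine (norm_add_le _ _).trans (add_le_add ?_ hmain)
  refine (norm_sum_le _ _).trans ((sum_le_sum herr).trans ?_)
  rw [← sum_mul]
  calc _ ≤ E₀ * (2 * (E₁ + E₂)) := by gcongr
    _ = _ := by ring

/-- the uniform range condition -/
def GoodK (K lam κ y₀ : ℝ) : Prop := ∀ y ≥ y₀, ∀ θ : ℝ, κ ≤ θ → θ ≤ 1 → ∀ q : ℕ, 0 < q →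
    (q : ℝ) ≤ lam ^ K → ∀ b : ZMod q,
    ∑ n ∈ Ioc ⌊y⌋₊ ⌊y * (1 + θ)⌋₊ with ((n : ℕ) : ZMod q) = b, Λ n ≤ 67 * (θ * y) / Nat.totient q

lemma goodK_ev (K : ℝ) (hK : 1 ≤ K) : ∀ᶠ lam : ℝ in atTop,
    GoodK K lam (lam ^ (-(1/2) : ℝ)) (Real.exp (√lam) / 2) := by
  obtain ⟨z₀, hz₀⟩ := bt_vm
  have t1 : Tendsto (fun lam : ℝ => Real.exp (√lam) / 2) atTop atTop :=
    (Real.tendsto_exp_atTop.comp Real.tendsto_sqrt_atTop).atTop_div_const (by norm_num)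
  have e2 : ∀ᶠ lam : ℝ in atTop, lam ^ K ≤ (Real.exp (√lam) / 2) ^ (1/10 : ℝ) := by
    have t2 := tendsto_exp_mul_div_rpow_atTop (2 * K) (1/10) (by norm_num)
    have t3 := (t2.comp Real.tendsto_sqrt_atTop).eventually_ge_atTop 2
    filter_upwards [t3, eventually_ge_atTop (1:ℝ)] with lam h h1
    simp only [Function.comp] at h
    have hs : 0 < √lam := Real.sqrt_pos.2 (by linarith)
    rw [le_div_iff₀ (by positivity)] at h
    have e3 : (√lam) ^ (2 * K) = lam ^ K := by
      rw [Real.rpow_mul hs.le]; norm_num [Real.sq_sqrt (show 0 ≤ lam by linarith)]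
    rw [e3] at h
    rw [Real.div_rpow (Real.exp_pos _).le (by norm_num), ← Real.exp_mul, le_div_iff₀ (by positivity)]
    have : (2:ℝ) ^ (1/10 : ℝ) ≤ 2 := by
      calc (2:ℝ) ^ (1/10 : ℝ) ≤ 2 ^ (1:ℝ) := by
            apply Real.rpow_le_rpow_of_exponent_le <;> norm_num
        _ = 2 := by norm_num
    have h4 : 0 < lam ^ K := by positivity
    calc lam ^ K * 2 ^ (1/10 : ℝ) ≤ lam ^ K * 2 := by gcongr
      _ ≤ Real.exp (1 / 10 * √lam) := by linarith
      _ = _ := by rw [mul_comm (√lam)]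
  filter_upwards [t1.eventually_ge_atTop z₀, t1.eventually_ge_atTop 1, e2, eventually_ge_atTop (1:ℝ)] with lam h1 h1' h2 h3
  intro y hy θ hθ hθ1 q hq hqK b
  have hy1 : 1 ≤ y := le_trans h1' hy
  have hlp : 0 < lam := by linarith
  have h5 : lam ^ K ≤ y ^ (1/10 : ℝ) := h2.trans (by gcongr)
  have h6 : lam ^ (1/2 : ℝ) ≤ y ^ (1/10 : ℝ) :=
    le_trans (Real.rpow_le_rpow_of_exponent_le h3 (by linarith)) h5
  have hθy : y ^ (9/10 : ℝ) ≤ θ * y := by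
    rw [Real.rpow_neg hlp.le] at hθ
    have h7 : (y ^ (1/10 : ℝ))⁻¹ ≤ θ := le_trans (by gcongr) hθ
    calc y ^ (9/10 : ℝ) = (y ^ (1/10 : ℝ))⁻¹ * y := by
          rw [← Real.rpow_neg (by linarith)]
          nth_rw 3 [← Real.rpow_one y]
          rw [← Real.rpow_add (by linarith)]; norm_num
      _ ≤ _ := by gcongr
  have := hz₀ y (le_trans h1 hy) (θ * y) hθy ?_ q hq (hqK.trans h5) b
  · rw [show y * (1 + θ) = y + θ * y by ring]
    exact this
  · nlinarith

lemma goodK_one {K lam κ y₀ : ℝ} (hlam : 1 ≤ lam) (hK : 0 ≤ K) (h : GoodK K lam κ y₀) (y : ℝ) (hy : y₀ ≤ y) (θ : ℝ)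
    (hθ : κ ≤ θ) (hθ1 : θ ≤ 1) : ∑ n ∈ Ioc ⌊y⌋₊ ⌊y * (1 + θ)⌋₊, Λ n ≤ 67 * (θ * y) := by
  have := h y hy θ hθ hθ1 1 one_pos (by simpa using Real.one_le_rpow hlam hK) 0
  rw [filter_true_of_mem (fun n _ => Subsingleton.elim _ _)] at this
  simpa using this

end C3

section C4
open Finset ArithmeticFunction Filter

set_option maxHeartbeats 1600000 in
lemma sigma2_bound (K : ℝ) (hK : 1 ≤ K) : ∃ C : ℝ, 0 < C ∧ ∃ z₀ : ℝ, ∀ z ≥ z₀, ∀ η : ℝ,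
    Real.log z ^ (-(1/4) : ℝ) ≤ η → η ≤ 1 → ∀ q : ℕ, ∀ [NeZero q], (q : ℝ) ≤ Real.log z ^ K → ∀ t : ZMod q,
    IsUnit t → ‖VV q t z (z * (1 + η)) 0 ⌊z * (1 + η)⌋₊‖
      ≤ C * (z * Real.log z ^ (1/2 : ℝ) + Real.log z * (η * z) * (q:ℝ) ^ (-(1/4) : ℝ)) := by
  obtain ⟨C₀, hC₀, hmert⟩ := mertens_vm
  have hev := Real.tendsto_log_atTop.eventually ((goodK_ev K hK).and (eventually_ge_atTop (16:ℝ)))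
  obtain ⟨z₀, hz₀⟩ := eventually_atTop.1 hev
  set C₁ : ℝ := Real.log 4 + 4 with hC₁
  have hC₁p : 0 < C₁ := by positivity
  refine ⟨8 * C₁ * (2 + C₀) + 3 * 67 ^ 2 * 6 + 6 * 67 ^ 2 * 33 ^ 4, by positivity, max z₀ 1, fun z hz η hη hη1 q _ hq t ht => ?_⟩
  obtain ⟨hg, hl⟩ := hz₀ z (le_trans (le_max_left _ _) hz)
  have hz1 : 1 ≤ z := le_trans (le_max_right _ _) hz
  have hzp : 0 < z := by linarith
  set lam := Real.log z with hlam
  set κ : ℝ := lam ^ (-(1/2) : ℝ) with hκ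
  set X := z * (1 + η) with hX
  set w := Real.exp (√lam) with hw
  have hlp : 0 < lam := by linarith
  have hκp : 0 < κ := by positivity
  have hκη : κ ≤ η := le_trans (Real.rpow_le_rpow_of_exponent_le (by linarith) (by norm_num)) hη
  have hκ1 : κ ≤ 1 := hκη.trans hη1
  have hηp : 0 < η := by linarith
  have hzX : z ≤ X := by rw [hX]; nlinarith
  have hX2 : X ≤ 2 * z := by rw [hX]; nlinarith
  have hκs : κ * lam = √lam := by
    rw [hκ, Real.sqrt_eq_rpow]
    nth_rw 2 [← Real.rpow_one lam]
    rw [← Real.rpow_add hlp]; norm_num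
  have hκs' : κ * √lam = 1 := by
    rw [hκ, Real.sqrt_eq_rpow, ← Real.rpow_add hlp]; norm_num
  have hs4 : 4 ≤ √lam := by
    apply Real.le_sqrt_of_sq_le; linarith
  have hwp : 0 < w := Real.exp_pos _
  have hw2 : 2 ≤ w := by
    have := Real.add_one_le_exp (√lam); linarith
  have hzexp : z = Real.exp lam := (Real.exp_log hzp).symm
  have hsq : √lam ^ 2 = lam := Real.sq_sqrt hlp.le
  have hw2z : 1 ≤ z / w ^ 2 := by
    rw [le_div_iff₀ (by positivity), one_mul, hzexp, hw, ← Real.exp_nat_mul]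
    apply Real.exp_le_exp.2
    have : 4 * √lam ≤ √lam * √lam := by gcongr
    push_cast; linarith
  obtain ⟨n, hn1, hn2⟩ := exists_nat_pow_near hw2z (show (1:ℝ) < 1 + κ by linarith)
  have hφ : (0:ℝ) < Nat.totient q := by exact_mod_cast Nat.totient_pos.2 (NeZero.pos q)
  have hq0 : 0 < q := NeZero.pos q
  have hq1 : (1:ℝ) ≤ q := by exact_mod_cast hq0
  set g : ℝ := q / Nat.totient q with hgdef
  have hg1 : 1 ≤ g := by
    rw [hgdef, le_div_iff₀ hφ, one_mul]; exact_mod_cast Nat.totient_le q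
  set Bx : ℝ := 67 ^ 2 * 6 * κ ^ 2 * z + 67 ^ 2 * κ * (η * z) * (2 * 33 ^ 4 * (q:ℝ) ^ (-(1/4):ℝ)) with hBx
  have hnear : ∀ (Y M : ℝ), w ≤ Y / M → 0 < M → ∑ a ∈ Ioc ⌊Y / (M * (1 + κ))⌋₊ ⌊Y / M⌋₊, Λ a ≤ 67 * (κ * (Y / M)) := by
    intro Y M hY hM
    have h0 : 0 < Y / M := by linarith
    have h2 : Y / (M * (1 + κ)) = Y / M / (1 + κ) := by rw [div_div]
    have h1 := goodK_one (by linarith) (by linarith) hg (Y / (M * (1 + κ))) (by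
      rw [h2]; gcongr; linarith) κ le_rfl hκ1
    have h3 : Y / (M * (1 + κ)) * (1 + κ) = Y / M := by field_simp
    rw [h3] at h1
    refine h1.trans ?_
    rw [h2]
    have h4 : Y / M / (1 + κ) ≤ Y / M := div_le_self h0.le (by linarith)
    gcongr
  have hbox : ∀ i ≤ n, ‖VV q t z X ⌊w * (1 + κ) ^ i⌋₊ ⌊w * (1 + κ) ^ (i + 1)⌋₊‖ ≤ Bx := by
    intro i hi
    set M := w * (1 + κ) ^ i with hM
    have hpow : 1 ≤ (1 + κ) ^ i := one_le_pow₀ (by linarith)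
    have hMw : w ≤ M := le_mul_of_one_le_right hwp.le hpow
    have hMp : 0 < M := by linarith
    have hMz : w ≤ z / M := by
      rw [le_div_iff₀ hMp]
      have : (1 + κ) ^ i ≤ z / w ^ 2 := (pow_le_pow_right₀ (by linarith) hi).trans hn1
      rw [le_div_iff₀ (by positivity)] at this
      calc w * M = (1 + κ) ^ i * w ^ 2 := by rw [hM]; ring
        _ ≤ z := this
    have hMX : w ≤ X / M := hMz.trans (by gcongr)
    have e1 : w * (1 + κ) ^ (i + 1) = M * (1 + κ) := by rw [hM]; ring
    rw [e1]
    have hw2' : w / 2 ≤ w := by linarith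
    have := VV_box q t ht z X M κ (67 * (κ * M) / Nat.totient q) (67 * (η * (z / M)) / Nat.totient q)
      (67 * (κ * M)) (67 * (κ * (z / M))) (67 * (κ * (X / M))) hzp.le hzX hMp hκp
      (hg M (by linarith) κ le_rfl hκ1 q hq0 hq)
      (by
        have := hg (z / M) (by linarith) η hκη hη1 q hq0 hq
        rw [show z / M * (1 + η) = X / M by rw [hX]; ring] at this
        exact this)
      (goodK_one (by linarith) (by linarith) hg M (by linarith) κ le_rfl hκ1)
      (hnear z M hMz hMp) (hnear X M hMX hMp)
    refine this.trans ?_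
    rw [hBx]
    refine add_le_add ?_ ?_
    · have : X / M ≤ 2 * (z / M) := by rw [← mul_div_assoc]; gcongr
      calc 2 * (67 * (κ * M) * (67 * (κ * (z / M)) + 67 * (κ * (X / M))))
          ≤ 2 * (67 * (κ * M) * (67 * (κ * (z / M)) + 67 * (κ * (2 * (z / M))))) := by gcongr
        _ = _ := by field_simp; ring
    · have hgq := gq_le_rpow hq0 (c := 1/16) (by norm_num)
      have hg4 : g ^ 4 ≤ 33 ^ 4 * (q:ℝ) ^ (1/4 : ℝ) := by
        calc g ^ 4 ≤ (33 * (q:ℝ) ^ (1/16 : ℝ)) ^ 4 := by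
              gcongr
              refine hgq.trans (le_of_eq ?_); norm_num
          _ = _ := by
              rw [mul_pow, ← Real.rpow_mul_natCast (by positivity)]; norm_num
      have h5 : g ^ 2 * (1 + g ^ 2) ≤ 2 * g ^ 4 := by
        have h6 : g ^ 2 * 1 ≤ g ^ 2 * g ^ 2 := by gcongr; exact one_le_pow₀ hg1
        linarith
      have e5 : 67 * (κ * M) / (Nat.totient q : ℝ) * (67 * (η * (z / M)) / Nat.totient q) * (q * √q) * (1 + g ^ 2)
        = 67 ^ 2 * κ * (η * z) * ((g ^ 2 * (1 + g ^ 2)) * (√q / q)) := by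
        rw [hgdef]; field_simp
      have e6 : √(q:ℝ) / q = (q:ℝ) ^ (-(1/2) : ℝ) := by
        rw [Real.sqrt_eq_rpow, div_eq_mul_inv, ← Real.rpow_neg_one, ← Real.rpow_add (by linarith)]; norm_num
      rw [e5, e6]
      refine mul_le_mul_of_nonneg_left ?_ (by positivity)
      calc g ^ 2 * (1 + g ^ 2) * (q:ℝ) ^ (-(1/2) : ℝ) ≤ (2 * (33 ^ 4 * (q:ℝ) ^ (1/4 : ℝ))) * (q:ℝ) ^ (-(1/2) : ℝ) := by
            refine mul_le_mul_of_nonneg_right (by linarith) (by positivity)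
        _ = 2 * 33 ^ 4 * ((q:ℝ) ^ (1/4 : ℝ) * (q:ℝ) ^ (-(1/2) : ℝ)) := by ring
        _ = _ := by rw [← Real.rpow_add (by linarith)]; norm_num
  have hmono : ∀ i, ⌊w⌋₊ ≤ ⌊w * (1 + κ) ^ i⌋₊ := fun i => by
    gcongr
    have hpow : 1 ≤ (1 + κ) ^ i := one_le_pow₀ (by linarith)
    exact le_mul_of_one_le_right hwp.le hpow
  have hsum : ∀ i ≤ n + 1, ‖VV q t z X ⌊w⌋₊ ⌊w * (1 + κ) ^ i⌋₊‖ ≤ i * Bx := by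
    intro i
    induction i with
    | zero => intro _; simp [VV]
    | succ i ih =>
      intro hi
      rw [VV_add q t z X (hmono i) (c := ⌊w * (1 + κ) ^ (i + 1)⌋₊) (by gcongr <;> linarith)]
      refine (norm_add_le _ _).trans ?_
      have := ih (by omega)
      have := hbox i (by omega)
      push_cast; linarith
  have hmid := hsum (n + 1) le_rfl
  set MI := w * (1 + κ) ^ (n + 1) with hMI
  have hMI1 : z / w ≤ MI := by
    rw [div_lt_iff₀ (by positivity)] at hn2
    rw [hMI, div_le_iff₀ hwp]; linarith
  have hMI2 : MI ≤ X := by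
    rw [le_div_iff₀ (by positivity)] at hn1
    have h7 : (1 + κ) ^ n * 2 ≤ (1 + κ) ^ n * w := by gcongr
    have h8 : MI ≤ (1 + κ) ^ n * w ^ 2 := by
      have h9 : 0 < (1 + κ) ^ n := by positivity
      calc MI = (1 + κ) ^ n * w * (1 + κ) := by rw [hMI]; ring
        _ ≤ (1 + κ) ^ n * w * w := by gcongr; linarith
        _ = _ := by ring
    linarith
  have hMIp : 0 < MI := by rw [hMI]; positivity
  have hsm := VV_small q t z X w _ (by linarith) (hmert w (by linarith))
  have hlg := VV_large q t z X (2 * w) _ MI (by linarith) hMIp (by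
    rw [div_le_iff₀ hMIp]
    rw [div_le_iff₀ hwp] at hMI1
    linarith) (hmert (2 * w) (by linarith))
  have hlw : Real.log w = √lam := Real.log_exp _
  have hlw2 : Real.log (2 * w) ≤ 2 * √lam := by
    rw [Real.log_mul (by norm_num) hwp.ne', hlw]
    have := Real.log_two_lt_d9; linarith
  have hnk : ((n + 1 : ℕ) : ℝ) * κ ≤ 3 * lam := by
    have h9 : (n:ℝ) * Real.log (1 + κ) ≤ lam := by
      rw [← Real.log_pow]
      refine Real.log_le_log (by positivity) (hn1.trans ?_)
      exact div_le_self hzp.le (one_le_pow₀ (by linarith))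
    have h10 : κ / 2 ≤ Real.log (1 + κ) := by
      have := Real.le_log_one_add_of_nonneg hκp.le
      refine le_trans ?_ this
      rw [div_le_div_iff₀ (by norm_num) (by linarith)]
      have := mul_le_mul_of_nonneg_left hκ1 hκp.le
      linarith
    have h11 : (n:ℝ) * (κ / 2) ≤ lam := le_trans (by gcongr) h9
    push_cast; linarith
  rw [VV_add q t z X (Nat.zero_le ⌊w⌋₊) (c := ⌊X⌋₊) ((hmono (n+1)).trans (by gcongr)),
    VV_add q t z X (hmono (n+1)) (c := ⌊X⌋₊) (by gcongr)]
  refine (norm_add_le _ _).trans (le_trans (add_le_add hsm ((norm_add_le _ _).trans (add_le_add hmid hlg))) ?_)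
  rw [← Real.sqrt_eq_rpow, hlw]
  have f1 : 2 * (C₁ * X * (√lam + C₀)) ≤ 4 * C₁ * (2 + C₀) * (z * √lam) := by
    have : C₀ * 1 ≤ C₀ * √lam := by gcongr; linarith
    have : √lam + C₀ ≤ (2 + C₀) * √lam := by linarith
    calc 2 * (C₁ * X * (√lam + C₀)) ≤ 2 * (C₁ * (2 * z) * ((2 + C₀) * √lam)) := by gcongr
      _ = _ := by ring
  have f2 : 2 * (C₁ * X * (Real.log (2 * w) + C₀)) ≤ 4 * C₁ * (2 + C₀) * (z * √lam) := by
    have : C₀ * 1 ≤ C₀ * √lam := by gcongr; linarith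
    have : Real.log (2 * w) + C₀ ≤ (2 + C₀) * √lam := by linarith
    have h0 : 0 ≤ Real.log (2 * w) := Real.log_nonneg (by linarith)
    calc 2 * (C₁ * X * (Real.log (2 * w) + C₀)) ≤ 2 * (C₁ * (2 * z) * ((2 + C₀) * √lam)) := by gcongr
      _ = _ := by ring
  have f3 : ((n + 1 : ℕ) : ℝ) * Bx ≤ 3 * 67 ^ 2 * 6 * (z * √lam) + 6 * 67 ^ 2 * 33 ^ 4 * (lam * (η * z) * (q:ℝ) ^ (-(1/4):ℝ)) := by
    calc ((n + 1 : ℕ) : ℝ) * Bx = (((n + 1 : ℕ) : ℝ) * κ) * (67 ^ 2 * 6 * κ * z + 67 ^ 2 * (η * z) * (2 * 33 ^ 4 * (q:ℝ) ^ (-(1/4):ℝ))) := by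
          rw [hBx]; ring
      _ ≤ (3 * lam) * (67 ^ 2 * 6 * κ * z + 67 ^ 2 * (η * z) * (2 * 33 ^ 4 * (q:ℝ) ^ (-(1/4):ℝ))) := by gcongr
      _ = 3 * 67 ^ 2 * 6 * (z * (κ * lam)) + 6 * 67 ^ 2 * 33 ^ 4 * (lam * (η * z) * (q:ℝ) ^ (-(1/4):ℝ)) := by ring
      _ = _ := by rw [hκs]
  have p1 : 0 ≤ z * √lam := by positivity
  have p2 : 0 ≤ lam * (η * z) * (q:ℝ) ^ (-(1/4):ℝ) := by positivity
  have p3 : 0 < C₁ * (2 + C₀) := by positivity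
  generalize z * √lam = P at *
  generalize lam * (η * z) * (q:ℝ) ^ (-(1/4):ℝ) = Q at *
  have p4 := mul_nonneg p3.le p2
  linarith

end C4

section C5
open Finset ArithmeticFunction Filter
open scoped ArithmeticFunction.Moebius

lemma ee_std (q : ℕ) [NeZero q] (t : ℤ) (n : ℕ) :
    ee (t / q) n = ZMod.stdAddChar ((t : ZMod q) * (n : ZMod q)) := by
  have : ((t : ZMod q) * (n : ZMod q)) = ((t * n : ℤ) : ZMod q) := by push_cast; ring
  rw [this, ZMod.stdAddChar_coe, ee]
  congr 1
  push_cast; ring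

lemma Sf_bound (ε : ℝ) (hε : 0 < ε) (hε1 : ε ≤ 1) (q : ℕ) [NeZero q] (t : ZMod q) (z η : ℝ) (hz : 1 ≤ z) (hη0 : 0 ≤ η)
    (hη : η ≤ 1) :
    Real.log (z * (1 + η)) ^ 2 * ‖∑ p ∈ primesIoc z (z * (1 + η)), fq q t (p : ZMod q)‖
      ≤ 64 / ε ^ 3 * (q:ℝ) ^ ε * (z * (1 + η)) + ‖VV q t z (z * (1 + η)) 0 ⌊z * (1 + η)⌋₊‖
        + 8 * (√(z * (1 + η)) * Real.log (z * (1 + η)) ^ 2) + 2 * (z * (1 + η)) := by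
  set X := z * (1 + η) with hX
  have hzX : z ≤ X := by rw [hX]; nlinarith
  have hX1 : 1 ≤ X := hz.trans hzX
  set L := Real.log X with hL
  have hL0 : 0 ≤ L := Real.log_nonneg hX1
  have hn : ∀ n ∈ Ioc ⌊z⌋₊ ⌊X⌋₊, 1 < n ∧ z < n ∧ (n:ℝ) ≤ X := by
    intro n hn
    obtain ⟨h1, h2⟩ := mem_Ioc.1 hn
    have h3 := (Nat.floor_lt (by linarith)).1 h1
    refine ⟨by exact_mod_cast lt_of_le_of_lt hz h3, h3, (Nat.le_floor_iff (by linarith)).1 h2⟩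
  have hT := T_bound ε hε hε1 q t z X hX1
  have hTe : ∑ n ∈ Ioc ⌊z⌋₊ ⌊X⌋₊, fq q t (n : ZMod q) *
      ((∑ d ∈ n.divisors, (μ d : ℝ) * (Real.log X - Real.log d) ^ 2 : ℝ) : ℂ)
      = ∑ n ∈ Ioc ⌊z⌋₊ ⌊X⌋₊, fq q t (n : ZMod q) * ((Λ n * (2 * L - Real.log n) : ℝ) : ℂ)
        + VV q t z X 0 ⌊X⌋₊ := by
    rw [← VV_eq, ← sum_add_distrib]
    refine sum_congr rfl fun n h => ?_
    rw [selberg_id n (hn n h).1, Complex.ofReal_add, mul_add]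
  rw [hTe] at hT
  set R := ∑ n ∈ Ioc ⌊z⌋₊ ⌊X⌋₊, fq q t (n : ZMod q) * ((Λ n * (2 * L - Real.log n) : ℝ) : ℂ) with hR
  have hRn : ‖R‖ ≤ 64 / ε ^ 3 * (q:ℝ) ^ ε * X + ‖VV q t z X 0 ⌊X⌋₊‖ := by
    have := norm_sub_le (R + VV q t z X 0 ⌊X⌋₊) (VV q t z X 0 ⌊X⌋₊)
    rw [add_sub_cancel_right] at this
    linarith
  have hsplit := sum_filter_add_sum_filter_not (Ioc ⌊z⌋₊ ⌊X⌋₊) Nat.Prime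
    (fun n => fq q t (n : ZMod q) * ((Λ n * (2 * L - Real.log n) : ℝ) : ℂ))
  rw [← hR] at hsplit
  set R2 := ∑ n ∈ Ioc ⌊z⌋₊ ⌊X⌋₊ with ¬ n.Prime, fq q t (n : ZMod q) * ((Λ n * (2 * L - Real.log n) : ℝ) : ℂ) with hR2
  have hR2n : ‖R2‖ ≤ 8 * (√X * L ^ 2) := by
    calc ‖R2‖ ≤ ∑ n ∈ Ioc ⌊z⌋₊ ⌊X⌋₊ with ¬ n.Prime, 2 * (Λ n * (2 * L)) := by
          refine (norm_sum_le _ _).trans (sum_le_sum fun n hn' => ?_)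
          obtain ⟨h1, h2, h3⟩ := hn n (mem_filter.1 hn').1
          have hl0 : 0 ≤ Real.log n := Real.log_nonneg (by exact_mod_cast h1.le)
          have hl1 : Real.log n ≤ L := Real.log_le_log (by exact_mod_cast (by omega : 0 < n)) h3
          have h0 : 0 ≤ Λ n := vonMangoldt_nonneg
          rw [norm_mul, Complex.norm_real, Real.norm_of_nonneg (mul_nonneg h0 (by linarith))]
          refine mul_le_mul (norm_fq_le q t _) (mul_le_mul_of_nonneg_left (by linarith) h0)
            (mul_nonneg h0 (by linarith)) (by norm_num)
      _ ≤ ∑ n ∈ Ioc 0 ⌊X⌋₊ with ¬ n.Prime, 2 * (Λ n * (2 * L)) := by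
          refine sum_le_sum_of_subset_of_nonneg (filter_subset_filter _ (Ioc_subset_Ioc_left (Nat.zero_le _))) fun n _ _ => ?_
          have h0 : 0 ≤ Λ n := vonMangoldt_nonneg
          positivity
      _ = 4 * L * (Chebyshev.psi X - Chebyshev.theta X) := by
          rw [Chebyshev.psi_sub_theta_eq_sum_not_prime, mul_sum]
          exact sum_congr rfl fun n _ => by ring
      _ ≤ 4 * L * (2 * √X * L) := by
          gcongr
          exact Chebyshev.psi_sub_theta_le hX1
      _ = _ := by ring
  have hprime : ((L ^ 2 : ℝ) : ℂ) * ∑ p ∈ primesIoc z X, fq q t (p : ZMod q)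
      = (R - R2) + ∑ p ∈ primesIoc z X, fq q t (p : ZMod q) * (((L - Real.log p) ^ 2 : ℝ) : ℂ) := by
    rw [← hsplit, add_sub_cancel_right]
    unfold primesIoc
    rw [mul_sum, ← sum_add_distrib]
    refine sum_congr rfl fun p hp => ?_
    rw [vonMangoldt_apply_prime (mem_filter.1 hp).2]
    push_cast; ring
  have hlast : ‖∑ p ∈ primesIoc z X, fq q t (p : ZMod q) * (((L - Real.log p) ^ 2 : ℝ) : ℂ)‖ ≤ 2 * X := by
    calc _ ≤ ∑ p ∈ primesIoc z X, (2:ℝ) := by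
          refine (norm_sum_le _ _).trans (sum_le_sum fun p hp => ?_)
          obtain ⟨h1, h2, h3⟩ := hn p (mem_filter.1 hp).1
          have hp0 : (0:ℝ) < p := by linarith
          rw [norm_mul, Complex.norm_real, Real.norm_of_nonneg (sq_nonneg _)]
          have hl1 : Real.log p ≤ L := Real.log_le_log hp0 h3
          have hl2 : L - Real.log p ≤ 1 := by
            rw [hL, ← Real.log_div (by linarith) hp0.ne']
            have h5 : X / p ≤ 1 + η := by
              rw [div_le_iff₀ hp0, hX]; nlinarith
            have := Real.log_le_sub_one_of_pos (show 0 < X / p by positivity)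
            linarith
          have h6 : (L - Real.log p) ^ 2 ≤ 1 := by
            apply pow_le_one₀ <;> linarith
          calc _ ≤ (2:ℝ) * 1 := by
                gcongr
                exact norm_fq_le q t _
            _ = 2 := by norm_num
      _ = (#(primesIoc z X) : ℝ) * 2 := by rw [sum_const, nsmul_eq_mul]
      _ ≤ X * 2 := by
          gcongr
          refine le_trans ?_ (Nat.floor_le (by linarith : 0 ≤ X))
          have : #(primesIoc z X) ≤ ⌊X⌋₊ := by
            refine (card_filter_le _ _).trans ?_
            rw [Nat.card_Ioc]; exact Nat.sub_le _ _
          exact_mod_cast this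
      _ = _ := by ring
  have hfin : ‖((L ^ 2 : ℝ) : ℂ) * ∑ p ∈ primesIoc z X, fq q t (p : ZMod q)‖ ≤ ‖R‖ + ‖R2‖ + 2 * X := by
    rw [hprime]
    refine (norm_add_le _ _).trans (add_le_add (norm_sub_le _ _) hlast)
  rw [norm_mul, Complex.norm_real, Real.norm_of_nonneg (sq_nonneg L)] at hfin
  linarith

lemma high_cell (K : ℝ) (hK : 1 ≤ K) : ∃ C : ℝ, 0 < C ∧ ∃ z₀ : ℝ, ∀ z ≥ z₀, ∀ η : ℝ,
    Real.log z ^ (-(1/4) : ℝ) ≤ η → η ≤ 1 → ∀ q : ℕ, 0 < q → (q : ℝ) ≤ Real.log z ^ K → ∀ t : ℤ,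
    IsCoprime t (q : ℤ) →
    ‖∑ p ∈ primesIoc z (z * (1 + η)), ee (t / q) p‖ ≤ C * (q:ℝ) ^ (-(1 / (4 * K))) * (η * z / Real.log z) := by
  obtain ⟨C₂, hC₂, z₂, hz₂⟩ := sigma2_bound K hK
  obtain ⟨z₃, hz₃⟩ := bt_short
  set ε : ℝ := 1 / (2 * K) with hε
  have hεp : 0 < ε := by positivity
  have hε1 : ε ≤ 1 := by rw [hε, div_le_one (by positivity)]; linarith
  have e1 := ev_log_pow (1/10) (by norm_num) 1
  have e2 := ev_log_pow (1/K) (by positivity) 1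
  have e3 := ev_log_pow (1/4) (by norm_num) 1
  have e4 := Real.tendsto_log_atTop.eventually_ge_atTop 1
  obtain ⟨z₁, hz₁⟩ := eventually_atTop.1 ((e1.and e2).and (e3.and e4))
  set D : ℝ := 128 / ε ^ 3 + C₂ + 20 with hD
  have hDp : 0 < D := by positivity
  refine ⟨2 * D + 33 ^ 3, by positivity, max (max z₁ 1) (max z₂ z₃), fun z hz η hη hη1 q hq hqK t ht => ?_⟩
  have : NeZero q := ⟨hq.ne'⟩
  have hzz1 : z₁ ≤ z := le_trans (le_trans (le_max_left _ _) (le_max_left _ _)) hz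
  have hz1 : 1 ≤ z := le_trans (le_trans (le_max_right _ _) (le_max_left _ _)) hz
  have hzz2 : z₂ ≤ z := le_trans (le_trans (le_max_left _ _) (le_max_right _ _)) hz
  have hzz3 : z₃ ≤ z := le_trans (le_trans (le_max_right _ _) (le_max_right _ _)) hz
  obtain ⟨⟨f1, f2⟩, -, f4⟩ := hz₁ z hzz1
  rw [one_mul] at f1 f2
  set lam := Real.log z with hlam
  have hlp : 0 < lam := by linarith
  have hηp : 0 < η := lt_of_lt_of_le (by positivity) hη
  set X := z * (1 + η) with hX
  have hzX : z ≤ X := by rw [hX]; nlinarith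
  have hX2 : X ≤ 2 * z := by rw [hX]; nlinarith
  have hXp : 0 < X := by linarith
  have hzp : 0 < z := by linarith
  have hq1 : (1:ℝ) ≤ q := by exact_mod_cast hq
  have hqp : (0:ℝ) < q := by linarith
  have htu : IsUnit (t : ZMod q) := by
    exact (ZMod.coe_int_isUnit_iff_isCoprime t q).2 ht.symm
  have g3 := (hz₁ X (hzz1.trans hzX)).2.1
  rw [one_mul] at g3
  set L := Real.log X with hL
  have hlL : lam ≤ L := Real.log_le_log hzp hzX
  have hS := Sf_bound ε hεp hε1 q (t : ZMod q) z η hz1 hηp.le hη1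
  have hV := hz₂ z hzz2 η hη hη1 q hqK (t : ZMod q) htu
  rw [← hX, ← hL] at hS
  rw [← hX] at hV
  set Sf := ∑ p ∈ primesIoc z X, fq q (t : ZMod q) (p : ZMod q) with hSf
  have hqlam : (q:ℝ) ^ ε ≤ lam ^ (1/2 : ℝ) := by
    calc (q:ℝ) ^ ε ≤ (lam ^ K) ^ ε := by gcongr
      _ = _ := by rw [← Real.rpow_mul hlp.le]; congr 1; rw [hε]; field_simp
  have hlh : 1 ≤ lam ^ (1/2 : ℝ) := Real.one_le_rpow f4 (by norm_num)
  have hXL : √X * L ^ 2 ≤ X := by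
    have hL0 : 0 ≤ L := by linarith
    calc √X * L ^ 2 ≤ √X * (X ^ (1/4 : ℝ)) ^ 2 := by gcongr
      _ = X ^ (1/2 : ℝ) * X ^ (1/2 : ℝ) := by
          rw [Real.sqrt_eq_rpow, ← Real.rpow_mul_natCast hXp.le]; norm_num
      _ = X := by rw [← Real.rpow_add hXp]; norm_num
  have hmain : lam ^ 2 * ‖Sf‖ ≤ D * (z * lam ^ (1/2 : ℝ) + lam * (η * z) * (q:ℝ) ^ (-(1/4) : ℝ)) := by
    have h1 : lam ^ 2 * ‖Sf‖ ≤ L ^ 2 * ‖Sf‖ := by gcongr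
    have h2 : 64 / ε ^ 3 * (q:ℝ) ^ ε * X ≤ 64 / ε ^ 3 * lam ^ (1/2 : ℝ) * (2 * z) := by gcongr
    have h3 : 10 * X ≤ 20 * (z * lam ^ (1/2 : ℝ)) := by nlinarith
    have h4 : 0 ≤ lam * (η * z) * (q:ℝ) ^ (-(1/4) : ℝ) := by positivity
    have h5 : 0 ≤ (128 / ε ^ 3 + 20) * (lam * (η * z) * (q:ℝ) ^ (-(1/4) : ℝ)) := by positivity
    have e5 : 64 / ε ^ 3 * lam ^ (1/2 : ℝ) * (2 * z) = 128 / ε ^ 3 * (z * lam ^ (1/2 : ℝ)) := by ring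
    rw [hD]
    linarith
  have hδ1 : lam ^ (-(1/4) : ℝ) ≤ (q:ℝ) ^ (-(1 / (4 * K))) := by
    rw [Real.rpow_neg hlp.le, Real.rpow_neg hqp.le]
    apply inv_anti₀ (by positivity)
    calc (q:ℝ) ^ (1 / (4 * K)) ≤ (lam ^ K) ^ (1 / (4 * K)) := by gcongr
      _ = _ := by rw [← Real.rpow_mul hlp.le]; congr 1; field_simp
  have hδ2 : (q:ℝ) ^ (-(1/4) : ℝ) ≤ (q:ℝ) ^ (-(1 / (4 * K))) := by
    apply Real.rpow_le_rpow_of_exponent_le hq1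
    rw [neg_le_neg_iff]
    apply one_div_le_one_div_of_le (by norm_num); linarith
  set Q := (q:ℝ) ^ (-(1 / (4 * K))) with hQ
  have hlq : lam ^ (1/2 : ℝ) ≤ lam * η * Q := by
    calc lam ^ (1/2 : ℝ) = lam * (lam ^ (-(1/4) : ℝ) * lam ^ (-(1/4) : ℝ)) := by
          rw [← Real.rpow_add hlp]
          nth_rw 2 [← Real.rpow_one lam]
          rw [← Real.rpow_add hlp]; norm_num
      _ ≤ lam * (η * Q) := by gcongr
      _ = _ := by ring
  have hSfn : ‖Sf‖ ≤ 2 * D * Q * (η * z / lam) := by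
    have h1 : lam ^ 2 * ‖Sf‖ ≤ lam ^ 2 * (2 * D * Q * (η * z / lam)) := by
      refine hmain.trans ?_
      calc _ ≤ D * (z * (lam * η * Q) + lam * (η * z) * Q) := by gcongr
        _ = _ := by field_simp; ring
    exact le_of_mul_le_mul_left h1 (by positivity)
  have hzη : z ^ (9/10 : ℝ) ≤ η * z := by
    have h1 : lam ^ (-1 : ℝ) ≤ η := le_trans (Real.rpow_le_rpow_of_exponent_le f4 (by norm_num)) hη
    have h2 : (z ^ (1/10 : ℝ))⁻¹ ≤ η := le_trans (by rw [Real.rpow_neg_one]; gcongr) h1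
    calc z ^ (9/10 : ℝ) = (z ^ (1/10 : ℝ))⁻¹ * z := by
          rw [← Real.rpow_neg hzp.le]
          nth_rw 3 [← Real.rpow_one z]
          rw [← Real.rpow_add hzp]; norm_num
      _ ≤ _ := by gcongr
  have hcard : (#(primesIoc z X) : ℝ) ≤ 33 * (η * z / lam) := by
    have := hz₃ z hzz3 (η * z) hzη 1 one_pos (by simpa using Real.one_le_rpow hz1 (by norm_num)) 0
    rw [filter_true_of_mem (fun n _ => Subsingleton.elim _ _)] at this
    rw [show z + η * z = X by rw [hX]; ring] at this
    refine this.trans (le_of_eq ?_)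
    simp; ring
  have hcq : ‖cq q (t : ZMod q)‖ ≤ 33 ^ 2 * Q := by
    refine (norm_cq_le q _ htu).trans ?_
    have hφ : (0:ℝ) < Nat.totient q := by exact_mod_cast Nat.totient_pos.2 hq
    have hgq := gq_le_rpow hq (c := 1/16) (by norm_num)
    have e6 : √(q:ℝ) / q = (q:ℝ) ^ (-(1/2) : ℝ) := by
      rw [Real.sqrt_eq_rpow, div_eq_mul_inv, ← Real.rpow_neg_one, ← Real.rpow_add (by linarith)]; norm_num
    calc q * √q / (Nat.totient q : ℝ) ^ 2 = (q / Nat.totient q) ^ 2 * (√q / q) := by field_simp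
      _ ≤ (33 * (q:ℝ) ^ (1/16 : ℝ)) ^ 2 * (q:ℝ) ^ (-(1/2) : ℝ) := by
          rw [e6]; gcongr
          refine hgq.trans (le_of_eq ?_); norm_num
      _ = 33 ^ 2 * ((q:ℝ) ^ (1/8 : ℝ) * (q:ℝ) ^ (-(1/2) : ℝ)) := by
          rw [mul_pow, ← Real.rpow_mul_natCast (by positivity)]; norm_num [mul_assoc]
      _ = 33 ^ 2 * (q:ℝ) ^ (-(3/8) : ℝ) := by rw [← Real.rpow_add (by linarith)]; norm_num
      _ ≤ _ := by
          gcongr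
          refine le_trans (Real.rpow_le_rpow_of_exponent_le hq1 (by norm_num)) hδ2
  have hqz : (q:ℝ) ≤ z := by
    refine hqK.trans ?_
    calc lam ^ K ≤ (z ^ (1 / K)) ^ K := by gcongr
      _ = z := by rw [← Real.rpow_mul hzp.le]; simp [show K ≠ 0 by linarith]
  have hSe : ∑ p ∈ primesIoc z X, ee (t / q) p = Sf + cq q (t : ZMod q) * #(primesIoc z X) := by
    rw [mul_comm, ← nsmul_eq_mul, ← sum_const, hSf, ← sum_add_distrib]
    refine sum_congr rfl fun p hp => ?_
    obtain ⟨hpp, hp1, -⟩ := (mem_primesIoc hzp.le).1 hp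
    have hpu : IsUnit (p : ZMod q) := by
      rw [ZMod.isUnit_iff_coprime]
      have hqp' : q < p := by exact_mod_cast lt_of_le_of_lt hqz hp1
      exact (Nat.Prime.coprime_iff_not_dvd hpp).2 fun h => by
        have := Nat.le_of_dvd hq h; omega
    rw [ee_std, fq, if_pos hpu]; ring
  rw [hSe]
  refine (norm_add_le _ _).trans ?_
  rw [norm_mul, Complex.norm_natCast]
  have : ‖cq q (t : ZMod q)‖ * #(primesIoc z X) ≤ (33 ^ 2 * Q) * (33 * (η * z / lam)) := by gcongr
  linarith

end C5

section D1
open Finset Filter Topology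

theorem Astar_one : Astar 1 = 0 := by simp [Astar]

theorem Astar_mul {p m : ℕ} (hp : p.Prime) (hm : m ≠ 0) (h : ∀ r, r.Prime → r ∣ m → r ≤ p) :
    Astar (p * m) = p - Astar m := by
  have hl : (p * m).primeFactorsList = m.primeFactorsList ++ [p] := by
    apply List.Perm.eq_of_pairwise (le := (· ≤ ·))
    · intro a b _ _ h1 h2; exact le_antisymm h1 h2
    · exact (Nat.primeFactorsList_sorted _).pairwise
    · rw [List.pairwise_append]
      refine ⟨(Nat.primeFactorsList_sorted _).pairwise, by simp, ?_⟩
      intro a ha b hb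
      rw [List.mem_singleton] at hb
      subst hb
      exact h a (Nat.prime_of_mem_primeFactorsList ha) (Nat.dvd_of_mem_primeFactorsList ha)
    · refine (Nat.perm_primeFactorsList_mul hp.ne_zero hm).trans ?_
      rw [Nat.primeFactorsList_prime hp]
      exact List.perm_append_comm
  unfold Astar
  rw [hl, List.length_append, List.length_singleton, sum_range_succ', List.reverse_append]
  simp only [List.reverse_singleton, List.singleton_append, List.getD_cons_succ, List.getD_cons_zero]
  rw [pow_zero, one_mul, add_comm, sub_eq_add_neg, ← sum_neg_distrib]
  congr 1
  exact sum_congr rfl fun j _ => by ring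

/-- largest prime factor, `0` for `n ≤ 1` -/
def gp (n : ℕ) : ℕ := n.primeFactors.sup id

theorem le_gp {n r : ℕ} (hn : n ≠ 0) (hr : r.Prime) (h : r ∣ n) : r ≤ gp n :=
  Finset.le_sup (f := id) (Nat.mem_primeFactors.2 ⟨hr, h, hn⟩)

theorem gp_one : gp 1 = 0 := by simp [gp]

theorem gp_mem {n : ℕ} (hn : 2 ≤ n) : gp n ∈ n.primeFactors := by
  have hne : n.primeFactors.Nonempty := Nat.nonempty_primeFactors.2 (by omega)
  obtain ⟨r, hr, h⟩ := Finset.exists_mem_eq_sup _ hne id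
  unfold gp
  rw [h]; exact hr

theorem gp_prime {n : ℕ} (hn : 2 ≤ n) : (gp n).Prime := (Nat.mem_primeFactors.1 (gp_mem hn)).1
theorem gp_dvd {n : ℕ} (hn : 2 ≤ n) : gp n ∣ n := (Nat.mem_primeFactors.1 (gp_mem hn)).2.1

theorem gp_mul {p m : ℕ} (hp : p.Prime) (hm : m ≠ 0) (h : ∀ r, r.Prime → r ∣ m → r ≤ p) :
    gp (p * m) = p := by
  apply le_antisymm
  · refine Finset.sup_le fun r hr => ?_
    obtain ⟨h1, h2, h3⟩ := Nat.mem_primeFactors.1 hr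
    rcases (h1.dvd_mul).1 h2 with h4 | h4
    · exact ((Nat.prime_dvd_prime_iff_eq h1 hp).1 h4).le
    · exact h r h1 h4
  · exact le_gp (mul_ne_zero hp.ne_zero hm) hp (dvd_mul_right _ _)

theorem gp_decomp {n : ℕ} (hn : 2 ≤ n) : ∃ m, m ≠ 0 ∧ n = gp n * m ∧ n / gp n = m ∧ gp m ≤ gp n ∧
    Astar n = gp n - Astar m := by
  obtain ⟨m, hm⟩ := gp_dvd hn
  have hm0 : m ≠ 0 := by rintro rfl; omega
  have hp := gp_prime hn
  have hle : ∀ r, r.Prime → r ∣ m → r ≤ gp n := fun r hr h =>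
    le_gp (by omega) hr (h.trans (hm ▸ dvd_mul_left m (gp n)))
  refine ⟨m, hm0, hm, Nat.div_eq_of_eq_mul_right hp.pos hm, ?_, ?_⟩
  · exact Finset.sup_le fun r hr => hle r (Nat.prime_of_mem_primeFactors hr) (Nat.dvd_of_mem_primeFactors hr)
  · conv_lhs => rw [hm]
    exact Astar_mul hp hm0 hle

open Classical in
/-- `2^v`-smooth numbers up to `Z` -/
noncomputable def smooth (Z : ℝ) (v : ℕ) : Finset ℕ :=
  (Ioc 0 ⌊Z⌋₊).filter fun n => ∀ p, p.Prime → p ∣ n → p ≤ 2 ^ v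

theorem mem_smooth {Z : ℝ} {v n : ℕ} : n ∈ smooth Z v ↔ n ≠ 0 ∧ (n : ℝ) ≤ Z ∧ ∀ p, p.Prime → p ∣ n → p ≤ 2 ^ v := by
  classical
  unfold smooth
  rw [mem_filter, mem_Ioc, and_assoc, Nat.pos_iff_ne_zero]
  constructor
  · rintro ⟨h1, h2, h3⟩; exact ⟨h1, (Nat.le_floor_iff' h1).1 h2, h3⟩
  · rintro ⟨h1, h2, h3⟩; exact ⟨h1, (Nat.le_floor_iff' h1).2 h2, h3⟩

theorem smooth_mono {Z Z' : ℝ} (h : Z ≤ Z') (v : ℕ) : smooth Z v ⊆ smooth Z' v := fun n hn => by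
  rw [mem_smooth] at *
  exact ⟨hn.1, hn.2.1.trans h, hn.2.2⟩

noncomputable def cellLo (H j h : ℕ) : ℝ := 2 ^ j * (1 + (h : ℝ) / H)

theorem cellLo_pos (H j h : ℕ) : 0 < cellLo H j h := by unfold cellLo; positivity
theorem cellLo_zero (H j : ℕ) : cellLo H j 0 = 2 ^ j := by simp [cellLo]
theorem cellLo_top {H : ℕ} (hH : 0 < H) (j : ℕ) : cellLo H j H = 2 ^ (j + 1) := by
  have : (H : ℝ) ≠ 0 := by positivity
  rw [cellLo, div_self this, pow_succ]; norm_num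
theorem cellLo_mono (H j : ℕ) {h h' : ℕ} (hh : h ≤ h') : cellLo H j h ≤ cellLo H j h' := by
  unfold cellLo; gcongr
theorem cellLo_ge (H j h : ℕ) : 2 ^ j ≤ cellLo H j h := by
  rw [← cellLo_zero H j]; exact cellLo_mono H j (Nat.zero_le _)
theorem cellLo_le {H : ℕ} (hH : 0 < H) (j : ℕ) {h : ℕ} (hh : h ≤ H) : cellLo H j h ≤ 2 ^ (j + 1) := by
  rw [← cellLo_top hH j]; exact cellLo_mono H j hh

noncomputable def cell (H j h : ℕ) : Finset ℕ := primesIoc (cellLo H j h) (cellLo H j (h + 1))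

theorem mem_cell {H j h p : ℕ} : p ∈ cell H j h ↔ p.Prime ∧ cellLo H j h < p ∧ (p : ℝ) ≤ cellLo H j (h + 1) :=
  mem_primesIoc (cellLo_pos H j h).le

theorem cell_bounds {H j h p : ℕ} (hh : h < H) (hp : p ∈ cell H j h) :
    p.Prime ∧ 2 ^ j < p ∧ p ≤ 2 ^ (j + 1) := by
  obtain ⟨h1, h2, h3⟩ := mem_cell.1 hp
  refine ⟨h1, ?_, ?_⟩
  · have := (cellLo_ge H j h).trans_lt h2
    exact_mod_cast this
  · have := h3.trans (cellLo_le (by omega) j (by omega : h + 1 ≤ H))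
    exact_mod_cast this

theorem dyad_unique {j j' p : ℕ} (h1 : 2 ^ j < p) (h2 : p ≤ 2 ^ (j + 1)) (h3 : 2 ^ j' < p) (h4 : p ≤ 2 ^ (j' + 1)) :
    j = j' := by
  have a : j < j' + 1 := (Nat.pow_lt_pow_iff_right (by norm_num)).1 (h1.trans_le h4)
  have b : j' < j + 1 := (Nat.pow_lt_pow_iff_right (by norm_num)).1 (h3.trans_le h2)
  omega

theorem cell_unique {H j h h' p : ℕ} (hp : p ∈ cell H j h) (hp' : p ∈ cell H j h') : h = h' := by
  obtain ⟨_, h2, h3⟩ := mem_cell.1 hp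
  obtain ⟨_, h5, h6⟩ := mem_cell.1 hp'
  by_contra hne
  rcases lt_or_gt_of_ne hne with hlt | hlt
  · linarith [cellLo_mono H j (show h + 1 ≤ h' from hlt)]
  · linarith [cellLo_mono H j (show h' + 1 ≤ h from hlt)]

theorem exists_cell {H : ℕ} (hH : 0 < H) {p j : ℕ} (hp : p.Prime) (h1 : 2 ^ j < p) (h2 : p ≤ 2 ^ (j + 1)) :
    ∃ h < H, p ∈ cell H j h := by
  classical
  have hex : ∃ h, (p : ℝ) ≤ cellLo H j (h + 1) := ⟨H - 1, by
    rw [Nat.sub_add_cancel hH, cellLo_top hH]; exact_mod_cast h2⟩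
  refine ⟨Nat.find hex, ?_, ?_⟩
  · have : Nat.find hex ≤ H - 1 := Nat.find_min' hex (by
      rw [Nat.sub_add_cancel hH, cellLo_top hH]; exact_mod_cast h2)
    omega
  · rw [mem_cell]
    refine ⟨hp, ?_, Nat.find_spec hex⟩
    rcases Nat.eq_zero_or_pos (Nat.find hex) with h0 | h0
    · rw [h0, cellLo_zero]; exact_mod_cast h1
    · have := Nat.find_min hex (m := Nat.find hex - 1) (by omega)
      rw [Nat.sub_add_cancel h0] at this
      exact not_le.1 this

theorem exists_dyad {p : ℕ} (hp : 2 ≤ p) : ∃ j, 2 ^ j < p ∧ p ≤ 2 ^ (j + 1) := by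
  refine ⟨Nat.log 2 (p - 1), ?_, ?_⟩
  · have := Nat.pow_log_le_self 2 (show p - 1 ≠ 0 by omega)
    omega
  · have := Nat.lt_pow_succ_log_self (b := 2) (by norm_num) (p - 1)
    omega

noncomputable def GG (H j0 : ℕ) : ℕ → ℝ → ℕ → Finset ℕ
  | 0, Z, v => smooth Z v
  | k + 1, Z, v => (Ico j0 v).biUnion fun j => (range H).biUnion fun h => (cell H j h).biUnion fun p =>
      (GG H j0 k (Z / cellLo H j (h + 1)) j).image (p * ·)

theorem GG_sub (H j0 k : ℕ) : ∀ Z v, GG H j0 k Z v ⊆ smooth Z v := by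
  induction k with
  | zero => intro Z v; exact subset_rfl
  | succ k ih =>
    intro Z v n hn
    simp only [GG, mem_biUnion, mem_image, mem_Ico, mem_range] at hn
    obtain ⟨j, ⟨hj0, hjv⟩, h, hh, p, hp, m, hm, rfl⟩ := hn
    obtain ⟨hm0, hmZ, hms⟩ := mem_smooth.1 (ih _ _ hm)
    obtain ⟨hpp, hp1, hp2⟩ := cell_bounds hh hp
    rw [mem_smooth]
    refine ⟨mul_ne_zero hpp.ne_zero hm0, ?_, ?_⟩
    · rw [le_div_iff₀ (cellLo_pos _ _ _)] at hmZ
      push_cast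
      calc (p : ℝ) * m ≤ cellLo H j (h + 1) * m := by
            gcongr; exact (mem_cell.1 hp).2.2
        _ ≤ Z := by linarith
    · intro r hr hrd
      rcases (hr.dvd_mul).1 hrd with h4 | h4
      · rw [(Nat.prime_dvd_prime_iff_eq hr hpp).1 h4]
        exact hp2.trans (Nat.pow_le_pow_right (by norm_num) hjv)
      · exact (hms r hr h4).trans (Nat.pow_le_pow_right (by norm_num) hjv.le)

theorem GG_gp {H j0 k : ℕ} {Z : ℝ} {j h p m : ℕ} (hh : h < H) (hp : p ∈ cell H j h) (hm : m ∈ GG H j0 k Z j) :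
    m ≠ 0 ∧ (∀ r, r.Prime → r ∣ m → r ≤ p) ∧ gp (p * m) = p ∧ Astar (p * m) = p - Astar m := by
  obtain ⟨hm0, hmZ, hms⟩ := mem_smooth.1 (GG_sub _ _ _ _ _ hm)
  obtain ⟨hpp, hp1, hp2⟩ := cell_bounds hh hp
  have : ∀ r, r.Prime → r ∣ m → r ≤ p := fun r hr h => (hms r hr h).trans hp1.le
  exact ⟨hm0, this, gp_mul hpp hm0 this, Astar_mul hpp hm0 this⟩

theorem GG_sum {E : Type*} [AddCommMonoid E] (H j0 k : ℕ) (Z : ℝ) (v : ℕ) (f : ℕ → E) :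
    ∑ n ∈ GG H j0 (k + 1) Z v, f n = ∑ j ∈ Ico j0 v, ∑ h ∈ range H, ∑ p ∈ cell H j h,
      ∑ m ∈ GG H j0 k (Z / cellLo H j (h + 1)) j, f (p * m) := by
  rw [GG, sum_biUnion]
  · refine sum_congr rfl fun j hj => ?_
    rw [sum_biUnion]
    · refine sum_congr rfl fun h hh => ?_
      rw [sum_biUnion]
      · refine sum_congr rfl fun p hp => ?_
        rw [sum_image]
        intro a _ b _ hab
        exact Nat.eq_of_mul_eq_mul_left (cell_bounds (mem_range.1 hh) hp).1.pos hab
      · intro p hp p' hp' hne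
        rw [Function.onFun, Finset.disjoint_left]
        intro n hn hn'
        obtain ⟨m, hm, rfl⟩ := mem_image.1 hn
        obtain ⟨m', hm', h2⟩ := mem_image.1 hn'
        have a := (GG_gp (mem_range.1 hh) hp hm).2.2.1
        have b := (GG_gp (mem_range.1 hh) hp' hm').2.2.1
        rw [h2] at b
        exact hne (a.symm.trans b)
    · intro h hh h' hh' hne
      rw [Function.onFun, Finset.disjoint_left]
      intro n hn hn'
      simp only [mem_biUnion, mem_image] at hn hn'
      obtain ⟨p, hp, m, hm, rfl⟩ := hn
      obtain ⟨p', hp', m', hm', h2⟩ := hn'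
      have a := (GG_gp (mem_range.1 hh) hp hm).2.2.1
      have b := (GG_gp (mem_range.1 hh') hp' hm').2.2.1
      rw [h2] at b
      have : p = p' := a.symm.trans b
      subst this
      exact hne (cell_unique hp hp')
  · intro j hj j' hj' hne
    rw [Function.onFun, Finset.disjoint_left]
    intro n hn hn'
    simp only [mem_biUnion, mem_image, mem_range] at hn hn'
    obtain ⟨h, hh, p, hp, m, hm, rfl⟩ := hn
    obtain ⟨h', hh', p', hp', m', hm', h2⟩ := hn'
    have a := (GG_gp hh hp hm).2.2.1
    have b := (GG_gp hh' hp' hm').2.2.1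
    rw [h2] at b
    have : p = p' := a.symm.trans b
    subst this
    obtain ⟨_, a1, a2⟩ := cell_bounds hh hp
    obtain ⟨_, b1, b2⟩ := cell_bounds hh' hp'
    exact hne (dyad_unique a1 a2 b1 b2)

/-- dyadic primes -/
noncomputable def dyP (j : ℕ) : Finset ℕ := (Ioc (2 ^ j) (2 ^ (j + 1))).filter Nat.Prime

theorem mem_dyP {j p : ℕ} : p ∈ dyP j ↔ p.Prime ∧ 2 ^ j < p ∧ p ≤ 2 ^ (j + 1) := by
  rw [dyP, mem_filter, mem_Ioc]; tauto

theorem smooth_sum (Z : ℝ) (j0 v : ℕ) :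
    ∑ j ∈ Ico j0 v, ∑ p ∈ dyP j, (smooth (Z / p) j).card ≤ (smooth Z v).card := by
  classical
  have : ∑ j ∈ Ico j0 v, ∑ p ∈ dyP j, (smooth (Z / p) j).card
      = ((Ico j0 v).sigma fun j => (dyP j).sigma fun p => smooth (Z / p) j).card := by
    rw [card_sigma]
    exact sum_congr rfl fun j _ => by rw [card_sigma]
  rw [this]
  refine Finset.card_le_card_of_injOn (fun s => s.2.1 * s.2.2) ?_ ?_
  · rintro ⟨j, p, m⟩ hs
    simp only [coe_sigma, Set.mem_sigma_iff, mem_coe, mem_Ico, mem_dyP, mem_smooth] at hs ⊢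
    obtain ⟨⟨h1, h2⟩, ⟨h3, h4, h5⟩, h6, h7, h8⟩ := hs
    refine ⟨mul_ne_zero h3.ne_zero h6, ?_, ?_⟩
    · rw [le_div_iff₀ (by exact_mod_cast h3.pos)] at h7
      push_cast; linarith
    · intro r hr hrd
      rcases (hr.dvd_mul).1 hrd with h | h
      · rw [(Nat.prime_dvd_prime_iff_eq hr h3).1 h]
        exact h5.trans (Nat.pow_le_pow_right (by norm_num) h2)
      · exact (h8 r hr h).trans (Nat.pow_le_pow_right (by norm_num) h2.le)
  · rintro ⟨j, p, m⟩ hs ⟨j', p', m'⟩ hs' heq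
    simp only [coe_sigma, Set.mem_sigma_iff, mem_coe, mem_Ico, mem_dyP, mem_smooth] at hs hs' heq
    obtain ⟨⟨h1, h2⟩, ⟨h3, h4, h5⟩, h6, h7, h8⟩ := hs
    obtain ⟨⟨h1', h2'⟩, ⟨h3', h4', h5'⟩, h6', h7', h8'⟩ := hs'
    have a := gp_mul h3 h6 fun r hr h => (h8 r hr h).trans h4.le
    have b := gp_mul h3' h6' fun r hr h => (h8' r hr h).trans h4'.le
    rw [← heq] at b
    have hpp : p = p' := a.symm.trans b
    subst hpp
    have hj : j = j' := dyad_unique h4 h5 h4' h5'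
    subst hj
    have hm : m = m' := Nat.eq_of_mul_eq_mul_left h3.pos heq
    subst hm
    rfl

/-- The main multiplicative decay estimate. -/
theorem GG_bound (H j0 : ℕ) (α S lam : ℝ) (hS : 0 ≤ S) (hlam : 0 < lam)
    (hyp : ∀ j, j0 ≤ j → ∀ Z : ℝ, 0 ≤ Z → ∑ h ∈ range H, ‖∑ p ∈ cell H j h, ee α p‖ * (smooth (Z / cellLo H j (h + 1)) j).card
      ≤ S * ∑ p ∈ dyP j, ((smooth (lam * Z / p) j).card : ℝ)) (k : ℕ) :
    ∀ (Z : ℝ) (v : ℕ), 0 ≤ Z → ‖∑ n ∈ GG H j0 k Z v, ee α (Astar n)‖ ≤ S ^ k * (smooth (lam ^ k * Z) v).card := by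
  induction k with
  | zero =>
    intro Z v hZ
    rw [pow_zero, one_mul, pow_zero, one_mul]
    refine (norm_sum_le _ _).trans ?_
    simp [ee_norm, GG]
  | succ k ih =>
    intro Z v hZ
    rw [GG_sum]
    calc ‖∑ j ∈ Ico j0 v, ∑ h ∈ range H, ∑ p ∈ cell H j h,
        ∑ m ∈ GG H j0 k (Z / cellLo H j (h + 1)) j, ee α (Astar (p * m))‖
        ≤ ∑ j ∈ Ico j0 v, ∑ h ∈ range H, ‖∑ p ∈ cell H j h, ee α p‖ *
            (S ^ k * (smooth (lam ^ k * Z / cellLo H j (h + 1)) j).card) := by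
          refine (norm_sum_le _ _).trans (sum_le_sum fun j hj => ?_)
          refine (norm_sum_le _ _).trans (sum_le_sum fun h hh => ?_)
          have : ∑ p ∈ cell H j h, ∑ m ∈ GG H j0 k (Z / cellLo H j (h + 1)) j, ee α (Astar (p * m))
              = (∑ p ∈ cell H j h, ee α p) * (starRingEnd ℂ) (∑ m ∈ GG H j0 k (Z / cellLo H j (h + 1)) j, ee α (Astar m)) := by
            rw [map_sum, sum_mul_sum]
            refine sum_congr rfl fun p hp => sum_congr rfl fun m hm => ?_
            rw [(GG_gp (mem_range.1 hh) hp hm).2.2.2, ee_sub]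
          rw [this, norm_mul, RCLike.norm_conj]
          refine mul_le_mul_of_nonneg_left ?_ (norm_nonneg _)
          rw [mul_div_assoc]
          exact ih _ _ (div_nonneg hZ (cellLo_pos _ _ _).le)
      _ = S ^ k * ∑ j ∈ Ico j0 v, ∑ h ∈ range H, ‖∑ p ∈ cell H j h, ee α p‖ *
            (smooth (lam ^ k * Z / cellLo H j (h + 1)) j).card := by
          rw [mul_sum]
          refine sum_congr rfl fun j _ => ?_
          rw [mul_sum]
          exact sum_congr rfl fun h _ => by ring
      _ ≤ S ^ k * ∑ j ∈ Ico j0 v, S * ∑ p ∈ dyP j, ((smooth (lam * (lam ^ k * Z) / p) j).card : ℝ) := by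
          gcongr with j hj
          exact hyp j (mem_Ico.1 hj).1 _ (by positivity)
      _ = S ^ (k + 1) * ((∑ j ∈ Ico j0 v, ∑ p ∈ dyP j, (smooth ((lam ^ (k + 1) * Z) / p) j).card : ℕ) : ℝ) := by
          rw [← mul_sum, ← mul_assoc, ← pow_succ]
          push_cast
          congr 1
          refine sum_congr rfl fun j _ => sum_congr rfl fun p _ => ?_
          rw [pow_succ, mul_comm (lam ^ k) lam, mul_assoc]
      _ ≤ _ := by
          gcongr
          exact smooth_sum _ _ _

theorem smooth_card_le {Z : ℝ} (hZ : 0 ≤ Z) (v : ℕ) : ((smooth Z v).card : ℝ) ≤ Z := by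
  classical
  have : (smooth Z v).card ≤ ⌊Z⌋₊ := by
    unfold smooth
    refine (card_filter_le _ _).trans ?_
    simp
  exact (Nat.cast_le.2 this).trans (Nat.floor_le hZ)

/-- goodness -/
def good (y : ℕ) : ℕ → ℕ → Prop
  | 0, _ => True
  | k + 1, n => y < gp n ∧ 2 * gp (n / gp n) ≤ gp n ∧ good y k (n / gp n)

theorem cellLo_ratio {H : ℕ} (hH : 0 < H) (j h : ℕ) : cellLo H j (h + 1) ≤ (1 + 1 / (H : ℝ)) * cellLo H j h := by
  have hp : (0:ℝ) < H := by exact_mod_cast hH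
  unfold cellLo
  push_cast
  have : (1 + ((h : ℝ) + 1) / H) ≤ (1 + 1 / H) * (1 + h / H) := by
    have : 0 ≤ (1 / (H:ℝ)) * (h / H) := by positivity
    have e : ((h : ℝ) + 1) / H = h / H + 1 / H := by ring
    rw [e]; nlinarith
  calc (2:ℝ) ^ j * (1 + ((h : ℝ) + 1) / H) ≤ 2 ^ j * ((1 + 1 / H) * (1 + h / H)) := by gcongr
    _ = _ := by ring

theorem good_mem (H j0 : ℕ) (hH : 0 < H) (k : ℕ) : ∀ (n : ℕ) (Z : ℝ) (v : ℕ), n ≠ 0 → good (2 ^ j0) k n →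
    (1 + 1 / (H : ℝ)) ^ k * n ≤ Z → gp n ≤ 2 ^ v → n ∈ GG H j0 k Z v := by
  induction k with
  | zero =>
    intro n Z v hn _ hZ hv
    rw [GG, mem_smooth]
    refine ⟨hn, by simpa using hZ, fun p hp hd => (le_gp hn hp hd).trans hv⟩
  | succ k ih =>
    intro n Z v hn hg hZ hv
    obtain ⟨hg1, hg2, hg3⟩ := hg
    have hn2 : 2 ≤ n := by
      by_contra hlt
      have : n = 1 := by omega
      rw [this, gp_one] at hg1
      exact absurd hg1 (Nat.not_lt_zero _)
    obtain ⟨m, hm0, hnm, hdiv, hgm, _⟩ := gp_decomp hn2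
    rw [hdiv] at hg2 hg3
    have hp := gp_prime hn2
    obtain ⟨j, hj1, hj2⟩ := exists_dyad hp.two_le
    obtain ⟨h, hh, hc⟩ := exists_cell hH hp hj1 hj2
    simp only [GG, mem_biUnion, mem_image, mem_Ico, mem_range]
    refine ⟨j, ⟨?_, ?_⟩, h, hh, gp n, hc, m, ?_, hnm.symm⟩
    · have : j0 < j + 1 := (Nat.pow_lt_pow_iff_right (a := 2) (by norm_num)).1 (hg1.trans_le hj2)
      omega
    · exact (Nat.pow_lt_pow_iff_right (a := 2) (by norm_num)).1 (hj1.trans_le hv)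
    · apply ih m _ _ hm0 hg3
      · rw [le_div_iff₀ (cellLo_pos _ _ _)]
        refine le_trans ?_ hZ
        have h1 := cellLo_ratio hH j h
        have h2 := (mem_cell.1 hc).2.1
        have hH0 : (0:ℝ) < 1 + 1 / (H : ℝ) := by positivity
        calc (1 + 1 / (H : ℝ)) ^ k * m * cellLo H j (h + 1)
            ≤ (1 + 1 / (H : ℝ)) ^ k * m * ((1 + 1 / (H : ℝ)) * gp n) := by
              gcongr
              exact h1.trans (mul_le_mul_of_nonneg_left h2.le hH0.le)
          _ = (1 + 1 / (H : ℝ)) ^ (k + 1) * (gp n * m : ℕ) := by push_cast; ring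
          _ = _ := by rw [← hnm]
      · rw [pow_succ] at hj2
        omega

end D1

section D2
open Finset Filter Topology

theorem dyP_lower : ∃ c : ℝ, 0 < c ∧ ∃ J : ℕ, ∀ j ≥ J, c * (2 ^ j / (j * Real.log 2)) ≤ (dyP j).card := by
  obtain ⟨z₀, h⟩ := primes_AP_window 1 1 isUnit_one 2 (by norm_num)
  obtain ⟨J, hJ⟩ := (eventually_atTop.1 ((tendsto_pow_atTop_atTop_of_one_lt (r := (2:ℝ)) (by norm_num)).eventually_ge_atTop z₀))
  refine ⟨((Nat.totient 1 : ℕ) : ℝ)⁻¹ * (2 - 1) / 4, by norm_num, J, fun j hj => ?_⟩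
  have := h (2 ^ j) (hJ j hj)
  rw [Real.log_pow] at this
  refine this.trans ?_
  norm_cast
  apply card_le_card
  intro p hp
  have hp := (mem_filter.1 hp).1
  have e := (mem_primesIoc (by positivity)).1 hp
  rw [mem_dyP]
  refine ⟨e.1, by exact_mod_cast e.2.1, ?_⟩
  have := e.2.2
  rw [pow_succ, mul_comm]
  exact_mod_cast this

theorem high_GG (K : ℝ) (hK : 1 ≤ K) : ∃ C : ℝ, 0 < C ∧ ∃ J : ℕ, ∀ j0 ≥ J, ∀ H : ℕ, 0 < H →
    (2 * (H : ℝ)) ^ 4 ≤ j0 * Real.log 2 → ∀ q : ℕ, 0 < q → (q : ℝ) ≤ (j0 * Real.log 2) ^ K →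
    ∀ t : ℤ, IsCoprime t (q : ℤ) → ∀ (k : ℕ) (Z : ℝ) (v : ℕ), 0 ≤ Z →
    ‖∑ n ∈ GG H j0 k Z v, ee (t / q) (Astar n)‖ ≤ (C * (q : ℝ) ^ (-(1 / (4 * K)))) ^ k * (2 ^ k * Z) := by
  obtain ⟨C, hC, z₀, hz⟩ := high_cell K hK
  obtain ⟨c, hc, J1, hJ1⟩ := dyP_lower
  obtain ⟨J2, hJ2⟩ := (eventually_atTop.1 ((tendsto_pow_atTop_atTop_of_one_lt (r := (2:ℝ)) (by norm_num)).eventually_ge_atTop z₀))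
  refine ⟨C / c, by positivity, max J1 (max J2 1), ?_⟩
  intro j0 hj0 H hH hH4 q hq hqK t ht k Z v hZ
  have hq0 : (0:ℝ) < q := by exact_mod_cast hq
  have hH0 : (0:ℝ) < H := by exact_mod_cast hH
  have hl2 : 0 < Real.log 2 := Real.log_pos (by norm_num)
  have key := GG_bound H j0 (t / q) (C / c * (q : ℝ) ^ (-(1 / (4 * K)))) 2 (by positivity) (by norm_num) ?_ k Z v hZ
  · refine key.trans ?_
    gcongr
    exact smooth_card_le (by positivity) v
  · intro j hj Z hZ
    have hj1 : 1 ≤ j := by omega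
    have hjp : (0:ℝ) < j := by exact_mod_cast hj1
    have hcell : ∀ h ∈ range H, ‖∑ p ∈ cell H j h, ee (t / q) p‖ ≤ C * (q : ℝ) ^ (-(1 / (4 * K))) * (2 ^ j / (H * (j * Real.log 2))) := by
      intro h hh
      set z := cellLo H j h with hzdef
      have hzp : 0 < z := cellLo_pos _ _ _
      have hz2 : 2 ^ j ≤ z := cellLo_ge _ _ _
      have hz3 : z ≤ 2 ^ (j + 1) := cellLo_le hH j (mem_range.1 hh).le
      have hlogz : j * Real.log 2 ≤ Real.log z := by
        rw [← Real.log_pow]; exact Real.log_le_log (by positivity) hz2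
      have hlogj : (j0:ℝ) * Real.log 2 ≤ j * Real.log 2 := by gcongr
      set η := 2 ^ j / H / z with hη
      have hηz : η * z = 2 ^ j / H := by rw [hη]; field_simp
      have e1 : cellLo H j (h + 1) = z * (1 + η) := by
        rw [mul_add, mul_one, mul_comm z η, hηz, hzdef]
        unfold cellLo; push_cast; ring
      have hηlo : 1 / (2 * (H:ℝ)) ≤ η := by
        rw [hη, div_div, div_le_div_iff₀ (by positivity) (by positivity)]
        rw [pow_succ] at hz3
        nlinarith
      have hηhi : η ≤ 1 := by
        rw [hη, div_div, div_le_one (by positivity)]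
        have : (1:ℝ) ≤ H := by exact_mod_cast hH
        nlinarith
      have hLp : 0 < Real.log z := lt_of_lt_of_le (by positivity) hlogz
      have hlow : Real.log z ^ (-(1/4) : ℝ) ≤ η := by
        refine le_trans ?_ hηlo
        rw [Real.rpow_neg hLp.le, one_div (2 * (H:ℝ))]
        apply inv_anti₀ (by positivity)
        calc 2 * (H:ℝ) = ((2 * (H:ℝ)) ^ 4) ^ (1/4 : ℝ) := by
              rw [← Real.rpow_natCast, ← Real.rpow_mul (by positivity)]; norm_num
          _ ≤ _ := by
              apply Real.rpow_le_rpow (by positivity) _ (by norm_num)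
              linarith
      have hqz : (q:ℝ) ≤ Real.log z ^ K := by
        refine hqK.trans ?_
        apply Real.rpow_le_rpow (by positivity) (by linarith) (by linarith)
      have := hz z ((hJ2 j (by omega)).trans hz2) η hlow hηhi q hq hqz t ht
      unfold cell
      rw [← hzdef, e1]
      refine this.trans ?_
      rw [hηz, div_div]
      gcongr
    have hsm : ∀ h ∈ range H, ((smooth (Z / cellLo H j (h + 1)) j).card : ℝ) ≤ (smooth (Z / 2 ^ j) j).card := by
      intro h hh
      norm_cast
      apply card_le_card (smooth_mono _ _)
      push_cast
      gcongr
      exact cellLo_ge _ _ _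
    calc _ ≤ ∑ h ∈ range H, C * (q : ℝ) ^ (-(1 / (4 * K))) * (2 ^ j / (H * (j * Real.log 2))) * ((smooth (Z / 2 ^ j) j).card : ℝ) := by
          refine sum_le_sum fun h hh => ?_
          exact mul_le_mul (hcell h hh) (hsm h hh) (by positivity) (by positivity)
      _ = C / c * (q : ℝ) ^ (-(1 / (4 * K))) * (c * (2 ^ j / (j * Real.log 2)) * ((smooth (Z / 2 ^ j) j).card : ℝ)) := by
          rw [sum_const, card_range, nsmul_eq_mul]
          field_simp
      _ ≤ C / c * (q : ℝ) ^ (-(1 / (4 * K))) * ((dyP j).card * ((smooth (Z / 2 ^ j) j).card : ℝ)) := by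
          gcongr
          exact hJ1 j (by omega)
      _ ≤ _ := by
          gcongr
          rw [← nsmul_eq_mul, ← sum_const]
          refine sum_le_sum fun p hp => ?_
          norm_cast
          apply card_le_card (smooth_mono _ _)
          push_cast
          obtain ⟨h1, h2, h3⟩ := mem_dyP.1 hp
          have h3' : (p:ℝ) ≤ 2 ^ (j + 1) := by exact_mod_cast h3
          rw [div_le_div_iff₀ (by positivity) (by exact_mod_cast h1.pos)]
          calc Z * p ≤ Z * 2 ^ (j + 1) := by gcongr
            _ = _ := by ring

lemma card_primesIoc_le (ρ : ℝ) (hρ : 1 < ρ) : ∃ z₀ : ℝ, ∀ z, z₀ ≤ z →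
    ((primesIoc z (ρ * z)).card : ℝ) ≤ 33 * (ρ - 1) * (z / Real.log z) := by
  obtain ⟨z₀, h⟩ := bt_short
  have ht := (tendsto_rpow_atTop (show (0:ℝ) < 1 / 10 by norm_num)).eventually_ge_atTop ((ρ - 1)⁻¹)
  obtain ⟨z₁, h1⟩ := eventually_atTop.1 ht
  refine ⟨max z₀ (max z₁ 2), fun z hz => ?_⟩
  have hz0 := (le_max_left _ _).trans hz
  have hz1 := h1 z (((le_max_left _ _).trans (le_max_right _ _)).trans hz)
  have hz2 : 2 ≤ z := ((le_max_right _ _).trans (le_max_right _ _)).trans hz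
  have hpos : 0 < ρ - 1 := by linarith
  have e : z = z ^ (9/10 : ℝ) * z ^ (1/10 : ℝ) := by
    rw [← Real.rpow_add (by linarith)]; norm_num
  have := h z hz0 ((ρ - 1) * z) ?_ 1 one_pos ?_ 0
  · rw [show z + (ρ - 1) * z = ρ * z by ring, filter_true_of_mem (fun p _ => Subsingleton.elim _ _)] at this
    rw [Nat.totient_one] at this
    refine this.trans (le_of_eq ?_)
    push_cast; ring
  · have h9 : 0 ≤ z ^ (9/10 : ℝ) := by positivity
    have h3 : 1 ≤ (ρ - 1) * z ^ (1/10 : ℝ) := by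
      calc (1:ℝ) = (ρ - 1) * (ρ - 1)⁻¹ := (mul_inv_cancel₀ hpos.ne').symm
        _ ≤ _ := mul_le_mul_of_nonneg_left hz1 hpos.le
    calc z ^ (9/10 : ℝ) = z ^ (9/10 : ℝ) * 1 := (mul_one _).symm
      _ ≤ z ^ (9/10 : ℝ) * ((ρ - 1) * z ^ (1/10 : ℝ)) := mul_le_mul_of_nonneg_left h3 h9
      _ = (ρ - 1) * (z ^ (9/10 : ℝ) * z ^ (1/10 : ℝ)) := by ring
      _ = _ := by rw [← e]
  · push_cast
    exact Real.one_le_rpow (by linarith) (by norm_num)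

theorem low_cell (q : ℕ) (hq : 3 ≤ q) (t : ℤ) (ht : IsCoprime t (q : ℤ)) :
    ∃ s : ℝ, 0 ≤ s ∧ s < 1 ∧ ∀ ρ : ℝ, 1 < ρ → ∃ z₀ : ℝ, ∀ z, z₀ ≤ z →
      ‖∑ p ∈ primesIoc z (ρ * z), ee (t / q) p‖ ≤ s * (primesIoc z (ρ * z)).card := by
  have : NeZero q := ⟨by omega⟩
  have : Fact (1 < q) := ⟨by omega⟩
  set w := ‖ee (t / q) 1 + ee (t / q) (-1)‖ with hw
  have hw2 : w < 2 := ee_one_lt hq t ht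
  have hφ : (0:ℝ) < (q.totient : ℝ)⁻¹ := by
    have := Nat.totient_pos.2 (show 0 < q by omega); positivity
  set κ : ℝ := (q.totient : ℝ)⁻¹ / 132 with hκ
  have hκ0 : 0 < κ := by positivity
  refine ⟨max 0 (1 - κ * (2 - w)), le_max_left _ _, max_lt one_pos (by nlinarith), fun ρ hρ => ?_⟩
  obtain ⟨z1, h1⟩ := primes_AP_window q 1 isUnit_one ρ hρ
  obtain ⟨z2, h2⟩ := primes_AP_window q (-1) (isUnit_one.neg) ρ hρ
  obtain ⟨z3, h3⟩ := card_primesIoc_le ρ hρ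
  refine ⟨max z1 (max z2 (max z3 2)), fun z hz => ?_⟩
  have hz1 : z1 ≤ z := (le_max_left _ _).trans hz
  have hz2 : z2 ≤ z := ((le_max_left _ _).trans (le_max_right _ _)).trans hz
  have hz34 : max z3 2 ≤ z := ((le_max_right _ _).trans (le_max_right _ _)).trans hz
  have hz3 : z3 ≤ z := (le_max_left _ _).trans hz34
  have hz4 : 2 ≤ z := (le_max_right _ _).trans hz34
  have g1 := h1 z hz1
  have g2 := h2 z hz2
  have g3 := h3 z hz3
  set P := primesIoc z (ρ * z) with hP
  set P1 := P.filter (fun p : ℕ => (p : ZMod q) = 1) with hP1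
  set P2 := P.filter (fun p : ℕ => (p : ZMod q) = -1) with hP2
  have hne : (1 : ZMod q) ≠ -1 := by
    intro h
    have : ((2 : ℕ) : ZMod q) = 0 := by
      push_cast
      rw [← one_add_one_eq_two]; nth_rewrite 2 [h]; ring
    rw [ZMod.natCast_eq_zero_iff] at this
    have := Nat.le_of_dvd (by norm_num) this
    omega
  have hdisj : Disjoint P1 P2 := by
    rw [hP1, hP2, disjoint_filter]
    intro p _ h h'
    exact hne (h.symm.trans h')
  have hsub : P1 ∪ P2 ⊆ P := union_subset (filter_subset _ _) (filter_subset _ _)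
  have hX : 0 ≤ z / Real.log z := by
    have : 0 < Real.log z := Real.log_pos (by linarith)
    positivity
  have hN1 : κ * P.card ≤ P1.card := by
    refine le_trans ?_ g1
    calc κ * P.card ≤ κ * (33 * (ρ - 1) * (z / Real.log z)) := mul_le_mul_of_nonneg_left g3 hκ0.le
      _ = _ := by rw [hκ]; ring
  have hN2 : κ * P.card ≤ P2.card := by
    refine le_trans ?_ g2
    calc κ * P.card ≤ κ * (33 * (ρ - 1) * (z / Real.log z)) := mul_le_mul_of_nonneg_left g3 hκ0.le
      _ = _ := by rw [hκ]; ring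
  have s1 : ∑ p ∈ P1, ee (t / q) p = P1.card * ee (t / q) 1 := by
    rw [← nsmul_eq_mul, ← sum_const]
    apply sum_congr rfl
    intro p hp
    apply ee_period (by omega)
    simpa using (mem_filter.1 hp).2
  have s2 : ∑ p ∈ P2, ee (t / q) p = P2.card * ee (t / q) (-1) := by
    rw [← nsmul_eq_mul, ← sum_const]
    apply sum_congr rfl
    intro p hp
    apply ee_period (by omega)
    simpa using (mem_filter.1 hp).2
  have s3 : ∑ p ∈ P, ee (t / q) p = ∑ p ∈ P \ (P1 ∪ P2), ee (t / q) p +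
      (P1.card * ee (t / q) 1 + P2.card * ee (t / q) (-1)) := by
    rw [← sum_sdiff hsub, sum_union hdisj, s1, s2]
  have s4 : ‖∑ p ∈ P \ (P1 ∪ P2), ee (t / q) p‖ ≤ P.card - P1.card - P2.card := by
    refine (norm_sum_le _ _).trans ?_
    simp_rw [ee_norm]
    rw [sum_const, nsmul_eq_mul, mul_one, card_sdiff_of_subset hsub,
      Nat.cast_sub (card_le_card hsub), card_union_of_disjoint hdisj]
    push_cast
    linarith
  set N : ℝ := κ * P.card with hN
  have hN0 : 0 ≤ N := by positivity
  have s5 : ‖(P1.card * ee (t / q) 1 + P2.card * ee (t / q) (-1) : ℂ)‖ ≤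
      N * w + (P1.card - N) + (P2.card - N) := by
    have : (P1.card * ee (t / q) 1 + P2.card * ee (t / q) (-1) : ℂ) =
      (N : ℂ) * (ee (t / q) 1 + ee (t / q) (-1)) + ((P1.card - N : ℝ) : ℂ) * ee (t / q) 1 +
      ((P2.card - N : ℝ) : ℂ) * ee (t / q) (-1) := by push_cast; ring
    rw [this]
    refine (norm_add₃_le).trans ?_
    rw [norm_mul, norm_mul, norm_mul, ee_norm, ee_norm, Complex.norm_real, Complex.norm_real,
      Complex.norm_real, Real.norm_of_nonneg hN0, Real.norm_of_nonneg (by linarith),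
      Real.norm_of_nonneg (by linarith)]
    linarith
  rw [s3]
  refine (norm_add_le _ _).trans ?_
  have : (1 - κ * (2 - w)) * P.card ≤ max 0 (1 - κ * (2 - w)) * P.card :=
    mul_le_mul_of_nonneg_right (le_max_right _ _) (Nat.cast_nonneg _)
  have e : (1 - κ * (2 - w)) * P.card = P.card - 2 * N + N * w := by rw [hN]; ring
  linarith

theorem low_GG (q : ℕ) (hq : 3 ≤ q) (t : ℤ) (ht : IsCoprime t (q : ℤ)) :
    ∃ s : ℝ, 0 ≤ s ∧ s < 1 ∧ ∀ H : ℕ, 0 < H → ∃ J : ℕ, ∀ j0 ≥ J, ∀ (k : ℕ) (Z : ℝ) (v : ℕ), 0 ≤ Z →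
    ‖∑ n ∈ GG H j0 k Z v, ee (t / q) (Astar n)‖ ≤ s ^ k * Z := by
  classical
  obtain ⟨s, hs0, hs1, hcell⟩ := low_cell q hq t ht
  refine ⟨s, hs0, hs1, fun H hH => ?_⟩
  have hH0 : (0:ℝ) < H := by exact_mod_cast hH
  have hρ : ∀ h : ℕ, 1 < cellLo H 0 (h + 1) / cellLo H 0 h := by
    intro h
    rw [one_lt_div (cellLo_pos _ _ _)]
    unfold cellLo
    gcongr
    exact Nat.lt_succ_self h
  choose z₀ hz using fun h => hcell _ (hρ h)
  have hev : ∀ᶠ j : ℕ in atTop, ∀ h ∈ range H, z₀ h ≤ (2:ℝ) ^ j := by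
    rw [eventually_all_finset]
    intro h _
    exact (tendsto_pow_atTop_atTop_of_one_lt (r := (2:ℝ)) (by norm_num)).eventually_ge_atTop (z₀ h)
  obtain ⟨J, hJ⟩ := eventually_atTop.1 hev
  refine ⟨J, fun j0 hj0 k Z v hZ => ?_⟩
  have key := GG_bound H j0 (t / q) (s) 1 (hs0) (by norm_num) ?_ k Z v hZ
  · refine key.trans ?_
    rw [one_pow, one_mul]
    exact mul_le_mul_of_nonneg_left (smooth_card_le hZ v) (pow_nonneg (hs0) k)
  · intro j hj Z hZ
    rw [one_mul]
    calc _ ≤ ∑ h ∈ range H, ∑ p ∈ cell H j h, s * ((smooth (Z / p) j).card : ℝ) := by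
          refine sum_le_sum fun h hh => ?_
          have e : cellLo H 0 (h + 1) / cellLo H 0 h * cellLo H j h = cellLo H j (h + 1) := by
            have := (cellLo_pos H 0 h).ne'
            rw [div_mul_eq_mul_div, div_eq_iff this]
            unfold cellLo; ring
          have h2 := hz h (cellLo H j h) ((hJ j (by omega) h hh).trans (cellLo_ge _ _ _))
          rw [e] at h2
          calc _ ≤ (s * (cell H j h).card) * ((smooth (Z / cellLo H j (h + 1)) j).card : ℝ) := by
                refine mul_le_mul_of_nonneg_right h2 (by positivity)
            _ = ∑ p ∈ cell H j h, s * ((smooth (Z / cellLo H j (h + 1)) j).card : ℝ) := by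
                rw [sum_const, nsmul_eq_mul]; ring
            _ ≤ _ := by
                refine sum_le_sum fun p hp => ?_
                refine mul_le_mul_of_nonneg_left ?_ (hs0)
                norm_cast
                apply card_le_card (smooth_mono _ _)
                obtain ⟨a1, a2, a3⟩ := mem_cell.1 hp
                have : (0:ℝ) < p := by exact_mod_cast a1.pos
                gcongr
      _ = s * ∑ h ∈ range H, ∑ p ∈ cell H j h, ((smooth (Z / p) j).card : ℝ) := by
          simp_rw [mul_sum]
      _ = s * ∑ p ∈ (range H).biUnion (cell H j), ((smooth (Z / p) j).card : ℝ) := by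
          rw [sum_biUnion]
          intro h hh h' hh' hne
          rw [Function.onFun, Finset.disjoint_left]
          intro n hn hn'
          exact hne (cell_unique hn hn')
      _ ≤ _ := by
          refine mul_le_mul_of_nonneg_left ?_ (hs0)
          refine sum_le_sum_of_subset_of_nonneg ?_ fun _ _ _ => by positivity
          intro p hp
          obtain ⟨h, hh, hp⟩ := mem_biUnion.1 hp
          exact mem_dyP.2 (cell_bounds (mem_range.1 hh) hp)

end D2

section D3
open Finset Filter Topology

theorem sum_le_of_inj {ι κ : Type*} [DecidableEq κ] (A : Finset ι) (B : Finset κ) (f : ι → ℝ) (g : κ → ℝ) (φ : ι → κ)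
    (maps : ∀ a ∈ A, φ a ∈ B) (inj : Set.InjOn φ A) (hg : ∀ b ∈ B, 0 ≤ g b) (h : ∀ a ∈ A, f a ≤ g (φ a)) :
    ∑ a ∈ A, f a ≤ ∑ b ∈ B, g b := by
  calc ∑ a ∈ A, f a ≤ ∑ a ∈ A, g (φ a) := sum_le_sum h
    _ = ∑ b ∈ A.image φ, g b := (sum_image inj).symm
    _ ≤ _ := sum_le_sum_of_subset_of_nonneg (image_subset_iff.2 maps) fun b hb _ => hg b hb

/-- primes up to `2^J` -/
def pr (J : ℕ) : Finset ℕ := (Ioc 0 (2 ^ J)).filter Nat.Prime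

theorem mem_pr {J p : ℕ} : p ∈ pr J ↔ p.Prime ∧ p ≤ 2 ^ J := by
  rw [pr, mem_filter, mem_Ioc]
  exact ⟨fun h => ⟨h.2, h.1.2⟩, fun h => ⟨⟨h.1.pos, h.2⟩, h.1⟩⟩

noncomputable def mert (J : ℕ) : ℝ := ∑ p ∈ pr J, (p : ℝ)⁻¹

theorem mert_nonneg (J : ℕ) : 0 ≤ mert J := sum_nonneg fun _ _ => by positivity

theorem mert_mono {J J' : ℕ} (h : J ≤ J') : mert J ≤ mert J' := by
  refine sum_le_sum_of_subset_of_nonneg ?_ fun _ _ _ => by positivity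
  intro p hp
  rw [mem_pr] at *
  exact ⟨hp.1, hp.2.trans (Nat.pow_le_pow_right (by norm_num) h)⟩

theorem dyP_inv (j : ℕ) (hj : 1 ≤ j) : ∑ p ∈ dyP j, (p : ℝ)⁻¹ ≤ 4 / j := by
  have hl2 : 0 < Real.log 2 := Real.log_pos (by norm_num)
  have hjp : (0:ℝ) < j := by exact_mod_cast hj
  have hden : (0:ℝ) < 2 ^ j * (j * Real.log 2) := by positivity
  calc ∑ p ∈ dyP j, (p : ℝ)⁻¹ ≤ ∑ p ∈ dyP j, Real.log p / (2 ^ j * (j * Real.log 2)) := by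
        refine sum_le_sum fun p hp => ?_
        obtain ⟨h1, h2, h3⟩ := mem_dyP.1 hp
        have h2' : (2:ℝ) ^ j ≤ p := by exact_mod_cast h2.le
        have hlog : j * Real.log 2 ≤ Real.log p := by
          rw [← Real.log_pow]; exact Real.log_le_log (by positivity) h2'
        have hpp : (0:ℝ) < p := by exact_mod_cast h1.pos
        rw [inv_eq_one_div, div_le_div_iff₀ hpp hden]
        calc 1 * (2 ^ j * (j * Real.log 2)) ≤ p * Real.log p := by
              rw [one_mul]; gcongr
          _ = _ := by ring
    _ = (∑ p ∈ dyP j, Real.log p) / (2 ^ j * (j * Real.log 2)) := by rw [sum_div]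
    _ ≤ (Chebyshev.theta (2 ^ (j + 1))) / (2 ^ j * (j * Real.log 2)) := by
        gcongr
        rw [Chebyshev.theta]
        refine sum_le_sum_of_subset_of_nonneg ?_ fun p hp _ => ?_
        · intro p hp
          obtain ⟨h1, h2, h3⟩ := mem_dyP.1 hp
          rw [mem_filter, mem_Ioc]
          refine ⟨⟨h1.pos, ?_⟩, h1⟩
          apply Nat.le_floor
          exact_mod_cast h3
        · exact Real.log_natCast_nonneg p
    _ ≤ (Real.log 4 * 2 ^ (j + 1)) / (2 ^ j * (j * Real.log 2)) := by
        gcongr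
        exact Chebyshev.theta_le_log4_mul_x (by positivity)
    _ = 4 / j := by
        rw [show (4:ℝ) = 2 ^ 2 by norm_num, Real.log_pow]
        field_simp
        norm_num
        ring

theorem mert_succ (J : ℕ) : mert (J + 1) = mert J + ∑ p ∈ dyP J, (p : ℝ)⁻¹ := by
  unfold mert
  rw [← sum_union]
  · congr 1
    ext p
    have : 2 ^ J ≤ 2 ^ (J + 1) := Nat.pow_le_pow_right (by norm_num) (by omega)
    rw [mem_union, mem_pr, mem_pr, mem_dyP]
    constructor
    · rintro ⟨h1, h2⟩
      by_cases h : p ≤ 2 ^ J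
      · exact Or.inl ⟨h1, h⟩
      · exact Or.inr ⟨h1, by omega, h2⟩
    · rintro (⟨h1, h2⟩ | ⟨h1, h2, h3⟩)
      · exact ⟨h1, by omega⟩
      · exact ⟨h1, h3⟩
  · rw [Finset.disjoint_left]
    intro p hp hp'
    have h1 := mem_pr.1 hp
    have h2 := mem_dyP.1 hp'
    omega

theorem mert_le (J : ℕ) (hJ : 1 ≤ J) : mert J ≤ 5 + 4 * Real.log J := by
  have h1 : mert 1 ≤ 1 := by
    have : pr 1 = {2} := by decide
    rw [mert, this]; norm_num
  have h2 : ∀ J, 1 ≤ J → mert J ≤ 1 + 4 * (harmonic (J - 1) : ℚ) := by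
    intro J hJ
    induction J, hJ using Nat.le_induction with
    | base => simpa using h1
    | succ J hJ ih =>
      rw [mert_succ]
      have := dyP_inv J hJ
      obtain ⟨J', rfl⟩ : ∃ J', J = J' + 1 := ⟨J - 1, by omega⟩
      simp only [Nat.add_sub_cancel] at ih ⊢
      rw [harmonic_succ]
      push_cast at this ih ⊢
      have e : (4:ℝ) / (J' + 1) = 4 * ((J':ℝ) + 1)⁻¹ := by ring
      linarith
  have h3 := h2 J hJ
  rcases eq_or_lt_of_le hJ with h | h
  · subst h; simp; linarith
  · have h4 := harmonic_le_one_add_log (J - 1)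
    have h5 : Real.log ((J - 1 : ℕ) : ℝ) ≤ Real.log J := Real.log_le_log (by exact_mod_cast (by omega : 0 < J - 1)) (by exact_mod_cast (by omega : J - 1 ≤ J))
    linarith

theorem smooth_inv_sum (J : ℕ) (T : Finset ℕ) (hT : ∀ n ∈ T, n ≠ 0 ∧ gp n ≤ 2 ^ J) (f : ℕ →* ℝ) (hf : ∀ n, 0 ≤ f n) (c : ℝ)
    (hc : ∀ p, p.Prime → p ≤ 2 ^ J → f p ≤ c / p) (h34 : ∀ p, p.Prime → f p ≤ 3 / 4) :
    ∑ n ∈ T, f n ≤ Real.exp (4 * c * mert J) := by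
  have h1 : ∀ p : ℕ, p.Prime → f p < 1 := fun p hp => (h34 p hp).trans_lt (by norm_num)
  refine (euler_le f hf h1 (pr J) T ?_).trans ?_
  · intro n hn
    refine ⟨(hT n hn).1, fun p hp hd => mem_pr.2 ⟨hp, (le_gp (hT n hn).1 hp hd).trans (hT n hn).2⟩⟩
  · rw [mert, mul_sum, Real.exp_sum]
    have : (pr J).filter Nat.Prime = pr J := filter_true_of_mem fun p hp => (mem_pr.1 hp).1
    rw [this]
    refine prod_le_prod (fun p hp => ?_) fun p hp => ?_
    · have := h1 p (mem_pr.1 hp).1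
      exact inv_nonneg.2 (by linarith)
    · obtain ⟨hp1, hp2⟩ := mem_pr.1 hp
      have a := hc p hp1 hp2
      have b := h34 p hp1
      have hfp := hf p
      calc (1 - f p)⁻¹ ≤ 1 + 4 * f p := by
            rw [inv_le_iff_one_le_mul₀ (by linarith)]
            nlinarith
        _ ≤ Real.exp (4 * f p) := by linarith [Real.add_one_le_exp (4 * f p)]
        _ ≤ _ := by
            apply Real.exp_le_exp.2
            rw [div_eq_mul_inv] at a
            linarith

theorem exp_mert {c : ℝ} (hc : 0 ≤ c) (J : ℕ) (hJ : 1 ≤ J) : Real.exp (c * mert J) ≤ Real.exp (5 * c) * (J:ℝ) ^ (4 * c) := by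
  have hJp : (0:ℝ) < J := by exact_mod_cast hJ
  rw [Real.rpow_def_of_pos hJp, ← Real.exp_add]
  apply Real.exp_le_exp.2
  nlinarith [mert_le J hJ]

end D3

section D4
open Finset Filter Topology

noncomputable def rpowHom (s : ℝ) (hs : s ≠ 0) : ℕ →* ℝ where
  toFun n := (n : ℝ) ^ s
  map_one' := by simp
  map_mul' m n := by
    push_cast
    exact Real.mul_rpow (by positivity) (by positivity)

theorem rankin (x : ℝ) (hx : 1 ≤ x) (v : ℕ) (hv : 3 ≤ v) :
    ((smooth x v).card : ℝ) ≤ √x + x * Real.exp (-(Real.log x / (2 * (v * Real.log 2)))) * (Real.exp 60 * (v:ℝ) ^ (48:ℝ)) := by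
  have hl2 : (0.6931471803 : ℝ) < Real.log 2 := Real.log_two_gt_d9
  have hv0 : (0:ℝ) < v := by exact_mod_cast (by omega : 0 < v)
  have hv3 : (3:ℝ) ≤ v := by exact_mod_cast hv
  have hl2p : 0 < Real.log 2 := by linarith
  have hx0 : 0 < x := by linarith
  set σ : ℝ := 1 / (v * Real.log 2) with hσ
  have hσ0 : 0 < σ := by positivity
  have hσ1 : σ ≤ 1 / 2 := by
    rw [hσ]
    apply one_div_le_one_div_of_le (by norm_num)
    nlinarith
  have hE : ∑ n ∈ smooth x v, rpowHom (σ - 1) (by linarith) n ≤ Real.exp (4 * 3 * mert v) := by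
    apply smooth_inv_sum
    · intro n hn
      obtain ⟨h1, h2, h3⟩ := mem_smooth.1 hn
      exact ⟨h1, Finset.sup_le fun r hr => h3 r (Nat.prime_of_mem_primeFactors hr) (Nat.dvd_of_mem_primeFactors hr)⟩
    · intro n
      change 0 ≤ (n:ℝ) ^ (σ - 1)
      positivity
    · intro p hp hpv
      change (p:ℝ) ^ (σ - 1) ≤ 3 / p
      have hp0 : (0:ℝ) < p := by exact_mod_cast hp.pos
      rw [Real.rpow_sub_one hp0.ne']
      gcongr
      calc (p:ℝ) ^ σ ≤ ((2:ℝ) ^ v) ^ σ := by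
            apply Real.rpow_le_rpow hp0.le _ hσ0.le
            exact_mod_cast hpv
        _ = Real.exp 1 := by
            rw [Real.rpow_def_of_pos (by positivity), Real.log_pow, hσ]
            congr 1
            field_simp
        _ ≤ 3 := by linarith [Real.exp_one_lt_d9]
    · intro p hp
      change (p:ℝ) ^ (σ - 1) ≤ 3 / 4
      have hp2 : (2:ℝ) ≤ p := by exact_mod_cast hp.two_le
      calc (p:ℝ) ^ (σ - 1) ≤ (2:ℝ) ^ (σ - 1) := by
            apply Real.rpow_le_rpow_of_nonpos (by norm_num) hp2 (by linarith)
        _ ≤ (2:ℝ) ^ (-(1/2) : ℝ) := by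
            apply Real.rpow_le_rpow_of_exponent_le (by norm_num) (by linarith)
        _ ≤ 3 / 4 := by
            rw [Real.rpow_neg (by norm_num), ← Real.sqrt_eq_rpow, inv_le_comm₀ (by positivity) (by norm_num)]
            apply Real.le_sqrt_of_sq_le
            norm_num
  have hE2 : Real.exp (4 * 3 * mert v) ≤ Real.exp 60 * (v:ℝ) ^ (48:ℝ) := by
    have := exp_mert (c := 12) (by norm_num) v (by omega)
    norm_num at this ⊢
    exact this
  have hsplit : ((smooth x v).card : ℝ) ≤ ∑ n ∈ smooth x v, ((if (n:ℝ) ≤ √x then 1 else 0) + x ^ (1 - σ / 2) * (n:ℝ) ^ (σ - 1)) := by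
    rw [card_eq_sum_ones]
    push_cast
    refine sum_le_sum fun n hn => ?_
    obtain ⟨h1, h2, h3⟩ := mem_smooth.1 hn
    have hn0 : (0:ℝ) < n := by exact_mod_cast Nat.pos_of_ne_zero h1
    split_ifs with h
    · have : 0 ≤ x ^ (1 - σ / 2) * (n:ℝ) ^ (σ - 1) := by positivity
      linarith
    · rw [not_le] at h
      rw [zero_add]
      have e1 : (√x) ^ σ ≤ (n:ℝ) ^ σ := Real.rpow_le_rpow (by positivity) h.le hσ0.le
      have e2 : (√x) ^ σ = x ^ (σ / 2) := by
        rw [Real.sqrt_eq_rpow, ← Real.rpow_mul hx0.le]; congr 1; ring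
      rw [e2] at e1
      rw [Real.rpow_sub_one hn0.ne', Real.rpow_sub hx0, Real.rpow_one]
      have e3 : 0 < x ^ (σ / 2) := by positivity
      rw [div_mul_div_comm, le_div_iff₀ (by positivity)]
      rw [one_mul, mul_comm]
      exact mul_le_mul h2 e1 e3.le hx0.le
  refine hsplit.trans ?_
  rw [sum_add_distrib]
  apply add_le_add
  · rw [← sum_filter, sum_const, nsmul_eq_mul, mul_one]
    have : ((smooth x v).filter fun n : ℕ => (n:ℝ) ≤ √x) ⊆ Ioc 0 ⌊√x⌋₊ := by
      intro n hn
      obtain ⟨h1, h2⟩ := mem_filter.1 hn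
      rw [mem_Ioc]
      exact ⟨Nat.pos_of_ne_zero (mem_smooth.1 h1).1, Nat.le_floor h2⟩
    have h2 := card_le_card this
    rw [Nat.card_Ioc, Nat.sub_zero] at h2
    exact (Nat.cast_le.2 h2).trans (Nat.floor_le (by positivity))
  · rw [← mul_sum]
    have e : x * Real.exp (-(Real.log x / (2 * (v * Real.log 2)))) = x ^ (1 - σ / 2) := by
      rw [Real.rpow_sub hx0, Real.rpow_one, Real.rpow_def_of_pos hx0, div_eq_mul_inv x, ← Real.exp_neg]
      congr 2
      rw [hσ]; ring
    rw [e]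
    gcongr
    exact hE.trans hE2

theorem sum_sub_union {A B C : Finset ℕ} (h : A ⊆ B ∪ C) (f : ℕ → ℝ) (hf : ∀ n, 0 ≤ f n) :
    ∑ n ∈ A, f n ≤ ∑ n ∈ B, f n + ∑ n ∈ C, f n := by
  rw [← sum_union_inter]
  exact (sum_le_sum_of_subset_of_nonneg h fun n _ _ => hf n).trans
    (le_add_of_nonneg_right (sum_nonneg fun n _ => hf n))

/-- some of the first `k` prime factors is `≤ y` -/
def lowP (y : ℕ) : ℕ → ℕ → Prop
  | 0, _ => False
  | k + 1, n => gp n ≤ y ∨ lowP y k (n / gp n)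

def closeP (y n : ℕ) : Prop := ∃ p r : ℕ, p.Prime ∧ r.Prime ∧ y < p ∧ r ≤ p ∧ p < 2 * r ∧ p * r ∣ n

theorem not_good (y k : ℕ) : ∀ n, n ≠ 0 → ¬ good y k n → lowP y k n ∨ closeP y n := by
  induction k with
  | zero => intro n _ h; exact absurd trivial h
  | succ k ih =>
    intro n hn h
    simp only [good, not_and_or, not_lt] at h
    rcases Nat.lt_or_ge y (gp n) with hy | hy
    · have hn2 : 2 ≤ n := by
        by_contra hlt
        have : n = 1 := by omega
        rw [this, gp_one] at hy
        exact absurd hy (Nat.not_lt_zero _)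
      obtain ⟨m, hm0, hnm, hdiv, hgm, _⟩ := gp_decomp hn2
      rw [hdiv] at h
      rcases h with h | h | h
      · omega
      · right
        have hg0 : 0 < gp m := by omega
        have hm2 : 2 ≤ m := by
          by_contra hlt
          have : m = 1 := by omega
          rw [this, gp_one] at hg0
          omega
        exact ⟨gp n, gp m, gp_prime hn2, gp_prime hm2, hy, hgm, by omega, by
          conv_rhs => rw [hnm]
          exact mul_dvd_mul_left _ (gp_dvd hm2)⟩
      · rcases ih m hm0 h with h1 | ⟨p, r, h1, h2, h3, h4, h5, h6⟩
        · left; right; rw [hdiv]; exact h1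
        · right
          exact ⟨p, r, h1, h2, h3, h4, h5, h6.trans ⟨gp n, by rw [mul_comm]; exact hnm⟩⟩
    · left; left; exact hy

open Classical in
theorem lowP_sum (N J j0 : ℕ) (hN : N ≤ 2 ^ J) (hj : 1 ≤ j0) (k : ℕ) :
    ∑ m ∈ (Ioc 0 N).filter (lowP (2 ^ j0) k), (m : ℝ)⁻¹ ≤ Real.exp 20 * (j0:ℝ) ^ (16:ℝ) * (1 + mert J) ^ k := by
  have hE : ∑ m ∈ (Ioc 0 N).filter (fun m => gp m ≤ 2 ^ j0), (m : ℝ)⁻¹ ≤ Real.exp 20 * (j0:ℝ) ^ (16:ℝ) := by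
    have h1 := smooth_inv_sum j0 ((Ioc 0 N).filter (fun m => gp m ≤ 2 ^ j0)) (fun n hn => by
      rw [mem_filter, mem_Ioc] at hn
      exact ⟨by omega, hn.2⟩) invHom (fun n => by change 0 ≤ (n:ℝ)⁻¹; positivity) 1 (fun p hp _ => by
        change (p:ℝ)⁻¹ ≤ 1 / p
        rw [one_div]) (fun p hp => by
        change (p:ℝ)⁻¹ ≤ 3 / 4
        have hp2 : (2:ℝ) ≤ p := by exact_mod_cast hp.two_le
        rw [inv_le_comm₀ (by positivity) (by norm_num)]
        linarith)
    have h2 := exp_mert (c := 4) (by norm_num) j0 hj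
    norm_num at h1 h2 ⊢
    exact h1.trans h2
  set E := Real.exp 20 * (j0:ℝ) ^ (16:ℝ) with hEdef
  have hE0 : 0 ≤ E := by positivity
  have hm0 := mert_nonneg J
  induction k with
  | zero =>
    have : (Ioc 0 N).filter (lowP (2 ^ j0) 0) = ∅ := filter_eq_empty_iff.2 fun m _ h => h
    rw [this, sum_empty]
    positivity
  | succ k ih =>
    have hsub : (Ioc 0 N).filter (lowP (2 ^ j0) (k + 1)) ⊆ (Ioc 0 N).filter (fun m => gp m ≤ 2 ^ j0) ∪
        (Ioc 0 N).filter (fun m => 2 ≤ m ∧ lowP (2 ^ j0) k (m / gp m)) := by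
      intro m hm
      rw [mem_filter] at hm
      rw [mem_union, mem_filter, mem_filter]
      rcases hm.2 with h | h
      · exact Or.inl ⟨hm.1, h⟩
      · rcases Nat.lt_or_ge m 2 with h2 | h2
        · left
          have : m = 1 := by have := mem_Ioc.1 hm.1; omega
          refine ⟨hm.1, ?_⟩
          rw [this, gp_one]; exact Nat.zero_le _
        · exact Or.inr ⟨hm.1, h2, h⟩
    have h2 : ∑ m ∈ (Ioc 0 N).filter (fun m => 2 ≤ m ∧ lowP (2 ^ j0) k (m / gp m)), (m : ℝ)⁻¹
        ≤ ∑ b ∈ (pr J) ×ˢ (Ioc 0 N).filter (lowP (2 ^ j0) k), (b.1 : ℝ)⁻¹ * (b.2 : ℝ)⁻¹ := by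
      apply sum_le_of_inj _ _ _ _ (fun m => (gp m, m / gp m))
      · intro m hm
        rw [mem_filter, mem_Ioc] at hm
        obtain ⟨⟨h1, h2⟩, h3, h4⟩ := hm
        obtain ⟨m', hm0, hnm, hdiv, hgm, _⟩ := gp_decomp h3
        rw [mem_product, mem_pr, mem_filter, mem_Ioc]
        refine ⟨⟨gp_prime h3, ?_⟩, ⟨?_, ?_⟩, h4⟩
        · exact ((Nat.le_of_dvd h1 (gp_dvd h3)).trans h2).trans hN
        · change 0 < m / gp m
          rw [hdiv]; omega
        · exact (Nat.div_le_self _ _).trans h2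
      · intro m hm m' hm' heq
        rw [mem_coe, mem_filter] at hm hm'
        obtain ⟨h1, h2⟩ := Prod.mk.inj heq
        calc m = gp m * (m / gp m) := (Nat.mul_div_cancel' (gp_dvd hm.2.1)).symm
          _ = gp m' * (m' / gp m') := by rw [h2, h1]
          _ = m' := Nat.mul_div_cancel' (gp_dvd hm'.2.1)
      · intro b _; positivity
      · intro m hm
        rw [mem_filter] at hm
        simp only
        rw [← mul_inv]
        norm_cast
        rw [Nat.mul_div_cancel' (gp_dvd hm.2.1)]
    rw [sum_product] at h2
    simp only at h2
    rw [← sum_mul_sum] at h2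
    calc _ ≤ _ := sum_sub_union hsub (fun n => (n:ℝ)⁻¹) fun _ => by positivity
      _ ≤ E + mert J * (E * (1 + mert J) ^ k) := by
          apply add_le_add hE
          refine h2.trans ?_
          exact mul_le_mul_of_nonneg_left ih hm0
      _ ≤ _ := by
          have : 1 ≤ (1 + mert J) ^ k := one_le_pow₀ (by linarith)
          rw [pow_succ]
          nlinarith

open Classical in
theorem closeP_sum (N J j0 : ℕ) (hN : N ≤ 2 ^ J) (hj : 2 ≤ j0) :
    ∑ m ∈ (Ioc 0 N).filter (closeP (2 ^ j0)), (m : ℝ)⁻¹ ≤ mert J * (8 / (j0 - 1)) * (1 + Real.log N) := by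
  have hr : ∀ p ∈ (pr J).filter (fun p => 2 ^ j0 < p), ∑ r ∈ (pr J).filter (fun r => r ≤ p ∧ p < 2 * r), (r:ℝ)⁻¹ ≤ 8 / (j0 - 1) := by
    intro p hp
    rw [mem_filter, mem_pr] at hp
    obtain ⟨j, h1, h2⟩ := exists_dyad hp.1.1.two_le
    have hjj : j0 < j + 1 := (Nat.pow_lt_pow_iff_right (a := 2) (by norm_num)).1 (hp.2.trans_le h2)
    have hsub : (pr J).filter (fun r => r ≤ p ∧ p < 2 * r) ⊆ dyP (j - 1) ∪ dyP j := by
      intro r hr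
      rw [mem_filter, mem_pr] at hr
      rw [mem_union, mem_dyP, mem_dyP, Nat.sub_add_cancel (by omega)]
      have e : 2 ^ j = 2 * 2 ^ (j - 1) := by
        conv_lhs => rw [show j = (j - 1) + 1 by omega, pow_succ]
        ring
      by_cases h : r ≤ 2 ^ j
      · exact Or.inl ⟨hr.1.1, by omega, h⟩
      · exact Or.inr ⟨hr.1.1, by omega, by omega⟩
    have hj0 : (2:ℝ) ≤ j0 := by exact_mod_cast hj
    have hjc : (j0:ℝ) ≤ j := by exact_mod_cast (by omega : j0 ≤ j)
    calc _ ≤ _ := sum_sub_union hsub (fun n => (n:ℝ)⁻¹) fun _ => by positivity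
      _ ≤ 4 / ((j - 1 : ℕ) : ℝ) + 4 / j := add_le_add (dyP_inv _ (by omega)) (dyP_inv _ (by omega))
      _ ≤ 4 / (j0 - 1) + 4 / (j0 - 1) := by
          rw [Nat.cast_sub (by omega)]
          push_cast
          have : (0:ℝ) < j0 - 1 := by linarith
          gcongr
          linarith
      _ = _ := by ring
  have hj0 : (2:ℝ) ≤ j0 := by exact_mod_cast hj
  have hj1 : (0:ℝ) < j0 - 1 := by linarith
  set B := ((pr J).filter (fun p => 2 ^ j0 < p)).sigma fun p => (pr J).filter (fun r => r ≤ p ∧ p < 2 * r) with hB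
  have hch : ∀ m : ℕ, ∃ p r : ℕ, closeP (2 ^ j0) m → p.Prime ∧ r.Prime ∧ 2 ^ j0 < p ∧ r ≤ p ∧ p < 2 * r ∧ p * r ∣ m := by
    intro m
    by_cases h : closeP (2 ^ j0) m
    · obtain ⟨p, r, h'⟩ := h
      exact ⟨p, r, fun _ => h'⟩
    · exact ⟨0, 0, fun h' => absurd h' h⟩
  choose P R hPR using hch
  have h1 : ∑ m ∈ (Ioc 0 N).filter (closeP (2 ^ j0)), (m : ℝ)⁻¹ ≤
      ∑ b ∈ B ×ˢ (Ioc 0 N), ((b.1.1 : ℝ)⁻¹ * (b.1.2 : ℝ)⁻¹) * (b.2 : ℝ)⁻¹ := by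
    apply sum_le_of_inj _ _ _ _ (fun m => ((⟨P m, R m⟩ : Σ _ : ℕ, ℕ), m / (P m * R m)))
    · intro m hm
      rw [mem_filter, mem_Ioc] at hm
      obtain ⟨⟨h1, h2⟩, h3⟩ := hm
      obtain ⟨a1, a2, a3, a4, a5, a6⟩ := hPR m h3
      have b1 : P m ≤ 2 ^ J := ((Nat.le_of_dvd h1 ((dvd_mul_right _ _).trans a6)).trans h2).trans hN
      rw [mem_product, hB, mem_sigma, mem_filter, mem_filter, mem_pr, mem_pr, mem_Ioc]
      refine ⟨⟨⟨⟨a1, b1⟩, a3⟩, ⟨a2, a4.trans b1⟩, a4, a5⟩, ?_, (Nat.div_le_self _ _).trans h2⟩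
      exact Nat.div_pos (Nat.le_of_dvd h1 a6) (Nat.mul_pos a1.pos a2.pos)
    · intro m hm m' hm' heq
      rw [mem_coe, mem_filter] at hm hm'
      obtain ⟨h1, h2⟩ := Prod.mk.inj heq
      have h3 : P m = P m' := congrArg Sigma.fst h1
      have h4 : R m = R m' := congrArg Sigma.snd h1
      have d := (hPR m hm.2).2.2.2.2.2
      have d' := (hPR m' hm'.2).2.2.2.2.2
      calc m = P m * R m * (m / (P m * R m)) := (Nat.mul_div_cancel' d).symm
        _ = P m' * R m' * (m' / (P m' * R m')) := by rw [h2, h3, h4]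
        _ = m' := Nat.mul_div_cancel' d'
    · intro b _; positivity
    · intro m hm
      rw [mem_filter] at hm
      have d := (hPR m hm.2).2.2.2.2.2
      simp only
      rw [← mul_inv, ← mul_inv]
      norm_cast
      rw [Nat.mul_div_cancel' d]
  rw [sum_product] at h1
  have hharm : ∑ i ∈ Ioc 0 N, (i:ℝ)⁻¹ ≤ 1 + Real.log N := by
    have := harmonic_le_one_add_log N
    rw [harmonic_eq_sum_Icc] at this
    push_cast at this
    exact this
  have hlogN : 0 ≤ 1 + Real.log N := by
    have := Real.log_natCast_nonneg N
    linarith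
  calc _ ≤ _ := h1
    _ = (∑ p ∈ (pr J).filter (fun p => 2 ^ j0 < p), (p:ℝ)⁻¹ * ∑ r ∈ (pr J).filter (fun r => r ≤ p ∧ p < 2 * r), (r:ℝ)⁻¹) * ∑ i ∈ Ioc 0 N, (i:ℝ)⁻¹ := by
        simp_rw [← mul_sum]
        rw [← sum_mul, hB, sum_sigma]
        simp_rw [← mul_sum]
    _ ≤ (∑ p ∈ (pr J).filter (fun p => 2 ^ j0 < p), (p:ℝ)⁻¹ * (8 / (j0 - 1))) * (1 + Real.log N) := by
        refine mul_le_mul ?_ hharm (sum_nonneg fun _ _ => by positivity) (sum_nonneg fun _ _ => by positivity)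
        refine sum_le_sum fun p hp => ?_
        exact mul_le_mul_of_nonneg_left (hr p hp) (by positivity)
    _ ≤ _ := by
        rw [← sum_mul]
        gcongr
        exact sum_le_sum_of_subset_of_nonneg (filter_subset _ _) fun _ _ _ => by positivity

end D4

section D5
open Finset Filter Topology

theorem fib_count (q : ℕ) (a : ZMod q) (S M : Finset ℕ) (T : ℕ → Finset ℕ) (B : ℕ → ℝ)
    (hS : ∀ n ∈ S, 2 ≤ n ∧ ((Astar n : ℤ) : ZMod q) = a) (hM : ∀ n ∈ S, n / gp n ∈ M)
    (hT : ∀ n ∈ S, gp n ∈ T (n / gp n)) (hB0 : ∀ m ∈ M, 0 ≤ B m)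
    (hB : ∀ n ∈ S, (((T (n / gp n)).filter fun p : ℕ => (p : ZMod q) = a + ((Astar (n / gp n) : ℤ) : ZMod q)).card : ℝ) ≤ B (n / gp n)) :
    (S.card : ℝ) ≤ ∑ m ∈ M, B m := by
  rw [card_eq_sum_card_fiberwise (f := fun n => n / gp n) (t := M) hM]
  push_cast
  refine sum_le_sum fun m hm => ?_
  rcases (S.filter fun n => n / gp n = m).eq_empty_or_nonempty with h | ⟨n0, hn0⟩
  · rw [h]; simpa using hB0 m hm
  · rw [mem_filter] at hn0
    have h1 := hB n0 hn0.1
    rw [hn0.2] at h1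
    refine le_trans ?_ h1
    norm_cast
    apply card_le_card_of_injOn gp
    · intro n hn
      rw [mem_coe, mem_filter] at hn
      obtain ⟨hn2, ha⟩ := hS n hn.1
      obtain ⟨m', hm0, hnm, hdiv, hgm, hA⟩ := gp_decomp hn2
      rw [mem_coe, mem_filter]
      refine ⟨by rw [← hn.2]; exact hT n hn.1, ?_⟩
      rw [← ha, hA, ← hn.2, hdiv]
      push_cast; ring
    · intro n hn n' hn' heq
      rw [mem_coe, mem_filter] at hn hn'
      calc n = gp n * (n / gp n) := (Nat.mul_div_cancel' (gp_dvd (hS n hn.1).1)).symm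
        _ = gp n' * (n' / gp n') := by rw [hn.2, hn'.2, heq]
        _ = n' := Nat.mul_div_cancel' (gp_dvd (hS n' hn'.1).1)

theorem two_le_of_gp {n y : ℕ} (hn : n ≠ 0) (h : y < gp n) : 2 ≤ n := by
  by_contra hlt
  have : n = 1 := by omega
  rw [this, gp_one] at h
  exact absurd h (Nat.not_lt_zero _)

theorem mid_count : ∃ X₀ : ℝ, ∀ v : ℕ, X₀ ≤ 2 ^ v → 1 ≤ v → ∀ q : ℕ, 0 < q → (q:ℝ) ≤ ((2:ℝ) ^ v) ^ (1/20 : ℝ) →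
    ∀ (a : ZMod q) (x : ℝ) (S M : Finset ℕ), 0 ≤ x →
    (∀ n ∈ S, n ≠ 0 ∧ (n:ℝ) ≤ x ∧ 2 ^ v < gp n ∧ ((Astar n : ℤ) : ZMod q) = a) → (∀ n ∈ S, n / gp n ∈ M) →
    (S.card : ℝ) ≤ 68 * x / (Nat.totient q * (v * Real.log 2)) * ∑ m ∈ M, (m:ℝ)⁻¹ := by
  obtain ⟨X₀, hX⟩ := bt_long
  refine ⟨X₀, fun v hv hv1 q hq hqv a x S M hx hS hM => ?_⟩
  have hl2 : 0 < Real.log 2 := Real.log_pos (by norm_num)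
  have hφ : (0:ℝ) < Nat.totient q := by exact_mod_cast Nat.totient_pos.2 hq
  have hvp : (0:ℝ) < v := by exact_mod_cast hv1
  rw [mul_sum]
  apply fib_count q a S M (fun m => primesIoc 0 (x / m))
  · intro n hn
    obtain ⟨h1, h2, h3, h4⟩ := hS n hn
    exact ⟨two_le_of_gp h1 h3, h4⟩
  · exact hM
  · intro n hn
    obtain ⟨h1, h2, h3, h4⟩ := hS n hn
    have hn2 := two_le_of_gp h1 h3
    obtain ⟨m, hm0, hnm, hdiv, hgm, _⟩ := gp_decomp hn2
    have hmp : (0:ℝ) < m := by exact_mod_cast Nat.pos_of_ne_zero hm0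
    rw [mem_primesIoc le_rfl, hdiv, le_div_iff₀ hmp]
    refine ⟨gp_prime hn2, by exact_mod_cast (gp_prime hn2).pos, ?_⟩
    rw [← Nat.cast_mul, ← hnm]; exact h2
  · intro m _; positivity
  · intro n hn
    obtain ⟨h1, h2, h3, h4⟩ := hS n hn
    have hn2 := two_le_of_gp h1 h3
    obtain ⟨m, hm0, hnm, hdiv, hgm, _⟩ := gp_decomp hn2
    rw [hdiv]
    have hmp : (0:ℝ) < m := by exact_mod_cast Nat.pos_of_ne_zero hm0
    have hX2 : (2:ℝ) ^ v ≤ x / m := by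
      rw [le_div_iff₀ hmp]
      calc (2:ℝ) ^ v * m ≤ gp n * m := by
            gcongr
            exact_mod_cast h3.le
        _ ≤ x := by rw [← Nat.cast_mul, ← hnm]; exact h2
    have hXp : 0 < x / m := lt_of_lt_of_le (by positivity) hX2
    have hlog : v * Real.log 2 ≤ Real.log (x / m) := by
      rw [← Real.log_pow]; exact Real.log_le_log (by positivity) hX2
    refine (hX (x / m) (hv.trans hX2) q hq (hqv.trans ?_) _).trans ?_
    · apply Real.rpow_le_rpow (by positivity) hX2 (by norm_num)
    · calc 68 * (x / m) / (Nat.totient q * Real.log (x / m)) ≤ 68 * (x / m) / (Nat.totient q * (v * Real.log 2)) := by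
            gcongr
        _ = _ := by ring

theorem top_count : ∃ X₀ : ℝ, ∀ v : ℕ, X₀ ≤ 2 ^ v → 1 ≤ v → ∀ q : ℕ, 0 < q → (q:ℝ) ≤ ((2:ℝ) ^ v) ^ (1/20 : ℝ) →
    ∀ (a : ZMod q) (x : ℝ) (S : Finset ℕ) (J : ℕ), 0 ≤ x → x ≤ 2 ^ J →
    (∀ n ∈ S, n ≠ 0 ∧ (n:ℝ) ≤ x ∧ 2 ^ v < gp n ∧ ((Astar n : ℤ) : ZMod q) = a) → (∀ n ∈ S, gp n < 2 * gp (n / gp n)) →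
    (S.card : ℝ) ≤ 136 * x / (Nat.totient q * (v * Real.log 2)) * mert J := by
  classical
  obtain ⟨X₀, hX⟩ := bt_long
  refine ⟨X₀, fun v hv hv1 q hq hqv a x S J hx hxJ hS hclose => ?_⟩
  have hl2 : 0 < Real.log 2 := Real.log_pos (by norm_num)
  have hφ : (0:ℝ) < Nat.totient q := by exact_mod_cast Nat.totient_pos.2 hq
  have hvp : (0:ℝ) < v := by exact_mod_cast hv1
  set M := (Ioc 0 ⌊x⌋₊).filter fun m : ℕ => 2 ≤ m ∧ ((gp m * m : ℕ) : ℝ) ≤ x with hMdef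
  have hdec : ∀ n ∈ S, ∃ m, 2 ≤ m ∧ n = gp n * m ∧ n / gp n = m ∧ gp m ≤ gp n := by
    intro n hn
    obtain ⟨h1, h2, h3, h4⟩ := hS n hn
    obtain ⟨m, hm0, hnm, hdiv, hgm, _⟩ := gp_decomp (two_le_of_gp h1 h3)
    refine ⟨m, ?_, hnm, hdiv, hgm⟩
    have := hclose n hn
    rw [hdiv] at this
    exact two_le_of_gp hm0 (show 0 < gp m by omega)
  have h1 : (S.card : ℝ) ≤ ∑ m ∈ M, 136 / (Nat.totient q * (v * Real.log 2)) * (gp m : ℝ) := by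
    apply fib_count q a S M (fun m => primesIoc 0 ((2 * gp m : ℕ) : ℝ))
    · intro n hn
      obtain ⟨h1, h2, h3, h4⟩ := hS n hn
      exact ⟨two_le_of_gp h1 h3, h4⟩
    · intro n hn
      obtain ⟨h1, h2, h3, h4⟩ := hS n hn
      obtain ⟨m, hm2, hnm, hdiv, hgm⟩ := hdec n hn
      have hle : gp m * m ≤ n := by
        conv_rhs => rw [hnm]
        exact Nat.mul_le_mul_right _ hgm
      rw [hdiv, hMdef, mem_filter, mem_Ioc]
      refine ⟨⟨by omega, Nat.le_floor (le_trans ?_ h2)⟩, hm2, le_trans ?_ h2⟩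
      · have : m ≤ n := by rw [← hdiv]; exact Nat.div_le_self _ _
        exact_mod_cast this
      · exact_mod_cast hle
    · intro n hn
      obtain ⟨h1, h2, h3, h4⟩ := hS n hn
      have hn2 := two_le_of_gp h1 h3
      rw [mem_primesIoc le_rfl]
      refine ⟨gp_prime hn2, by exact_mod_cast (gp_prime hn2).pos, ?_⟩
      exact_mod_cast (hclose n hn).le
    · intro m _; positivity
    · intro n hn
      obtain ⟨h1, h2, h3, h4⟩ := hS n hn
      have hc := hclose n hn
      have hX2 : (2:ℝ) ^ v ≤ ((2 * gp (n / gp n) : ℕ) : ℝ) := by exact_mod_cast (h3.trans hc).le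
      have hlog : v * Real.log 2 ≤ Real.log ((2 * gp (n / gp n) : ℕ) : ℝ) := by
        rw [← Real.log_pow]; exact Real.log_le_log (by positivity) hX2
      refine (hX _ (hv.trans hX2) q hq (hqv.trans ?_) _).trans ?_
      · apply Real.rpow_le_rpow (by positivity) hX2 (by norm_num)
      · calc 68 * ((2 * gp (n / gp n) : ℕ) : ℝ) / (Nat.totient q * Real.log ((2 * gp (n / gp n) : ℕ) : ℝ))
              ≤ 68 * ((2 * gp (n / gp n) : ℕ) : ℝ) / (Nat.totient q * (v * Real.log 2)) := by
              gcongr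
          _ = _ := by push_cast; ring
  rw [← mul_sum] at h1
  have h2 : ∑ m ∈ M, (gp m : ℝ) ≤ ∑ b ∈ (pr J).sigma fun r => Ioc 0 ⌊x / (r * r : ℕ)⌋₊, (b.1 : ℝ) := by
    apply sum_le_of_inj _ _ _ _ (fun m => (⟨gp m, m / gp m⟩ : Σ _ : ℕ, ℕ))
    · intro m hm
      rw [hMdef, mem_filter, mem_Ioc] at hm
      obtain ⟨⟨h1, h2⟩, h3, h4⟩ := hm
      obtain ⟨m', hm0, hnm, hdiv, hgm, _⟩ := gp_decomp h3
      have hp := gp_prime h3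
      rw [mem_sigma, mem_pr, mem_Ioc]
      refine ⟨⟨hp, ?_⟩, ?_, ?_⟩
      · have a1 : gp m ≤ m := Nat.le_of_dvd h1 (gp_dvd h3)
        have a2 : (m:ℝ) ≤ x := (Nat.le_floor_iff hx).1 h2
        have a3 : (m:ℝ) ≤ 2 ^ J := a2.trans hxJ
        have a4 : m ≤ 2 ^ J := by exact_mod_cast a3
        exact a1.trans a4
      · change 0 < m / gp m
        rw [hdiv]; omega
      · change m / gp m ≤ _
        rw [hdiv]
        apply Nat.le_floor
        have hpp : (0:ℝ) < ((gp m * gp m : ℕ) : ℝ) := by exact_mod_cast Nat.mul_pos hp.pos hp.pos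
        rw [le_div_iff₀ hpp]
        refine le_trans (le_of_eq ?_) h4
        rw [← Nat.cast_mul]
        congr 1
        calc m' * (gp m * gp m) = gp m * (gp m * m') := by ring
          _ = gp m * m := by rw [← hnm]
    · intro m hm m' hm' heq
      rw [mem_coe, hMdef, mem_filter] at hm hm'
      have h3 : gp m = gp m' := congrArg Sigma.fst heq
      have h4 : m / gp m = m' / gp m' := congrArg Sigma.snd heq
      calc m = gp m * (m / gp m) := (Nat.mul_div_cancel' (gp_dvd hm.2.1)).symm
        _ = gp m' * (m' / gp m') := by rw [h4, h3]
        _ = m' := Nat.mul_div_cancel' (gp_dvd hm'.2.1)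
    · intro b _; positivity
    · intro m _; exact le_rfl
  have h3 : ∑ b ∈ (pr J).sigma fun r => Ioc 0 ⌊x / (r * r : ℕ)⌋₊, (b.1 : ℝ) ≤ x * mert J := by
    rw [sum_sigma, mert, mul_sum]
    refine sum_le_sum fun r hr => ?_
    have hrp : (0:ℝ) < r := by exact_mod_cast (mem_pr.1 hr).1.pos
    simp only [sum_const, Nat.card_Ioc, Nat.sub_zero, nsmul_eq_mul]
    calc (⌊x / (r * r : ℕ)⌋₊ : ℝ) * r ≤ x / (r * r : ℕ) * r := by
          gcongr
          exact Nat.floor_le (by positivity)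
      _ = _ := by push_cast; field_simp
  calc (S.card : ℝ) ≤ _ := h1
    _ ≤ 136 / (Nat.totient q * (v * Real.log 2)) * (x * mert J) := by
        gcongr
        exact h2.trans h3
    _ = _ := by ring

theorem short_count : ∃ z₀ : ℝ, ∀ w : ℕ, z₀ ≤ 2 ^ w → 1 ≤ w → ∀ τ : ℝ, 1/2 ≤ τ → τ < 1 →
    1 ≤ (1 - τ) * ((2:ℝ) ^ w) ^ (1/10 : ℝ) → ∀ q : ℕ, 0 < q → (q:ℝ) ≤ ((2:ℝ) ^ w) ^ (1/10 : ℝ) →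
    ∀ (a : ZMod q) (x : ℝ) (S : Finset ℕ), 1 ≤ x →
    (∀ n ∈ S, n ≠ 0 ∧ (n:ℝ) ≤ x ∧ τ * x < n ∧ 2 ^ (w + 1) < gp n ∧ ((Astar n : ℤ) : ZMod q) = a) →
    (S.card : ℝ) ≤ 33 * ((1 - τ) * x) / (Nat.totient q * (w * Real.log 2)) * (1 + Real.log x) := by
  obtain ⟨z₀, hz⟩ := bt_short
  refine ⟨z₀, fun w hw hw1 τ hτ hτ1 hτw q hq hqw a x S hx hS => ?_⟩
  have hl2 : 0 < Real.log 2 := Real.log_pos (by norm_num)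
  have hφ : (0:ℝ) < Nat.totient q := by exact_mod_cast Nat.totient_pos.2 hq
  have hwp : (0:ℝ) < w := by exact_mod_cast hw1
  have hτ0 : 0 < 1 - τ := by linarith
  have hx0 : 0 < x := by linarith
  have hharm : ∑ i ∈ Ioc 0 ⌊x⌋₊, (i:ℝ)⁻¹ ≤ 1 + Real.log x := by
    have := harmonic_floor_le_one_add_log x hx
    rw [harmonic_eq_sum_Icc] at this
    push_cast at this
    exact this
  have hτp : 0 < τ := by linarith
  have h1 : (S.card : ℝ) ≤ ∑ m ∈ Ioc 0 ⌊x⌋₊, 33 * ((1 - τ) * x) / (Nat.totient q * (w * Real.log 2)) * (m:ℝ)⁻¹ := by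
    apply fib_count q a S _ (fun m => primesIoc (τ * x / m) (τ * x / m + (1 - τ) * x / m))
    · intro n hn
      obtain ⟨h1, h2, h3, h4, h5⟩ := hS n hn
      exact ⟨two_le_of_gp h1 h4, h5⟩
    · intro n hn
      obtain ⟨h1, h2, h3, h4, h5⟩ := hS n hn
      have hn2 := two_le_of_gp h1 h4
      rw [mem_Ioc]
      refine ⟨Nat.div_pos (Nat.le_of_dvd (by omega) (gp_dvd hn2)) (gp_prime hn2).pos, ?_⟩
      exact (Nat.div_le_self _ _).trans (Nat.le_floor h2)
    · intro n hn
      obtain ⟨h1, h2, h3, h4, h5⟩ := hS n hn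
      have hn2 := two_le_of_gp h1 h4
      obtain ⟨m, hm0, hnm, hdiv, hgm, _⟩ := gp_decomp hn2
      have hmp : (0:ℝ) < m := by exact_mod_cast Nat.pos_of_ne_zero hm0
      have hnc : (n:ℝ) = gp n * m := by exact_mod_cast hnm
      rw [hdiv, mem_primesIoc (by positivity), ← add_div, div_lt_iff₀ hmp, le_div_iff₀ hmp]
      refine ⟨gp_prime hn2, by linarith, by linarith⟩
    · intro m _; positivity
    · intro n hn
      obtain ⟨h1, h2, h3, h4, h5⟩ := hS n hn
      have hn2 := two_le_of_gp h1 h4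
      obtain ⟨m, hm0, hnm, hdiv, hgm, _⟩ := gp_decomp hn2
      rw [hdiv]
      have hmp : (0:ℝ) < m := by exact_mod_cast Nat.pos_of_ne_zero hm0
      have hnc : (n:ℝ) = gp n * m := by exact_mod_cast hnm
      have hz2 : (2:ℝ) ^ w ≤ τ * x / m := by
        rw [le_div_iff₀ hmp]
        have h4' : (2:ℝ) ^ (w + 1) ≤ gp n := by exact_mod_cast h4.le
        rw [pow_succ] at h4'
        have : (2:ℝ) ^ w * 2 * m ≤ gp n * m := by gcongr
        have e : 1 / 2 * x ≤ τ * x := by gcongr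
        linarith
      set z := τ * x / m with hzdef
      have hzp : 0 < z := by positivity
      have hlog : w * Real.log 2 ≤ Real.log z := by
        rw [← Real.log_pow]; exact Real.log_le_log (by positivity) hz2
      have hpow : ((2:ℝ) ^ w) ^ (1/10 : ℝ) ≤ z ^ (1/10 : ℝ) := Real.rpow_le_rpow (by positivity) hz2 (by norm_num)
      have hH : z ^ (9/10 : ℝ) ≤ (1 - τ) * x / m := by
        have e1 : 1 ≤ (1 - τ) * z ^ (1/10 : ℝ) := hτw.trans (by gcongr)
        calc z ^ (9/10 : ℝ) = z ^ (9/10 : ℝ) * 1 := by ring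
          _ ≤ z ^ (9/10 : ℝ) * ((1 - τ) * z ^ (1/10 : ℝ)) := by gcongr
          _ = (1 - τ) * (z ^ (9/10 : ℝ) * z ^ (1/10 : ℝ)) := by ring
          _ = (1 - τ) * z := by rw [← Real.rpow_add hzp]; norm_num
          _ ≤ (1 - τ) * (x / m) := by
              gcongr
              rw [hzdef]
              gcongr
              nlinarith
          _ = _ := by ring
      refine (hz z (hw.trans hz2) _ hH q hq (hqw.trans hpow) _).trans ?_
      calc 33 * ((1 - τ) * x / m) / (Nat.totient q * Real.log z) ≤ 33 * ((1 - τ) * x / m) / (Nat.totient q * (w * Real.log 2)) := by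
            gcongr
        _ = _ := by ring
  rw [← mul_sum] at h1
  refine h1.trans ?_
  gcongr

end D5

section D6
open Finset Filter Topology

noncomputable def ww (l : ℝ) : ℕ := ⌈l ^ (511/512 : ℝ)⌉₊
noncomputable def jz (l : ℝ) : ℕ := 2 * ⌈l ^ (1/64 : ℝ)⌉₊
noncomputable def JJ (l : ℝ) : ℕ := ⌈2 * l⌉₊
noncomputable def HH (l : ℝ) : ℕ := ⌊l ^ (1/256 : ℝ) / 2⌋₊

theorem ev_q (K θ : ℝ) (hK : 1 ≤ K) (hθ : 0 < θ) : ∀ᶠ l : ℝ in atTop, ∀ q : ℕ, 0 < q → (q:ℝ) ≤ l ^ K →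
    (q:ℝ) / Nat.totient q ≤ l ^ θ := by
  have hl2 : 0 < Real.log 2 := Real.log_pos (by norm_num)
  filter_upwards [ev_log_pow θ hθ (1 + K / Real.log 2), eventually_ge_atTop (Real.exp 1)] with l h1 h2 q hq hqK
  have hl0 : 0 < l := (Real.exp_pos 1).trans_le h2
  have hlog : 1 ≤ Real.log l := by rw [Real.le_log_iff_exp_le hl0]; exact h2
  refine (gq_le hq).trans (le_trans ?_ h1)
  have h3 : Real.log q ≤ K * Real.log l := by
    rw [← Real.log_rpow hl0]
    exact Real.log_le_log (by exact_mod_cast hq) hqK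
  calc 1 + Real.log q / Real.log 2 ≤ Real.log l + K * Real.log l / Real.log 2 := by gcongr
    _ = _ := by ring

theorem ev_mert (θ : ℝ) (hθ : 0 < θ) : ∀ᶠ l : ℝ in atTop, 1 + mert (JJ l) ≤ l ^ θ := by
  filter_upwards [ev_log_pow θ hθ 14, eventually_ge_atTop (Real.exp 1)] with l h1 h2
  have hl0 : 0 < l := (Real.exp_pos 1).trans_le h2
  have hlog : 1 ≤ Real.log l := by rw [Real.le_log_iff_exp_le hl0]; exact h2
  have he : (2.7:ℝ) < l := by linarith [Real.exp_one_gt_d9]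
  have hJ1 : 1 ≤ JJ l := Nat.one_le_ceil_iff.2 (by linarith)
  have hJ2 : (JJ l : ℝ) ≤ l ^ 2 := by
    have := Nat.ceil_lt_add_one (show 0 ≤ 2 * l by linarith)
    unfold JJ
    nlinarith
  have hm := mert_le (JJ l) hJ1
  have h3 : Real.log (JJ l) ≤ 2 * Real.log l := by
    have := Real.log_le_log (by exact_mod_cast hJ1) hJ2
    rw [Real.log_pow] at this
    exact_mod_cast this
  linarith

theorem ww_ge (l : ℝ) : l ^ (511/512 : ℝ) ≤ ww l := Nat.le_ceil _

theorem ww_le {l : ℝ} (hl : 1 ≤ l) : ((ww l + 1 : ℕ) : ℝ) ≤ 3 * l ^ (511/512 : ℝ) := by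
  have h1 : 1 ≤ l ^ (511/512 : ℝ) := Real.one_le_rpow hl (by norm_num)
  have := Nat.ceil_lt_add_one (show 0 ≤ l ^ (511/512 : ℝ) by linarith)
  push_cast
  unfold ww
  linarith

theorem jz_facts {l : ℝ} (hl : 1 ≤ l) : 2 ≤ jz l ∧ l ^ (1/64 : ℝ) ≤ (jz l : ℝ) - 1 ∧ (jz l : ℝ) ≤ 4 * l ^ (1/64 : ℝ) ∧
    (jz l : ℝ) ^ (16:ℝ) ≤ 4 ^ (16:ℝ) * l ^ (1/4 : ℝ) := by
  have h1 : 1 ≤ l ^ (1/64 : ℝ) := Real.one_le_rpow hl (by norm_num)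
  have h2 := Nat.ceil_lt_add_one (show 0 ≤ l ^ (1/64 : ℝ) by linarith)
  have h3 := Nat.le_ceil (l ^ (1/64 : ℝ))
  have h4 : 1 ≤ ⌈l ^ (1/64 : ℝ)⌉₊ := Nat.one_le_ceil_iff.2 (by linarith)
  have h4' : (1:ℝ) ≤ ⌈l ^ (1/64 : ℝ)⌉₊ := by exact_mod_cast h4
  have h5 : (jz l : ℝ) ≤ 4 * l ^ (1/64 : ℝ) := by unfold jz; push_cast; linarith
  refine ⟨by unfold jz; omega, by unfold jz; push_cast; linarith, h5, ?_⟩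
  calc (jz l : ℝ) ^ (16:ℝ) ≤ (4 * l ^ (1/64 : ℝ)) ^ (16:ℝ) := Real.rpow_le_rpow (by positivity) h5 (by norm_num)
    _ = _ := by
      rw [Real.mul_rpow (by norm_num) (by positivity), ← Real.rpow_mul (by linarith)]
      norm_num

theorem ev_pow2 (K c : ℝ) (hc : 0 < c) : ∀ᶠ l : ℝ in atTop, l ^ K ≤ ((2:ℝ) ^ (ww l)) ^ c := by
  have hl2 : 0 < Real.log 2 := Real.log_pos (by norm_num)
  filter_upwards [ev_log_pow (511/512) (by norm_num) (K / (c * Real.log 2)), eventually_gt_atTop 0] with l h1 h2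
  have h3 := h1.trans (ww_ge l)
  rw [Real.rpow_def_of_pos h2, Real.rpow_def_of_pos (by positivity), Real.log_pow]
  apply Real.exp_le_exp.2
  calc Real.log l * K = (K / (c * Real.log 2) * Real.log l) * (c * Real.log 2) := by field_simp
    _ ≤ ww l * (c * Real.log 2) := by gcongr
    _ = _ := by ring

theorem tendsto_ww : Tendsto ww atTop atTop := by
  unfold ww
  exact tendsto_nat_ceil_atTop.comp (tendsto_rpow_atTop (by norm_num))

theorem tendsto_jz : Tendsto jz atTop atTop := by
  unfold jz
  exact (tendsto_nat_ceil_atTop.comp (tendsto_rpow_atTop (by norm_num))).const_mul_atTop' (by norm_num)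

theorem ev_ww (X₀ : ℝ) : ∀ᶠ l : ℝ in atTop, X₀ ≤ (2:ℝ) ^ (ww l) :=
  ((tendsto_pow_atTop_atTop_of_one_lt (r := (2:ℝ)) (by norm_num)).comp tendsto_ww).eventually_ge_atTop X₀

theorem ev_jw : ∀ᶠ l : ℝ in atTop, jz l ≤ ww l := by
  have := (tendsto_rpow_atTop (show (0:ℝ) < 495/512 by norm_num)).eventually_ge_atTop 8
  filter_upwards [(tendsto_rpow_atTop (show (0:ℝ) < 503/512 by norm_num)).eventually_ge_atTop 4, eventually_ge_atTop 1] with l h1 h2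
  have h3 := (jz_facts h2).2.2.1
  have h4 := ww_ge l
  have : (jz l : ℝ) ≤ ww l := by
    calc (jz l : ℝ) ≤ 4 * l ^ (1/64 : ℝ) := h3
      _ ≤ l ^ (503/512 : ℝ) * l ^ (1/64 : ℝ) := by gcongr
      _ = l ^ (511/512 : ℝ) := by rw [← Real.rpow_add (by linarith)]; norm_num
      _ ≤ _ := h4
  exact_mod_cast this

theorem x_le_JJ {x : ℝ} (hx : 1 ≤ x) : x ≤ 2 ^ (JJ (Real.log x)) := by
  have h1 := Nat.le_ceil (2 * Real.log x)
  have hl := Real.log_nonneg hx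
  have h2 : Real.log x ≤ JJ (Real.log x) * Real.log 2 := by
    have := Real.log_two_gt_d9
    unfold JJ
    nlinarith
  rw [← Real.log_le_log_iff (by linarith) (by positivity), Real.log_pow]
  exact h2

theorem ev_HH : ∀ᶠ l : ℝ in atTop, 1 ≤ HH l ∧ l ^ (1/256 : ℝ) ≤ 4 * HH l ∧ 2 * (HH l : ℝ) ≤ l ^ (1/256 : ℝ) := by
  filter_upwards [(tendsto_rpow_atTop (show (0:ℝ) < 1/256 by norm_num)).eventually_ge_atTop 4] with l h1
  have h2 := Nat.floor_le (show 0 ≤ l ^ (1/256 : ℝ) / 2 by linarith)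
  have h3 := Nat.lt_floor_add_one (l ^ (1/256 : ℝ) / 2)
  have h4 : 1 ≤ HH l := Nat.le_floor (by push_cast; linarith)
  refine ⟨h4, ?_, ?_⟩
  · have : (1:ℝ) ≤ HH l := by exact_mod_cast h4
    unfold HH at *
    linarith
  · unfold HH; linarith

/-- a negative power beats constants -/
theorem ev_neg (C c ε : ℝ) (hc : 0 < c) (hε : 0 < ε) : ∀ᶠ l : ℝ in atTop, C * l ^ (-c) ≤ ε := by
  have : Tendsto (fun l : ℝ => C * l ^ (-c)) atTop (𝓝 (C * 0)) := (tendsto_rpow_neg_atTop hc).const_mul C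
  rw [mul_zero] at this
  exact (this.eventually_lt_const hε).mono fun _ h => h.le

theorem ev_exp (C s c b ε : ℝ) (hc : 0 < c) (hb : 0 < b) (hε : 0 < ε) :
    ∀ᶠ l : ℝ in atTop, C * (l ^ s * Real.exp (-(b * l ^ c))) ≤ ε := by
  have h1 := ((tendsto_rpow_mul_exp_neg_mul_atTop_nhds_zero (s / c) b hb).comp (tendsto_rpow_atTop hc)).const_mul C
  rw [mul_zero] at h1
  filter_upwards [h1.eventually_lt_const hε, eventually_ge_atTop 0] with l h h0
  refine le_trans (le_of_eq ?_) h.le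
  simp only [Function.comp]
  rw [← Real.rpow_mul h0]
  congr 3
  · congr 1; field_simp
  · ring

end D6

section D7
open Finset Filter Topology

theorem smooth_small (K ε : ℝ) (hε : 0 < ε) : ∀ᶠ x : ℝ in atTop,
    ((smooth x (ww (Real.log x) + 1)).card : ℝ) * Real.log x ^ K ≤ ε * x := by
  have hl2 : Real.log 2 < 0.6931471808 := Real.log_two_lt_d9
  have hl2p : 0 < Real.log 2 := Real.log_pos (by norm_num)
  have h1 := Real.tendsto_log_atTop.eventually (ev_exp 1 K 1 (1/2) (ε/2) (by norm_num) (by norm_num) (by linarith))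
  have h2 := Real.tendsto_log_atTop.eventually
    (ev_exp (Real.exp 60 * 3 ^ (48:ℝ)) (48 + K) (1/512) (1/6) (ε/2) (by norm_num) (by norm_num) (by linarith))
  have h3 := Real.tendsto_log_atTop.eventually (tendsto_ww.eventually_ge_atTop 3)
  have h4 := Real.tendsto_log_atTop.eventually (eventually_ge_atTop 1)
  filter_upwards [h1, h2, h3, h4, eventually_ge_atTop 1] with x h1 h2 h3 h4 h5
  set l := Real.log x with hl
  have hx0 : 0 < x := by linarith
  have hl0 : 0 < l := by linarith
  have hr := rankin x h5 (ww l + 1) (by omega)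
  have hv := ww_le h4
  set v : ℝ := ((ww l + 1 : ℕ) : ℝ) with hvdef
  have hv0 : 0 < v := by rw [hvdef]; positivity
  have hsq : √x = x * Real.exp (-(1/2 * l ^ (1:ℝ))) := by
    rw [Real.rpow_one, Real.sqrt_eq_rpow, Real.rpow_def_of_pos hx0, ← hl]
    have hxe : Real.exp l = x := by rw [hl]; exact Real.exp_log hx0
    calc Real.exp (l * (1/2)) = Real.exp l * Real.exp (-(1/2 * l)) := by
          rw [← Real.exp_add]; congr 1; ring
      _ = _ := by rw [hxe]
  have hex : Real.exp (-(l / (2 * (v * Real.log 2)))) ≤ Real.exp (-(1/6 * l ^ (1/512 : ℝ))) := by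
    apply Real.exp_le_exp.2
    apply neg_le_neg
    rw [le_div_iff₀ (by positivity)]
    have e : l ^ (1/512:ℝ) * l ^ (511/512:ℝ) = l := by
      rw [← Real.rpow_add hl0]; norm_num
    have hp : 0 ≤ l ^ (1/512:ℝ) := by positivity
    calc 1/6 * l ^ (1/512:ℝ) * (2 * (v * Real.log 2)) ≤ 1/6 * l ^ (1/512:ℝ) * (2 * (3 * l ^ (511/512:ℝ) * 1)) := by
          gcongr; linarith
      _ = l ^ (1/512:ℝ) * l ^ (511/512:ℝ) := by ring
      _ = l := e
  have hv48 : v ^ (48:ℝ) ≤ 3 ^ (48:ℝ) * l ^ (48:ℝ) := by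
    rw [← Real.mul_rpow (by norm_num) hl0.le]
    apply Real.rpow_le_rpow hv0.le _ (by norm_num)
    refine hv.trans ?_
    have : l ^ (511/512:ℝ) ≤ l ^ (1:ℝ) := Real.rpow_le_rpow_of_exponent_le h4 (by norm_num)
    rw [Real.rpow_one] at this
    linarith
  have hlK : 0 ≤ l ^ K := by positivity
  calc ((smooth x (ww l + 1)).card : ℝ) * l ^ K
      ≤ (√x + x * Real.exp (-(l / (2 * (v * Real.log 2)))) * (Real.exp 60 * v ^ (48:ℝ))) * l ^ K :=
        mul_le_mul_of_nonneg_right hr hlK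
    _ ≤ (x * Real.exp (-(1/2 * l ^ (1:ℝ))) + x * Real.exp (-(1/6 * l ^ (1/512 : ℝ))) * (Real.exp 60 * (3 ^ (48:ℝ) * l ^ (48:ℝ)))) * l ^ K := by
        rw [hsq]
        refine mul_le_mul_of_nonneg_right (add_le_add le_rfl ?_) hlK
        apply mul_le_mul _ _ (by positivity) (by positivity)
        · exact mul_le_mul_of_nonneg_left hex hx0.le
        · exact mul_le_mul_of_nonneg_left hv48 (by positivity)
    _ = x * (1 * (l ^ K * Real.exp (-(1/2 * l ^ (1:ℝ))))) + x * (Real.exp 60 * 3 ^ (48:ℝ) * (l ^ (48 + K) * Real.exp (-(1/6 * l ^ (1/512 : ℝ))))) := by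
        rw [Real.rpow_add hl0]; ring
    _ ≤ x * (ε/2) + x * (ε/2) := by gcongr
    _ = ε * x := by ring

open Classical in
theorem bad_raw : ∃ X₀ : ℝ, ∀ v : ℕ, X₀ ≤ 2 ^ v → 1 ≤ v → ∀ q : ℕ, 0 < q → (q:ℝ) ≤ ((2:ℝ) ^ v) ^ (1/20 : ℝ) →
    ∀ (a : ZMod q) (x : ℝ) (J j0 k : ℕ), 1 ≤ x → x ≤ 2 ^ J → 2 ≤ j0 → j0 ≤ v →
    (((Ioc 0 ⌊x⌋₊).filter fun n => (gp n ≤ 2 ^ v ∨ ¬ good (2 ^ j0) (k + 1) n) ∧ ((Astar n : ℤ) : ZMod q) = a).card : ℝ)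
      ≤ (smooth x v).card + x / (Nat.totient q * (v * Real.log 2)) *
        (136 * mert J + 68 * (Real.exp 20 * (j0:ℝ) ^ (16:ℝ) * (1 + mert J) ^ k)
          + 68 * (mert J * (8 / (j0 - 1)) * (1 + Real.log x))) := by
  obtain ⟨X1, hX1⟩ := mid_count
  obtain ⟨X2, hX2⟩ := top_count
  refine ⟨max X1 X2, fun v hv hv1 q hq hqv a x J j0 k hx hxJ hj0 hjv => ?_⟩
  have hl2p : 0 < Real.log 2 := Real.log_pos (by norm_num)
  have hx0 : 0 ≤ x := by linarith
  have hN : ⌊x⌋₊ ≤ 2 ^ J := by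
    have := (Nat.floor_le hx0).trans hxJ
    exact_mod_cast this
  set B0 := (Ioc 0 ⌊x⌋₊).filter fun n => 2 ^ v < gp n ∧ ((Astar n : ℤ) : ZMod q) = a with hB0
  have hB0m : ∀ n ∈ B0, n ≠ 0 ∧ (n:ℝ) ≤ x ∧ 2 ^ v < gp n ∧ ((Astar n : ℤ) : ZMod q) = a := by
    intro n hn
    obtain ⟨h1, h2, h3⟩ := mem_filter.1 hn
    obtain ⟨h4, h5⟩ := mem_Ioc.1 h1
    exact ⟨h4.ne', (Nat.le_floor_iff hx0).1 h5, h2, h3⟩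
  have hdiv : ∀ n ∈ B0, n / gp n ∈ Ioc 0 ⌊x⌋₊ := by
    intro n hn
    obtain ⟨h1, h2, h3, h4⟩ := hB0m n hn
    obtain ⟨m, hm0, -, e, -⟩ := gp_decomp (two_le_of_gp h1 h3)
    rw [mem_Ioc]
    refine ⟨by rw [e]; exact Nat.pos_of_ne_zero hm0, (Nat.div_le_self _ _).trans ((Nat.le_floor_iff hx0).2 h2)⟩
  set St := B0.filter fun n => gp n < 2 * gp (n / gp n) with hSt
  set Sl := B0.filter fun n => lowP (2 ^ j0) k (n / gp n) with hSl
  set Sc := B0.filter fun n => closeP (2 ^ j0) (n / gp n) with hSc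
  have hsub : ((Ioc 0 ⌊x⌋₊).filter fun n => (gp n ≤ 2 ^ v ∨ ¬ good (2 ^ j0) (k + 1) n) ∧ ((Astar n : ℤ) : ZMod q) = a)
      ⊆ smooth x v ∪ (St ∪ (Sl ∪ Sc)) := by
    intro n hn
    obtain ⟨h1, h2, h3⟩ := mem_filter.1 hn
    obtain ⟨h4, h5⟩ := mem_Ioc.1 h1
    by_cases hg : gp n ≤ 2 ^ v
    · apply mem_union_left
      rw [mem_smooth]
      exact ⟨h4.ne', (Nat.le_floor_iff hx0).1 h5, fun p hp hpn => (le_gp h4.ne' hp hpn).trans hg⟩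
    · apply mem_union_right
      have hg' : 2 ^ v < gp n := not_le.1 hg
      have hn0 : n ∈ B0 := mem_filter.2 ⟨h1, hg', h3⟩
      have hng := h2.resolve_left hg
      have hy : 2 ^ j0 < gp n := lt_of_le_of_lt (Nat.pow_le_pow_right (by norm_num) hjv) hg'
      by_cases hc : gp n < 2 * gp (n / gp n)
      · exact mem_union_left _ (mem_filter.2 ⟨hn0, hc⟩)
      · apply mem_union_right
        have : ¬ good (2 ^ j0) k (n / gp n) := fun h => hng ⟨hy, not_lt.1 hc, h⟩
        have hm := mem_Ioc.1 (hdiv n hn0)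
        rcases not_good _ _ _ hm.1.ne' this with h | h
        · exact mem_union_left _ (mem_filter.2 ⟨hn0, h⟩)
        · exact mem_union_right _ (mem_filter.2 ⟨hn0, h⟩)
  have c0 : (((Ioc 0 ⌊x⌋₊).filter fun n => (gp n ≤ 2 ^ v ∨ ¬ good (2 ^ j0) (k + 1) n) ∧ ((Astar n : ℤ) : ZMod q) = a).card : ℝ)
      ≤ (smooth x v).card + (St.card + (Sl.card + Sc.card)) := by
    refine le_trans (Nat.cast_le.2 (card_le_card hsub)) ?_
    exact_mod_cast (card_union_le _ _).trans (add_le_add le_rfl ((card_union_le _ _).trans (add_le_add le_rfl (card_union_le _ _))))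
  have c1 := hX2 v ((le_max_right _ _).trans hv) hv1 q hq hqv a x St J hx0 hxJ
    (fun n hn => hB0m n (mem_filter.1 hn).1) (fun n hn => (mem_filter.1 hn).2)
  have c2 := hX1 v ((le_max_left _ _).trans hv) hv1 q hq hqv a x Sl ((Ioc 0 ⌊x⌋₊).filter (lowP (2 ^ j0) k)) hx0
    (fun n hn => hB0m n (mem_filter.1 hn).1)
    (fun n hn => mem_filter.2 ⟨hdiv n (mem_filter.1 hn).1, (mem_filter.1 hn).2⟩)
  have c3 := hX1 v ((le_max_left _ _).trans hv) hv1 q hq hqv a x Sc ((Ioc 0 ⌊x⌋₊).filter (closeP (2 ^ j0))) hx0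
    (fun n hn => hB0m n (mem_filter.1 hn).1)
    (fun n hn => mem_filter.2 ⟨hdiv n (mem_filter.1 hn).1, (mem_filter.1 hn).2⟩)
  have d2 := lowP_sum ⌊x⌋₊ J j0 hN (by omega) k
  have d3 := closeP_sum ⌊x⌋₊ J j0 hN hj0
  have hj1 : (0:ℝ) < (j0:ℝ) - 1 := by
    have : (2:ℝ) ≤ j0 := by exact_mod_cast hj0
    linarith
  have hm0 := mert_nonneg J
  have hlogN : Real.log ⌊x⌋₊ ≤ Real.log x := by
    apply Real.log_le_log _ (Nat.floor_le hx0)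
    exact_mod_cast Nat.floor_pos.2 hx
  have d3' : ∑ m ∈ (Ioc 0 ⌊x⌋₊).filter (closeP (2 ^ j0)), (m:ℝ)⁻¹ ≤ mert J * (8 / (j0 - 1)) * (1 + Real.log x) := by
    refine d3.trans (mul_le_mul_of_nonneg_left (by linarith) ?_)
    exact mul_nonneg hm0 (by positivity)
  have hA : 0 ≤ x / (Nat.totient q * (v * Real.log 2)) := by positivity
  have hA68 : 0 ≤ 68 * x / (Nat.totient q * (v * Real.log 2)) := by positivity
  have c2' := c2.trans (mul_le_mul_of_nonneg_left d2 hA68)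
  have c3' := c3.trans (mul_le_mul_of_nonneg_left d3' hA68)
  refine c0.trans ((add_le_add le_rfl (add_le_add c1 (add_le_add c2' c3'))).trans (le_of_eq ?_))
  ring

end D7

section D8
open Finset Filter Topology

theorem frac_bound {x l D φ' : ℝ} {q v : ℕ} (hx : 0 ≤ x) (hl : 0 < l) (hq : 0 < q) (hφ : 0 < φ')
    (hD : (q:ℝ) / φ' ≤ D) (hv : l ^ (511/512:ℝ) ≤ v) :
    x / (φ' * (v * Real.log 2)) ≤ (x / q) * (D * (2 * l ^ (-(511/512):ℝ))) := by
  have hl2 : (0.6931471803 : ℝ) < Real.log 2 := Real.log_two_gt_d9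
  have hq0 : (0:ℝ) < q := by exact_mod_cast hq
  have hp : 0 < l ^ (511/512:ℝ) := by positivity
  have hv0 : (0:ℝ) < v := by linarith
  have h1 : 1 / ((v:ℝ) * Real.log 2) ≤ 2 * l ^ (-(511/512):ℝ) := by
    rw [Real.rpow_neg hl.le, div_le_iff₀ (by nlinarith)]
    calc (1:ℝ) = 2 * (l ^ (511/512:ℝ))⁻¹ * (l ^ (511/512:ℝ) * (1/2)) := by field_simp
      _ ≤ 2 * (l ^ (511/512:ℝ))⁻¹ * (v * Real.log 2) := by gcongr; linarith
  calc x / (φ' * (v * Real.log 2)) = (x / q) * ((q / φ') * (1 / (v * Real.log 2))) := by field_simp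
    _ ≤ _ := by
      refine mul_le_mul_of_nonneg_left ?_ (by positivity)
      apply mul_le_mul hD h1 (by positivity)
      exact le_trans (by positivity) hD

open Classical in
theorem bad_small (K : ℝ) (hK : 1 ≤ K) (k : ℕ) (ε : ℝ) (hε : 0 < ε) : ∀ᶠ x : ℝ in atTop,
    ∀ q : ℕ, 0 < q → (q:ℝ) ≤ Real.log x ^ K → ∀ a : ZMod q,
    (((Ioc 0 ⌊x⌋₊).filter fun n => (gp n ≤ 2 ^ (ww (Real.log x) + 1) ∨ ¬ good (2 ^ (jz (Real.log x))) (k + 1) n)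
      ∧ ((Astar n : ℤ) : ZMod q) = a).card : ℝ) ≤ ε * (x / q) := by
  obtain ⟨X₀, hX⟩ := bad_raw
  set θ : ℝ := 1 / (512 * (k + 2)) with hθ
  have hθ0 : 0 < θ := by positivity
  set C : ℝ := 136 + 68 * (Real.exp 20 * 4 ^ (16:ℝ)) + 68 * 16 with hC
  have T := Real.tendsto_log_atTop
  filter_upwards [smooth_small K (ε/2) (by linarith), T.eventually (ev_q K θ hK hθ0), T.eventually (ev_mert θ hθ0),
    T.eventually (ev_pow2 K (1/20) (by norm_num)), T.eventually (ev_ww X₀), T.eventually ev_jw,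
    T.eventually (eventually_ge_atTop 1), eventually_ge_atTop 1,
    T.eventually (ev_neg (2 * C) (6/512) (ε/2) (by norm_num) (by linarith))] with x h1 h2 h3 h4 h5 h6 h7 h8 h9 q hq hqK a
  set l := Real.log x with hl
  have hl0 : 0 < l := by linarith
  have hx0 : 0 < x := by linarith
  have hq0 : (0:ℝ) < q := by exact_mod_cast hq
  have hpow : (2:ℝ) ^ (ww l) ≤ 2 ^ (ww l + 1) := pow_le_pow_right₀ (by norm_num) (Nat.le_succ _)
  obtain ⟨j1, j2, j3, j4⟩ := jz_facts h7
  have hraw := hX (ww l + 1) (h5.trans hpow) (by omega) q hq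
    ((hqK.trans h4).trans (Real.rpow_le_rpow (by positivity) hpow (by norm_num))) a x (JJ l) (jz l) k h8 (x_le_JJ h8) j1 (by omega)
  rw [← hl] at hraw
  refine hraw.trans ?_
  set D := l ^ θ with hDdef
  have hD1 : 1 ≤ D := Real.one_le_rpow h7 hθ0.le
  have hm0 := mert_nonneg (JJ l)
  have hm : mert (JJ l) ≤ D := by linarith
  have hDk : D ≤ D ^ (k + 1) := le_self_pow₀ hD1 (by omega)
  have hDk' : D ^ k ≤ D ^ (k + 1) := pow_le_pow_right₀ hD1 (by omega)
  have hL1 : (1:ℝ) ≤ l ^ (63/64:ℝ) := Real.one_le_rpow h7 (by norm_num)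
  have hL2 : l ^ (1/4:ℝ) ≤ l ^ (63/64:ℝ) := Real.rpow_le_rpow_of_exponent_le h7 (by norm_num)
  have hφ : (0:ℝ) < Nat.totient q := by exact_mod_cast Nat.totient_pos.2 hq
  have hfr := frac_bound (x := x) (q := q) (v := ww l + 1) hx0.le hl0 hq hφ (h2 q hq hqK)
    ((ww_ge l).trans (by push_cast; linarith))
  have b1 : 136 * mert (JJ l) ≤ 136 * (D ^ (k + 1) * l ^ (63/64:ℝ)) := by
    refine mul_le_mul_of_nonneg_left ?_ (by norm_num)
    calc mert (JJ l) ≤ D ^ (k + 1) * 1 := by linarith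
      _ ≤ _ := mul_le_mul_of_nonneg_left hL1 (by positivity)
  have b2 : 68 * (Real.exp 20 * (jz l:ℝ) ^ (16:ℝ) * (1 + mert (JJ l)) ^ k) ≤
      68 * (Real.exp 20 * 4 ^ (16:ℝ)) * (D ^ (k + 1) * l ^ (63/64:ℝ)) := by
    calc 68 * (Real.exp 20 * (jz l:ℝ) ^ (16:ℝ) * (1 + mert (JJ l)) ^ k)
        ≤ 68 * (Real.exp 20 * (4 ^ (16:ℝ) * l ^ (63/64:ℝ)) * D ^ (k + 1)) := by
          refine mul_le_mul_of_nonneg_left ?_ (by norm_num)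
          apply mul_le_mul _ _ (by positivity) (by positivity)
          · refine mul_le_mul_of_nonneg_left ?_ (by positivity)
            exact j4.trans (mul_le_mul_of_nonneg_left hL2 (by positivity))
          · exact (pow_le_pow_left₀ (by linarith) h3 k).trans hDk'
      _ = _ := by ring
  have b3 : 68 * (mert (JJ l) * (8 / ((jz l:ℝ) - 1)) * (1 + l)) ≤ 68 * 16 * (D ^ (k + 1) * l ^ (63/64:ℝ)) := by
    have hp : 0 < l ^ (1/64:ℝ) := by positivity
    have e : l ^ (63/64:ℝ) = (l ^ (1/64:ℝ))⁻¹ * l := by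
      rw [← Real.rpow_neg hl0.le]
      nth_rewrite 3 [← Real.rpow_one l]
      rw [← Real.rpow_add hl0]; norm_num
    calc 68 * (mert (JJ l) * (8 / ((jz l:ℝ) - 1)) * (1 + l))
        ≤ 68 * (D ^ (k + 1) * (8 / l ^ (1/64:ℝ)) * (l + l)) := by
          refine mul_le_mul_of_nonneg_left ?_ (by norm_num)
          apply mul_le_mul _ (by linarith) (by linarith) (by positivity)
          apply mul_le_mul (hm.trans hDk) _ (div_nonneg (by norm_num) (by linarith)) (by positivity)
          exact div_le_div_of_nonneg_left (by norm_num) hp j2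
      _ = _ := by rw [e]; ring
  have hbr : 136 * mert (JJ l) + 68 * (Real.exp 20 * (jz l:ℝ) ^ (16:ℝ) * (1 + mert (JJ l)) ^ k)
      + 68 * (mert (JJ l) * (8 / ((jz l:ℝ) - 1)) * (1 + l)) ≤ C * (D ^ (k + 1) * l ^ (63/64:ℝ)) := by
    refine (add_le_add (add_le_add b1 b2) b3).trans (le_of_eq ?_)
    rw [hC]; ring
  have hbr0 : 0 ≤ 136 * mert (JJ l) + 68 * (Real.exp 20 * (jz l:ℝ) ^ (16:ℝ) * (1 + mert (JJ l)) ^ k)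
      + 68 * (mert (JJ l) * (8 / ((jz l:ℝ) - 1)) * (1 + l)) := by
    have hp : 0 < l ^ (1/64:ℝ) := by positivity
    have : 0 ≤ 8 / ((jz l:ℝ) - 1) := div_nonneg (by norm_num) (by linarith)
    positivity
  have hDe : D ^ (k + 2) * l ^ (63/64:ℝ) * l ^ (-(511/512):ℝ) = l ^ (-(6/512):ℝ) := by
    rw [hDdef, ← Real.rpow_natCast, ← Real.rpow_mul hl0.le, ← Real.rpow_add hl0, ← Real.rpow_add hl0]
    congr 1
    rw [hθ]; push_cast; field_simp; ring
  have hsm : ((smooth x (ww l + 1)).card : ℝ) ≤ ε / 2 * (x / q) := by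
    rw [← mul_div_assoc, le_div_iff₀ hq0]
    exact (mul_le_mul_of_nonneg_left hqK (by positivity)).trans h1
  calc _ ≤ ε / 2 * (x / q) + (x / q) * (D * (2 * l ^ (-(511/512):ℝ))) * (C * (D ^ (k + 1) * l ^ (63/64:ℝ))) := by
        apply add_le_add hsm
        exact mul_le_mul hfr hbr hbr0 (by positivity)
    _ = ε / 2 * (x / q) + (x / q) * (2 * C * (D ^ (k + 2) * l ^ (63/64:ℝ) * l ^ (-(511/512):ℝ))) := by ring
    _ ≤ ε / 2 * (x / q) + (x / q) * (ε / 2) := by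
        rw [hDe]
        exact add_le_add le_rfl (mul_le_mul_of_nonneg_left h9 (by positivity))
    _ = _ := by ring

theorem short_small (K : ℝ) (hK : 1 ≤ K) (k : ℕ) (ε : ℝ) (hε : 0 < ε) : ∀ᶠ x : ℝ in atTop,
    ∀ q : ℕ, 0 < q → (q:ℝ) ≤ Real.log x ^ K → ∀ (a : ZMod q) (S : Finset ℕ),
    (∀ n ∈ S, n ≠ 0 ∧ (n:ℝ) ≤ x ∧ x < (1 + 1 / (HH (Real.log x) : ℝ)) ^ k * n ∧ 2 ^ (ww (Real.log x) + 1) < gp n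
      ∧ ((Astar n : ℤ) : ZMod q) = a) → (S.card : ℝ) ≤ ε * (x / q) := by
  obtain ⟨z₀, hz⟩ := short_count
  have T := Real.tendsto_log_atTop
  filter_upwards [T.eventually (ev_q K (1/1024) hK (by norm_num)), 
    T.eventually (ev_pow2 K (1/10) (by norm_num)), T.eventually (ev_pow2 1 (1/10) (by norm_num)), T.eventually (ev_ww z₀),
    T.eventually ev_HH, T.eventually (eventually_ge_atTop 1), eventually_ge_atTop 1,
    T.eventually ((tendsto_rpow_atTop (show (0:ℝ) < 1/256 by norm_num)).eventually_ge_atTop (8 * ((k:ℝ) + 1))),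
    T.eventually (tendsto_ww.eventually_ge_atTop 1),
    T.eventually (ev_neg (33 * 16 * ((k:ℝ) + 1)) (1/1024) ε (by norm_num) hε)] with x h1 h2 h3 h4 h5 h6 h7 h8 h9 h10 q hq hqK a S hS
  set l := Real.log x with hl
  have hl0 : 0 < l := by linarith
  have hx0 : 0 < x := by linarith
  have hq0 : (0:ℝ) < q := by exact_mod_cast hq
  have hφ : (0:ℝ) < Nat.totient q := by exact_mod_cast Nat.totient_pos.2 hq
  obtain ⟨H1, H2, H3⟩ := h5
  set H : ℝ := (HH l : ℝ) with hH
  have hH1 : (1:ℝ) ≤ H := by rw [hH]; exact_mod_cast H1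
  have hH2 : 2 * ((k:ℝ) + 1) ≤ H := by linarith
  have hk0 : (0:ℝ) ≤ k := Nat.cast_nonneg k
  set d : ℝ := ((k:ℝ) + 1) / H with hd
  have hd0 : 0 < d := by positivity
  have hd1 : d ≤ 1/2 := by rw [hd, div_le_iff₀ (by linarith)]; linarith
  have hlH : H ≤ l := by
    have : l ^ (1/256:ℝ) ≤ l ^ (1:ℝ) := Real.rpow_le_rpow_of_exponent_le h6 (by norm_num)
    rw [Real.rpow_one] at this
    linarith
  have hτ : (1 - d) * (1 + 1 / H) ^ k ≤ 1 := by
    have hi : 1 / H ≤ 1 := by rw [div_le_one (by linarith)]; exact hH1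
    have hi0 : 0 < 1 / H := by positivity
    have hb := one_add_mul_le_pow (a := -(1/H)) (by linarith) k
    calc (1 - d) * (1 + 1 / H) ^ k ≤ (1 + -(1/H)) ^ k * (1 + 1/H) ^ k := by
          refine mul_le_mul_of_nonneg_right (le_trans ?_ hb) (by positivity)
          rw [hd, add_div]
          have : (k:ℝ) * (-(1/H)) = -((k:ℝ) / H) := by ring
          rw [this]; linarith
      _ = (1 - (1/H) ^ 2) ^ k := by rw [← mul_pow]; congr 1; ring
      _ ≤ 1 := pow_le_one₀ (by nlinarith) (by nlinarith)
  have hc := hz (ww l) h4 h9 (1 - d) (by linarith) (by linarith) ?_ q hq (hqK.trans h2) a x S h7 ?_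
  · rw [sub_sub_cancel, ← hl] at hc
    have hfr := frac_bound (x := x) (q := q) (v := ww l) hx0.le hl0 hq hφ (h1 q hq hqK) (ww_ge l)
    have hdl : d ≤ ((k:ℝ) + 1) * (4 * l ^ (-(1/256):ℝ)) := by
      rw [hd, div_eq_mul_inv]
      refine mul_le_mul_of_nonneg_left ?_ (by positivity)
      have hp : 0 < l ^ (1/256:ℝ) := by positivity
      rw [Real.rpow_neg hl0.le, inv_le_iff_one_le_mul₀ (by linarith)]
      calc (1:ℝ) = (l ^ (1/256:ℝ))⁻¹ * l ^ (1/256:ℝ) := (inv_mul_cancel₀ hp.ne').symm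
        _ ≤ (l ^ (1/256:ℝ))⁻¹ * (4 * H) := mul_le_mul_of_nonneg_left H2 (by positivity)
        _ = _ := by ring
    have e : l ^ (1/1024:ℝ) * l ^ (-(511/512):ℝ) * l ^ (-(1/256):ℝ) * l = l ^ (-(1/1024):ℝ) := by
      nth_rewrite 4 [← Real.rpow_one l]
      rw [← Real.rpow_add hl0, ← Real.rpow_add hl0, ← Real.rpow_add hl0]; norm_num
    calc (S.card : ℝ) ≤ 33 * (d * x) / (Nat.totient q * (ww l * Real.log 2)) * (1 + l) := hc
      _ = 33 * d * (x / (Nat.totient q * (ww l * Real.log 2))) * (1 + l) := by ring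
      _ ≤ 33 * (((k:ℝ) + 1) * (4 * l ^ (-(1/256):ℝ))) * ((x / q) * (l ^ (1/1024:ℝ) * (2 * l ^ (-(511/512):ℝ)))) * (2 * l) := by
          have hl2p : 0 < Real.log 2 := Real.log_pos (by norm_num)
          apply mul_le_mul _ (by linarith) (by linarith) (by positivity)
          apply mul_le_mul _ hfr (by positivity) (by positivity)
          exact mul_le_mul_of_nonneg_left hdl (by norm_num)
      _ = (x / q) * (33 * 16 * ((k:ℝ) + 1) * (l ^ (1/1024:ℝ) * l ^ (-(511/512):ℝ) * l ^ (-(1/256):ℝ) * l)) := by ring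
      _ ≤ (x / q) * ε := by
          rw [e]
          exact mul_le_mul_of_nonneg_left h10 (by positivity)
      _ = _ := by ring
  · rw [sub_sub_cancel]
    rw [Real.rpow_one] at h3
    calc (1:ℝ) = 1 / H * H := by field_simp
      _ ≤ d * ((2:ℝ) ^ ww l) ^ (1/10:ℝ) := by
          apply mul_le_mul _ (hlH.trans h3) (by linarith) hd0.le
          rw [hd]; gcongr; linarith
  · intro n hn
    obtain ⟨a1, a2, a3, a4, a5⟩ := hS n hn
    refine ⟨a1, a2, ?_, a4, a5⟩
    calc (1 - d) * x < (1 - d) * ((1 + 1 / H) ^ k * n) := mul_lt_mul_of_pos_left a3 (by linarith)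
      _ = (1 - d) * (1 + 1 / H) ^ k * n := by ring
      _ ≤ 1 * n := mul_le_mul_of_nonneg_right hτ (by positivity)
      _ = n := one_mul _

end D8

section D9
open Finset Filter Topology

theorem ee_two (t : ℤ) (ht : IsCoprime t ((2:ℕ) : ℤ)) : ee (t / (2:ℕ)) 1 = -1 := by
  have hodd : t % 2 = 1 := by
    rcases Int.emod_two_eq_zero_or_one t with h | h
    · exfalso
      have h2 : (2:ℤ) ∣ t := Int.dvd_of_emod_eq_zero h
      have := ht.isUnit_of_dvd' h2 (by norm_num)
      norm_num [Int.isUnit_iff] at this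
    · exact h
  obtain ⟨r, hr⟩ : ∃ r, t = 2 * r + 1 := ⟨t / 2, by omega⟩
  unfold ee
  rw [hr]
  have : (((2 * Real.pi * ((((2 * r + 1 : ℤ) : ℝ) / ((2:ℕ):ℝ)) * ((1:ℤ):ℝ)) : ℝ) : ℂ) * Complex.I)
      = (r : ℂ) * (2 * Real.pi * Complex.I) + Real.pi * Complex.I := by
    push_cast; ring
  rw [this, Complex.exp_add, Complex.exp_int_mul_two_pi_mul_I, Complex.exp_pi_mul_I, one_mul]

theorem ee_two_parH (t : ℤ) (ht : IsCoprime t ((2:ℕ) : ℤ)) : ∀ n : ℕ, n ≠ 0 →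
    ee (t / (2:ℕ)) (Astar n) = (parH n : ℂ) := by
  intro n
  induction n using Nat.strong_induction_on with
  | _ n ih =>
    intro hn
    rcases (show n = 1 ∨ 2 ≤ n by omega) with rfl | h2
    · rw [Astar_one, ee_zero, map_one]; simp
    · obtain ⟨m, hm0, e1, e2, h3, e3⟩ := gp_decomp h2
      have hp := gp_prime h2
      have hlt : m < n := by
        rw [← e2]; exact Nat.div_lt_self (by omega) hp.one_lt
      have hpar : parH n = parH (gp n) * parH m := by
        rw [← map_mul, ← e1]
      rw [e3, ee_sub, ih m hlt hm0, Complex.conj_ofReal, hpar]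
      rw [Complex.ofReal_mul]
      congr 1
      by_cases hp2 : gp n = 2
      · rw [hp2, parH_two]
        have : ee (t / (2:ℕ)) ((2:ℕ):ℤ) = ee (t / (2:ℕ)) 0 := ee_period (by norm_num) t (by decide)
        rw [this, ee_zero]; simp
      · rw [parH_prime hp hp2]
        have hodd := hp.eq_two_or_odd.resolve_left hp2
        have : ee (t / (2:ℕ)) ((gp n : ℕ):ℤ) = ee (t / (2:ℕ)) 1 := by
          apply ee_period (by norm_num) t
          rw [ZMod.intCast_eq_intCast_iff]
          exact_mod_cast (show gp n ≡ 1 [MOD 2] from hodd)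
        rw [this, ee_two t ht]; simp

theorem gp_le {n : ℕ} (hn : n ≠ 0) : gp n ≤ n := by
  rcases (show n = 1 ∨ 2 ≤ n by omega) with rfl | h2
  · rw [gp_one]; omega
  · exact Nat.le_of_dvd (by omega) (gp_dvd h2)

theorem not_mem_GG {H j0 k n : ℕ} {x : ℝ} (hx : 1 ≤ x) (hH : 0 < H) (hn : n ∈ Ioc 0 ⌊x⌋₊)
    (hG : n ∉ GG H j0 k x (JJ (Real.log x))) : ¬ good (2 ^ j0) k n ∨ x < (1 + 1 / (H : ℝ)) ^ k * n := by
  by_contra hcon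
  push Not at hcon
  obtain ⟨h1, h2⟩ := mem_Ioc.1 hn
  refine hG (good_mem H j0 hH k n x _ h1.ne' hcon.1 hcon.2 ?_)
  have h3 : (n:ℝ) ≤ 2 ^ (JJ (Real.log x)) := ((Nat.le_floor_iff (by linarith)).1 h2).trans (x_le_JJ hx)
  exact (gp_le h1.ne').trans (by exact_mod_cast h3)

theorem GG_sub_Ioc {H j0 k v : ℕ} {x : ℝ} (hx : 0 ≤ x) : GG H j0 k x v ⊆ Ioc 0 ⌊x⌋₊ := by
  intro n hn
  obtain ⟨h1, h2, h3⟩ := mem_smooth.1 (GG_sub _ _ _ _ _ hn)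
  rw [mem_Ioc]
  exact ⟨Nat.pos_of_ne_zero h1, (Nat.le_floor_iff hx).2 h2⟩

theorem bern (k : ℕ) (H : ℝ) (hH : 1 ≤ H) : (1 - k / H) * (1 + 1 / H) ^ k ≤ 1 := by
  have hi : 1 / H ≤ 1 := by rw [div_le_one (by linarith)]; exact hH
  have hi0 : 0 < 1 / H := by positivity
  have hb := one_add_mul_le_pow (a := -(1/H)) (by linarith) k
  calc (1 - k / H) * (1 + 1 / H) ^ k ≤ (1 + -(1/H)) ^ k * (1 + 1/H) ^ k := by
        refine mul_le_mul_of_nonneg_right (le_trans ?_ hb) (by positivity)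
        have : (k:ℝ) * (-(1/H)) = -((k:ℝ) / H) := by ring
        rw [this]; linarith
    _ = (1 - (1/H) ^ 2) ^ k := by rw [← mul_pow]; congr 1; ring
    _ ≤ 1 := pow_le_one₀ (by nlinarith) (by nlinarith)

theorem low_freq_three (q : ℕ) (hq : 3 ≤ q) (t : ℤ) (ht : IsCoprime t (q:ℤ)) (ε : ℝ) (hε : 0 < ε) :
    ∀ᶠ x : ℝ in atTop, ‖∑ n ∈ Ioc 0 ⌊x⌋₊, ee (t / q) (Astar n)‖ ≤ ε * x := by
  classical
  obtain ⟨s, hs0, hs1, hGG⟩ := low_GG q hq t ht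
  obtain ⟨k, hk⟩ := exists_pow_lt_of_lt_one (show 0 < ε / 4 by linarith) hs1
  have hk1 : s ^ (k + 1) ≤ ε / 4 := (pow_le_pow_of_le_one hs0 hs1.le (Nat.le_succ k)).trans hk.le
  obtain ⟨H, hH⟩ := exists_nat_ge (max ((k:ℝ) + 1) (((k:ℝ) + 1) / (ε / 4)))
  have hHk : (k:ℝ) + 1 ≤ H := (le_max_left _ _).trans hH
  have hHε : ((k:ℝ) + 1) / (ε / 4) ≤ H := (le_max_right _ _).trans hH
  have hk0 : (0:ℝ) ≤ k := Nat.cast_nonneg k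
  have hH0 : (0:ℝ) < H := by linarith
  have hHp : 0 < H := by exact_mod_cast hH0
  obtain ⟨J, hJ⟩ := hGG H hHp
  have hd : ((k:ℝ) + 1) / H ≤ ε / 4 := by
    rw [div_le_iff₀ (by linarith)] at hHε
    rw [div_le_iff₀ hH0]; linarith
  have hd1 : ((k:ℝ) + 1) / H ≤ 1 := by rw [div_le_one hH0]; exact hHk
  have T := Real.tendsto_log_atTop
  filter_upwards [bad_small 1 le_rfl k (ε/4) (by linarith), eventually_ge_atTop 1, eventually_ge_atTop (8/ε),
    T.eventually (tendsto_jz.eventually_ge_atTop J), T.eventually (eventually_ge_atTop 1)] with x h1 h2 h3 h4 h5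
  set l := Real.log x with hl
  have hx0 : 0 ≤ x := by linarith
  have hb := h1 1 one_pos (by rw [Real.rpow_one]; exact_mod_cast h5) 0
  set G := GG H (jz l) (k + 1) x (JJ l) with hG
  have hGsub : G ⊆ Ioc 0 ⌊x⌋₊ := GG_sub_Ioc hx0
  have hbound := hJ (jz l) h4 (k + 1) x (JJ l) hx0
  rw [← hG] at hbound
  set B := (Ioc 0 ⌊x⌋₊).filter fun n => (gp n ≤ 2 ^ (ww l + 1) ∨ ¬ good (2 ^ (jz l)) (k + 1) n)
      ∧ ((Astar n : ℤ) : ZMod 1) = 0 with hB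
  set τ : ℝ := 1 - ((k:ℝ) + 1) / H with hτ
  have hτ0 : 0 ≤ τ := by linarith
  have hcsub : Ioc 0 ⌊x⌋₊ \ G ⊆ B ∪ Ioc (⌊τ * x⌋₊ - 1) ⌊x⌋₊ := by
    intro n hn
    obtain ⟨hn1, hn2⟩ := mem_sdiff.1 hn
    rcases not_mem_GG h2 hHp hn1 hn2 with h | h
    · exact mem_union_left _ (mem_filter.2 ⟨hn1, Or.inr h, Subsingleton.elim _ _⟩)
    · apply mem_union_right
      obtain ⟨p1, p2⟩ := mem_Ioc.1 hn1
      rw [mem_Ioc]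
      refine ⟨?_, p2⟩
      have hbe := bern (k + 1) H (by linarith)
      push_cast at hbe
      have : τ * x ≤ n := by
        calc τ * x ≤ τ * ((1 + 1 / (H:ℝ)) ^ (k + 1) * n) := mul_le_mul_of_nonneg_left h.le hτ0
          _ = τ * (1 + 1 / (H:ℝ)) ^ (k + 1) * n := by ring
          _ ≤ 1 * n := mul_le_mul_of_nonneg_right hbe (by positivity)
          _ = n := one_mul _
      have := Nat.floor_le_floor this
      rw [Nat.floor_natCast] at this
      omega
  have hcc : ((Ioc 0 ⌊x⌋₊ \ G).card : ℝ) ≤ ε / 4 * x + (ε / 4 * x + 2) := by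
    refine le_trans (Nat.cast_le.2 ((card_le_card hcsub).trans (card_union_le _ _))) ?_
    push_cast
    apply add_le_add
    · simpa using hb
    · rw [Nat.card_Ioc]
      have f1 : ((⌊x⌋₊ - (⌊τ * x⌋₊ - 1) : ℕ) : ℝ) ≤ (⌊x⌋₊ : ℝ) - ⌊τ * x⌋₊ + 1 := by
        have : ⌊τ * x⌋₊ ≤ ⌊x⌋₊ := by
          apply Nat.floor_le_floor
          have : τ ≤ 1 := by
            have : 0 ≤ ((k:ℝ) + 1) / H := by positivity
            linarith
          calc τ * x ≤ 1 * x := mul_le_mul_of_nonneg_right this hx0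
            _ = x := one_mul _
        have h' : (⌊x⌋₊ - (⌊τ * x⌋₊ - 1) : ℕ) + ⌊τ * x⌋₊ ≤ ⌊x⌋₊ + 1 := by omega
        have h'' : ((⌊x⌋₊ - (⌊τ * x⌋₊ - 1) : ℕ) : ℝ) + ⌊τ * x⌋₊ ≤ ⌊x⌋₊ + 1 := by exact_mod_cast h'
        linarith
      have f2 := Nat.floor_le hx0
      have f3 := Nat.lt_floor_add_one (τ * x)
      have f4 : (1 - τ) * x ≤ ε / 4 * x := mul_le_mul_of_nonneg_right (by rw [hτ]; linarith) hx0
      linarith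
  rw [← sum_sdiff hGsub]
  refine (norm_add_le _ _).trans ?_
  have g1 : ‖∑ n ∈ Ioc 0 ⌊x⌋₊ \ G, ee (t / q) (Astar n)‖ ≤ ((Ioc 0 ⌊x⌋₊ \ G).card : ℝ) := by
    refine (norm_sum_le _ _).trans ?_
    simp_rw [ee_norm]
    rw [sum_const, nsmul_eq_mul, mul_one]
  have g2 : s ^ (k + 1) * x ≤ ε / 4 * x := mul_le_mul_of_nonneg_right hk1 hx0
  have g3 : 8 ≤ ε * x := by
    rw [div_le_iff₀ hε] at h3; linarith
  have g4 : 0 ≤ ε * x := by positivity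
  linarith

theorem low_freq (q : ℕ) (hq : 2 ≤ q) (t : ℤ) (ht : IsCoprime t (q:ℤ)) (ε : ℝ) (hε : 0 < ε) :
    ∀ᶠ x : ℝ in atTop, ‖∑ n ∈ Ioc 0 ⌊x⌋₊, ee (t / q) (Astar n)‖ ≤ ε * x := by
  rcases (show q = 2 ∨ 3 ≤ q by omega) with rfl | h3
  · filter_upwards [(tendsto_order.1 parH_sum.abs).2 ε (by simpa using hε), eventually_gt_atTop 0] with x h1 h2
    have : ∑ n ∈ Ioc 0 ⌊x⌋₊, ee (t / (2:ℕ)) (Astar n) = ((∑ k ∈ Icc 1 ⌊x⌋₊, parH k : ℝ) : ℂ) := by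
      push_cast
      refine sum_congr (by ext k; simp [Nat.succ_le_iff]) fun n hn => ee_two_parH t ht n ?_
      have := (mem_Ioc.1 hn).1
      omega
    rw [this, Complex.norm_real, Real.norm_eq_abs]
    rw [abs_div, abs_of_pos h2, div_lt_iff₀ h2] at h1
    exact h1.le
  · exact low_freq_three q h3 t ht ε hε

end D9

section D10
open Finset Filter Topology

theorem inv_cube_sum (q : ℕ) (hq : 0 < q) : ∑ t ∈ range q, (((q / q.gcd t : ℕ) : ℝ) ^ 3)⁻¹ ≤ 2 := by
  have h1 : ∑ t ∈ range q, (((q / q.gcd t : ℕ) : ℝ) ^ 3)⁻¹ =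
      ∑ d ∈ q.divisors, ∑ t ∈ range q with q.gcd t = d, (((q / q.gcd t : ℕ) : ℝ) ^ 3)⁻¹ := by
    rw [sum_fiberwise_of_maps_to]
    intro t _
    exact Nat.mem_divisors.2 ⟨Nat.gcd_dvd_left _ _, hq.ne'⟩
  rw [h1]
  calc _ = ∑ d ∈ q.divisors, (Nat.totient (q / d) : ℝ) * (((q / d : ℕ) : ℝ) ^ 3)⁻¹ := by
        refine sum_congr rfl fun d hd => ?_
        rw [Nat.totient_div_of_dvd (Nat.mem_divisors.1 hd).1, ← nsmul_eq_mul, ← sum_const]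
        refine sum_congr rfl fun t ht => ?_
        rw [(mem_filter.1 ht).2]
    _ = ∑ d ∈ q.divisors, (Nat.totient d : ℝ) * ((d : ℝ) ^ 3)⁻¹ :=
        Nat.sum_div_divisors q (fun d => (Nat.totient d : ℝ) * ((d : ℝ) ^ 3)⁻¹)
    _ ≤ ∑ d ∈ q.divisors, ((d : ℝ) ^ 2)⁻¹ := by
        refine sum_le_sum fun d hd => ?_
        have hd0 : (0:ℝ) < d := by exact_mod_cast Nat.pos_of_mem_divisors hd
        calc (Nat.totient d : ℝ) * ((d : ℝ) ^ 3)⁻¹ ≤ d * ((d : ℝ) ^ 3)⁻¹ := by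
              gcongr; exact Nat.totient_le d
          _ = _ := by field_simp
    _ ≤ ∑ d ∈ insert 1 (Ioc 1 q), ((d : ℝ) ^ 2)⁻¹ := by
        apply sum_le_sum_of_subset_of_nonneg
        · intro d hd
          have h1 := Nat.pos_of_mem_divisors hd
          have h2 := Nat.divisor_le hd
          rw [mem_insert, mem_Ioc]; omega
        · intros; positivity
    _ ≤ 1 + (1 - (q:ℝ)⁻¹) := by
        rw [sum_insert (by simp)]
        have := sum_Ioc_inv_sq_le_sub (α := ℝ) one_ne_zero (show 1 ≤ q from hq)
        simp only [Nat.cast_one, inv_one] at this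
        simp only [Nat.cast_one, one_pow, inv_one]
        linarith
    _ ≤ 2 := by
        have : 0 ≤ (q:ℝ)⁻¹ := by positivity
        linarith

theorem ee_orth (q : ℕ) (hq : 0 < q) (m : ℤ) :
    ∑ t ∈ range q, ee (((t:ℤ):ℝ) / q) m = if (m : ZMod q) = 0 then (q:ℂ) else 0 := by
  have : NeZero q := ⟨hq.ne'⟩
  have h1 : ∀ t : ℕ, ee (((t:ℤ):ℝ) / q) m = ZMod.stdAddChar ((t : ZMod q) * (m : ZMod q)) := by
    intro t
    have : ((t : ZMod q) * (m : ZMod q)) = ((t * m : ℤ) : ZMod q) := by push_cast; ring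
    rw [this, ZMod.stdAddChar_coe, ee]
    congr 1
    push_cast; ring
  simp_rw [h1]
  have h2 : ∑ t ∈ range q, ZMod.stdAddChar ((t : ZMod q) * (m : ZMod q)) =
      ∑ t : ZMod q, ZMod.stdAddChar (t * (m : ZMod q)) := by
    refine sum_nbij' (fun t => (t : ZMod q)) (fun t => t.val) ?_ ?_ ?_ ?_ ?_
    · intros; exact mem_univ _
    · intro t _; exact mem_range.2 (ZMod.val_lt t)
    · intro t ht; exact ZMod.val_cast_of_lt (mem_range.1 ht)
    · intro t _; exact ZMod.natCast_zmod_val t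
    · intros; rfl
  rw [h2, AddChar.sum_mulShift _ (ZMod.isPrimitive_stdAddChar q), ZMod.card]
  push_cast
  rfl

/-- The structured set. -/
noncomputable def GS (k : ℕ) (x : ℝ) : Finset ℕ := GG (HH (Real.log x)) (jz (Real.log x)) (k + 1) x (JJ (Real.log x))

open Classical in
theorem E_small (K : ℝ) (hK : 1 ≤ K) (k : ℕ) (ε : ℝ) (hε : 0 < ε) : ∀ᶠ x : ℝ in atTop,
    ∀ q : ℕ, 0 < q → (q:ℝ) ≤ Real.log x ^ K → ∀ a : ZMod q,
    (((Ioc 0 ⌊x⌋₊ \ GS k x).filter fun n => ((Astar n : ℤ) : ZMod q) = a).card : ℝ) ≤ ε * (x / q) := by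
  have T := Real.tendsto_log_atTop
  filter_upwards [bad_small K hK k (ε/2) (by linarith), short_small K hK (k + 1) (ε/2) (by linarith),
    T.eventually ev_HH, eventually_ge_atTop 1] with x h1 h2 h3 h4 q hq hqK a
  have hb := h1 q hq hqK a
  set l := Real.log x with hl
  set S := (Ioc 0 ⌊x⌋₊).filter fun n : ℕ => x < (1 + 1 / (HH l : ℝ)) ^ (k + 1) * n ∧ 2 ^ (ww l + 1) < gp n
      ∧ ((Astar n : ℤ) : ZMod q) = a with hS
  have hs := h2 q hq hqK a S (by
    intro n hn
    obtain ⟨a1, a2, a3, a4⟩ := mem_filter.1 hn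
    obtain ⟨b1, b2⟩ := mem_Ioc.1 a1
    exact ⟨b1.ne', (Nat.le_floor_iff (by linarith)).1 b2, a2, a3, a4⟩)
  refine le_trans (Nat.cast_le.2 (card_le_card (t := ((Ioc 0 ⌊x⌋₊).filter fun n => (gp n ≤ 2 ^ (ww l + 1) ∨ ¬ good (2 ^ (jz l)) (k + 1) n)
      ∧ ((Astar n : ℤ) : ZMod q) = a) ∪ S) ?_)) ?_
  · intro n hn
    obtain ⟨a1, a2⟩ := mem_filter.1 hn
    obtain ⟨a3, a4⟩ := mem_sdiff.1 a1
    rw [mem_union, mem_filter, mem_filter]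
    rcases not_mem_GG h4 (show 0 < HH l by omega) a3 a4 with h | h
    · exact Or.inl ⟨a3, Or.inr h, a2⟩
    · by_cases hg : gp n ≤ 2 ^ (ww l + 1)
      · exact Or.inl ⟨a3, Or.inl hg, a2⟩
      · exact Or.inr ⟨a3, h, not_le.1 hg, a2⟩
  · refine le_trans (Nat.cast_le.2 (card_union_le _ _)) ?_
    push_cast
    linarith

theorem E_small_one (k : ℕ) (ε : ℝ) (hε : 0 < ε) : ∀ᶠ x : ℝ in atTop,
    ((Ioc 0 ⌊x⌋₊ \ GS k x).card : ℝ) ≤ ε * x := by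
  classical
  filter_upwards [E_small 1 le_rfl k ε hε, Real.tendsto_log_atTop.eventually (eventually_ge_atTop 1)] with x h1 h2
  have := h1 1 one_pos (by rw [Real.rpow_one]; exact_mod_cast h2) 0
  rw [filter_true_of_mem (fun n _ => Subsingleton.elim _ _)] at this
  simpa using this

theorem GS_sub {k : ℕ} {x : ℝ} (hx : 0 ≤ x) : GS k x ⊆ Ioc 0 ⌊x⌋₊ := GG_sub_Ioc hx

theorem norm_sum_ee_le (S : Finset ℕ) (α : ℝ) : ‖∑ n ∈ S, ee α (Astar n)‖ ≤ S.card := by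
  refine (norm_sum_le _ _).trans ?_
  simp_rw [ee_norm]
  rw [sum_const, nsmul_eq_mul, mul_one]

theorem freq_coprime (K : ℝ) (hK : 1 ≤ K) : ∃ k : ℕ, ∀ η : ℝ, 0 < η → ∀ᶠ x : ℝ in atTop,
    ∀ q : ℕ, 2 ≤ q → (q:ℝ) ≤ Real.log x ^ K → ∀ t : ℕ, t < q → t.Coprime q →
    ‖∑ n ∈ GS k x, ee (((t:ℤ):ℝ) / q) (Astar n)‖ ≤ η * x * ((q:ℝ) ^ 3)⁻¹ := by
  obtain ⟨C, hC, J, hhigh⟩ := high_GG (64 * K) (by linarith)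
  obtain ⟨k, hk⟩ := exists_nat_ge (16 * (64 * K))
  refine ⟨k, fun η hη => ?_⟩
  set B : ℝ := (2 * C) ^ (k + 1) with hB
  have hB0 : 0 < B := by positivity
  obtain ⟨Q0, hQ0⟩ := exists_nat_ge (max 1 (B / η))
  have hQ1 : (1:ℝ) ≤ Q0 := (le_max_left _ _).trans hQ0
  have hQB : B / η ≤ Q0 := (le_max_right _ _).trans hQ0
  set ε₁ : ℝ := η * ((Q0:ℝ) ^ 3)⁻¹ with hε₁
  have hε₁0 : 0 < ε₁ := by positivity
  have hlow : ∀ᶠ x : ℝ in atTop, ∀ q ∈ range (Q0 + 1), ∀ t ∈ range (Q0 + 1), 2 ≤ q → t.Coprime q →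
      ‖∑ n ∈ Ioc 0 ⌊x⌋₊, ee (((t:ℤ):ℝ) / q) (Astar n)‖ ≤ ε₁ / 2 * x := by
    rw [eventually_all_finset]
    intro q _
    rw [eventually_all_finset]
    intro t _
    by_cases h : 2 ≤ q ∧ t.Coprime q
    · filter_upwards [low_freq q h.1 (t:ℤ) (Nat.isCoprime_iff_coprime.2 h.2) (ε₁/2) (by linarith)] with x hx _ _
      exact hx
    · exact Eventually.of_forall fun x h1 h2 => absurd ⟨h1, h2⟩ h
  have T := Real.tendsto_log_atTop
  filter_upwards [hlow, E_small_one k (ε₁/2) (by linarith), T.eventually ev_HH,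
    T.eventually (tendsto_jz.eventually_ge_atTop J), T.eventually (eventually_ge_atTop 1), eventually_ge_atTop 1]
    with x h1 h2 h3 h4 h5 h6 q hq hqK t htq ht
  have hx0 : 0 ≤ x := by linarith
  have hq0 : (0:ℝ) < q := by exact_mod_cast (by omega : 0 < q)
  by_cases hqQ : q ≤ Q0
  · have g1 := h1 q (mem_range.2 (by omega)) t (mem_range.2 (by omega)) hq ht
    have hsub := GS_sub (k := k) hx0
    have e : ∑ n ∈ GS k x, ee (((t:ℤ):ℝ) / q) (Astar n) = ∑ n ∈ Ioc 0 ⌊x⌋₊, ee (((t:ℤ):ℝ) / q) (Astar n)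
        - ∑ n ∈ Ioc 0 ⌊x⌋₊ \ GS k x, ee (((t:ℤ):ℝ) / q) (Astar n) := by
      rw [← sum_sdiff hsub]; ring
    rw [e]
    have g2 := (norm_sub_le (∑ n ∈ Ioc 0 ⌊x⌋₊, ee (((t:ℤ):ℝ) / q) (Astar n))
      (∑ n ∈ Ioc 0 ⌊x⌋₊ \ GS k x, ee (((t:ℤ):ℝ) / q) (Astar n)))
    have g3 := norm_sum_ee_le (Ioc 0 ⌊x⌋₊ \ GS k x) (((t:ℤ):ℝ) / q)
    have g4 : ε₁ * x ≤ η * x * ((q:ℝ) ^ 3)⁻¹ := by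
      have hqQ' : (q:ℝ) ≤ Q0 := by exact_mod_cast hqQ
      calc ε₁ * x = η * x * ((Q0:ℝ) ^ 3)⁻¹ := by rw [hε₁]; ring
        _ ≤ _ := by gcongr
    linarith
  · have hqQ' : (Q0:ℝ) ≤ q := by exact_mod_cast (not_le.1 hqQ).le
    set l := Real.log x with hl
    have hl0 : 0 < l := by linarith
    have hl2 : (0.6931471803 : ℝ) < Real.log 2 := Real.log_two_gt_d9
    have hjl : l ^ (1/64:ℝ) ≤ jz l * Real.log 2 := by
      have a1 := Nat.le_ceil (l ^ (1/64:ℝ))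
      have a2 : 0 ≤ l ^ (1/64:ℝ) := by positivity
      unfold jz
      push_cast
      nlinarith
    have hp0 : 0 ≤ l ^ (1/64:ℝ) := by positivity
    have c1 : (2 * (HH l : ℝ)) ^ 4 ≤ jz l * Real.log 2 := by
      refine le_trans ?_ hjl
      calc (2 * (HH l : ℝ)) ^ 4 ≤ (l ^ (1/256:ℝ)) ^ 4 := pow_le_pow_left₀ (by positivity) h3.2.2 4
        _ = _ := by
          rw [← Real.rpow_natCast, ← Real.rpow_mul hl0.le]; norm_num
    have c2 : (q:ℝ) ≤ (jz l * Real.log 2) ^ (64 * K) := by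
      refine hqK.trans ?_
      calc l ^ K = (l ^ (1/64:ℝ)) ^ (64 * K) := by
            rw [← Real.rpow_mul hl0.le]; congr 1; ring
        _ ≤ _ := Real.rpow_le_rpow hp0 hjl (by linarith)
    have := hhigh (jz l) h4 (HH l) (by omega) c1 q (by omega) c2 (t:ℤ) (Nat.isCoprime_iff_coprime.2 ht) (k + 1) x (JJ l) hx0
    unfold GS
    refine this.trans ?_
    have hpow : ((q:ℝ) ^ (-(1 / (4 * (64 * K))))) ^ (k + 1) ≤ ((q:ℝ) ^ 4)⁻¹ := by
      rw [← Real.rpow_natCast, ← Real.rpow_mul hq0.le, ← Real.rpow_natCast (q:ℝ) 4, ← Real.rpow_neg hq0.le]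
      apply Real.rpow_le_rpow_of_exponent_le (by exact_mod_cast (by omega : 1 ≤ q))
      have : (4:ℝ) ≤ 1 / (4 * (64 * K)) * ((k + 1 : ℕ) : ℝ) := by
        rw [div_mul_eq_mul_div, one_mul, le_div_iff₀ (by linarith)]
        push_cast
        linarith
      push_cast at this ⊢
      linarith
    calc _ = B * ((q:ℝ) ^ (-(1 / (4 * (64 * K))))) ^ (k + 1) * x := by
          rw [hB, mul_pow, mul_pow]; ring
      _ ≤ B * ((q:ℝ) ^ 4)⁻¹ * x := by gcongr
      _ = B * (q:ℝ)⁻¹ * x * ((q:ℝ) ^ 3)⁻¹ := by field_simp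
      _ ≤ η * x * ((q:ℝ) ^ 3)⁻¹ := by
          refine mul_le_mul_of_nonneg_right (mul_le_mul_of_nonneg_right ?_ hx0) (by positivity)
          rw [← div_eq_mul_inv, div_le_iff₀ hq0]
          rw [div_le_iff₀ hη] at hQB
          calc B ≤ Q0 * η := hQB
            _ ≤ q * η := by gcongr
            _ = _ := mul_comm _ _

end D10

section D11
open Finset Filter Topology

theorem freq_all (K : ℝ) (hK : 1 ≤ K) : ∃ k : ℕ, ∀ η : ℝ, 0 < η → ∀ᶠ x : ℝ in atTop,
    ∀ q : ℕ, 0 < q → (q:ℝ) ≤ Real.log x ^ K →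
    ∑ t ∈ (range q).erase 0, ‖∑ n ∈ GS k x, ee (((t:ℤ):ℝ) / q) (Astar n)‖ ≤ 2 * η * x := by
  obtain ⟨k, hk⟩ := freq_coprime K hK
  refine ⟨k, fun η hη => ?_⟩
  filter_upwards [hk η hη, eventually_ge_atTop 0] with x h1 hx q hq hqK
  calc _ ≤ ∑ t ∈ (range q).erase 0, η * x * (((q / q.gcd t : ℕ) : ℝ) ^ 3)⁻¹ := by
        refine sum_le_sum fun t ht => ?_
        obtain ⟨ht0, ht1⟩ := mem_erase.1 ht
        have htq := mem_range.1 ht1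
        set d := q.gcd t with hd
        have hd0 : 0 < d := Nat.gcd_pos_of_pos_left _ hq
        obtain ⟨q', hq'⟩ : d ∣ q := Nat.gcd_dvd_left _ _
        obtain ⟨t', ht'⟩ : d ∣ t := Nat.gcd_dvd_right _ _
        have e1 : q / d = q' := by nth_rewrite 1 [hq']; exact Nat.mul_div_cancel_left _ hd0
        have e2 : t / d = t' := by nth_rewrite 1 [ht']; exact Nat.mul_div_cancel_left _ hd0
        have hcop : t'.Coprime q' := by
          rw [← e1, ← e2]
          exact (Nat.coprime_div_gcd_div_gcd hd0).symm
        have hlt : t' < q' := by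
          rw [hq', ht'] at htq
          exact Nat.lt_of_mul_lt_mul_left htq
        have ht'0 : 0 < t' := by
          rcases Nat.eq_zero_or_pos t' with h | h
          · rw [h, mul_zero] at ht'; exact absurd ht' ht0
          · exact h
        have hle : (q':ℝ) ≤ q := by
          rw [← e1]; exact_mod_cast Nat.div_le_self _ _
        have hdR : (0:ℝ) < d := by exact_mod_cast hd0
        have e3 : (((t:ℤ):ℝ) / q) = (((t':ℤ):ℝ) / q') := by
          have hq'0 : (0:ℝ) < q' := by exact_mod_cast (by omega : 0 < q')
          rw [hq']
          nth_rewrite 1 [ht']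
          push_cast
          field_simp
        rw [e3, e1]
        exact h1 q' (by omega) (hle.trans hqK) t' hlt hcop
    _ = η * x * ∑ t ∈ (range q).erase 0, (((q / q.gcd t : ℕ) : ℝ) ^ 3)⁻¹ := by rw [mul_sum]
    _ ≤ η * x * 2 := by
        refine mul_le_mul_of_nonneg_left ?_ (by positivity)
        refine le_trans ?_ (inv_cube_sum q hq)
        exact sum_le_sum_of_subset_of_nonneg (erase_subset _ _) fun _ _ _ => by positivity
    _ = _ := by ring

open Classical in
theorem class_count (q : ℕ) (hq : 0 < q) (a : ℤ) (G : Finset ℕ) (R : ℝ)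
    (hR : ∑ t ∈ (range q).erase 0, ‖∑ n ∈ G, ee (((t:ℤ):ℝ) / q) (Astar n)‖ ≤ R) :
    |(q:ℝ) * (G.filter fun n => ((Astar n : ℤ) : ZMod q) = (a : ZMod q)).card - G.card| ≤ R := by
  have h1 : ((q:ℂ) * (G.filter fun n => ((Astar n : ℤ) : ZMod q) = (a : ZMod q)).card) =
      ∑ t ∈ range q, ∑ n ∈ G, ee (((t:ℤ):ℝ) / q) (Astar n - a) := by
    rw [sum_comm]
    simp_rw [ee_orth q hq]
    rw [← sum_filter, sum_const, nsmul_eq_mul, mul_comm]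
    congr 3
    apply filter_congr
    intro n _
    push_cast
    rw [sub_eq_zero]
  rw [← add_sum_erase _ _ (mem_range.2 hq)] at h1
  have h0 : ∑ n ∈ G, ee ((((0:ℕ):ℤ):ℝ) / q) (Astar n - a) = G.card := by
    simp [ee]
  rw [h0] at h1
  have h2 : (((q:ℝ) * (G.filter fun n => ((Astar n : ℤ) : ZMod q) = (a : ZMod q)).card - G.card : ℝ) : ℂ) =
      ∑ t ∈ (range q).erase 0, ∑ n ∈ G, ee (((t:ℤ):ℝ) / q) (Astar n - a) := by
    push_cast
    rw [h1, add_sub_cancel_left]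
    push_cast
    rfl
  rw [← Real.norm_eq_abs, ← Complex.norm_real, h2]
  refine (norm_sum_le _ _).trans (le_trans (le_of_eq ?_) hR)
  refine sum_congr rfl fun t _ => ?_
  simp_rw [ee_sub]
  rw [← sum_mul, norm_mul, RCLike.norm_conj, ee_norm, mul_one]

theorem final_main (K : ℝ) (hK : 1 ≤ K) :
    ∀ ε : ℝ, 0 < ε → ∃ x₀ : ℝ, ∀ x : ℝ, x₀ ≤ x →
      ∀ q : ℕ, 0 < q → (q : ℝ) ≤ Real.log x ^ K →
        ∀ a : ℤ,
          |(cnt x (fun n => Astar n ≡ a [ZMOD (q : ℤ)]) : ℝ) - x / q| ≤ ε * (x / q) := by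
  classical
  intro ε hε
  obtain ⟨k, hk⟩ := freq_all K hK
  have hη : 0 < ε / 5 := by linarith
  obtain ⟨x₀, hx₀⟩ := eventually_atTop.1 ((hk (ε/5) hη).and ((E_small K hK k (ε/5) hη).and
    ((E_small_one k (ε/5) hη).and (eventually_ge_atTop (max 1 (5/ε))))))
  refine ⟨x₀, fun x hx q hq hqK a => ?_⟩
  obtain ⟨h1, h2, h3, h4⟩ := hx₀ x hx
  have hx1 : 1 ≤ x := (le_max_left _ _).trans h4
  have hx2 : 5 / ε ≤ x := (le_max_right _ _).trans h4
  have hx0 : 0 ≤ x := by linarith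
  have hq0 : (0:ℝ) < q := by exact_mod_cast hq
  have hsub := GS_sub (k := k) hx0
  have c1 := class_count q hq a (GS k x) _ (h1 q hq hqK)
  have c2 := h2 q hq hqK (a : ZMod q)
  set NG := ((GS k x).filter fun n => ((Astar n : ℤ) : ZMod q) = (a : ZMod q)).card with hNG
  set NE := ((Ioc 0 ⌊x⌋₊ \ GS k x).filter fun n => ((Astar n : ℤ) : ZMod q) = (a : ZMod q)).card with hNE
  have hcnt : cnt x (fun n => Astar n ≡ a [ZMOD (q : ℤ)]) = NE + NG := by
    have e : {n : ℕ | 0 < n ∧ (n : ℝ) ≤ x ∧ Astar n ≡ a [ZMOD (q : ℤ)]} =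
        ((Ioc 0 ⌊x⌋₊).filter fun n => ((Astar n : ℤ) : ZMod q) = (a : ZMod q) : Finset ℕ) := by
      ext n
      rw [coe_filter, Set.mem_ofPred_eq, Set.mem_ofPred_eq, mem_Ioc, Nat.le_floor_iff hx0, ZMod.intCast_eq_intCast_iff, and_assoc]
    rw [cnt, e, Set.ncard_coe_finset, hNE, hNG, ← card_union_of_disjoint, ← filter_union, sdiff_union_of_subset hsub]
    exact disjoint_filter_filter sdiff_disjoint
  have hcard : ((Ioc 0 ⌊x⌋₊ \ GS k x).card : ℝ) + (GS k x).card = ⌊x⌋₊ := by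
    have := card_sdiff_add_card_eq_card hsub
    rw [Nat.card_Ioc, Nat.sub_zero] at this
    exact_mod_cast this
  have f1 := Nat.floor_le hx0
  have f2 := Nat.lt_floor_add_one x
  have f3 : 1 ≤ ε / 5 * x := by
    rw [div_le_iff₀ hε] at hx2; linarith
  have c0 : (0:ℝ) ≤ ((Ioc 0 ⌊x⌋₊ \ GS k x).card : ℝ) := Nat.cast_nonneg _
  have c3 : (q:ℝ) * NE ≤ ε / 5 * x := by
    rw [← mul_div_assoc, le_div_iff₀ hq0] at c2; linarith
  have c4 : (0:ℝ) ≤ (q:ℝ) * NE := by positivity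
  rw [hcnt]
  obtain ⟨d1, d2⟩ := abs_le.1 c1
  have key : |(q:ℝ) * ((NE:ℝ) + NG) - x| ≤ ε * x := by
    rw [abs_le]
    constructor <;> linarith
  have e2 : (((NE + NG : ℕ) : ℝ) - x / q) = ((q:ℝ) * ((NE:ℝ) + NG) - x) / q := by
    push_cast; field_simp
  rw [e2, abs_div, abs_of_pos hq0, ← mul_div_assoc]
  exact div_le_div_of_nonneg_right key hq0.le

end D11

/-- **Theorem 6.1 for `A*`.** Fix `K ≥ 1`. The alternating sum of prime divisors function
`A*(n)` is asymptotically uniformly distributed modulo `q`, uniformly for `q ≤ (log x)^K`. -/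
theorem stmt19 (K : ℝ) (hK : 1 ≤ K) :
    ∀ ε : ℝ, 0 < ε → ∃ x₀ : ℝ, ∀ x : ℝ, x₀ ≤ x →
      ∀ q : ℕ, 0 < q → (q : ℝ) ≤ Real.log x ^ K →
        ∀ a : ℤ,
          |(cnt x (fun n => Astar n ≡ a [ZMOD (q : ℤ)]) : ℝ) - x / q| ≤ ε * (x / q) := by
  exact final_main K hK
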